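/- There is a polynomial P_5 with real coefficients of degree 9 such that for every ε > 0, N_5(B) = B · P_5(log B) + O_ε(B^{33/34 + ε}) as B → ∞; i.e., for each ε > 0 there is C(ε) > 0 with |N_5(B) − B·P_5(log B)| ≤ C(ε) · B^{33/34 + ε} for all large B. -/

import Mathlib

/-- `N_d(B)`: the number of orders of `ℤ^d` (unital subrings of the ring `Fin d → ℤ`
with componentwise operations, of finite additive index) whose additive index is at
most `B`. -/
noncomputable def numOrdersZ (d : ℕ) (B : ℝ) : ℕ :=
  Nat.card {O : Subring (Fin d → ℤ) //
    O.toAddSubgroup.index ≠ 0 ∧ (O.toAddSubgroup.index : ℝ) ≤ B}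

section

open Finset

/-- `F x = O(x ^ (-s))` on `[1, ∞)` for every `s < σ`. -/
def ErrO (σ : ℝ) (F : ℝ → ℝ) : Prop :=
  ∀ s < σ, ∃ C : ℝ, ∀ x : ℝ, 1 ≤ x → |F x| ≤ C * x ^ (-s)

/-- `F` is a polynomial of degree at most `D` in `log x`, up to an error `O(x ^ (-s))`
for every `s < σ`. -/
def PolyLog (D : ℕ) (σ : ℝ) (F : ℝ → ℝ) : Prop :=
  ∃ P : Polynomial ℝ, P.natDegree ≤ D ∧ ErrO σ (fun x => F x - P.eval (Real.log x))

namespace ErrO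

theorem congr {σ : ℝ} {F G : ℝ → ℝ} (h : ErrO σ F) (hFG : ∀ x, 1 ≤ x → G x = F x) :
    ErrO σ G := by
  intro s hs
  obtain ⟨C, hC⟩ := h s hs
  exact ⟨C, fun x hx => by rw [hFG x hx]; exact hC x hx⟩

theorem of_le {σ : ℝ} {F G : ℝ → ℝ} (h : ErrO σ F) (C₀ : ℝ)
    (hFG : ∀ x, 1 ≤ x → |G x| ≤ C₀ * |F x|) : ErrO σ G := by
  intro s hs
  obtain ⟨C, hC⟩ := h s hs
  refine ⟨|C₀| * C, fun x hx => (hFG x hx).trans ?_⟩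
  rw [mul_assoc]
  exact mul_le_mul (le_abs_self _) (hC x hx) (abs_nonneg _) (abs_nonneg _)

theorem nonneg_const {σ : ℝ} {F : ℝ → ℝ} (h : ErrO σ F) {s : ℝ} (hs : s < σ) :
    ∃ C : ℝ, 0 ≤ C ∧ ∀ x : ℝ, 1 ≤ x → |F x| ≤ C * x ^ (-s) := by
  obtain ⟨C, hC⟩ := h s hs
  refine ⟨C, ?_, hC⟩
  have := hC 1 le_rfl
  simp only [Real.one_rpow, mul_one] at this
  exact (abs_nonneg _).trans this

theorem mono {σ τ : ℝ} {F : ℝ → ℝ} (h : ErrO σ F) (hτ : τ ≤ σ) : ErrO τ F :=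
  fun s hs => h s (hs.trans_le hτ)

theorem add {σ : ℝ} {F G : ℝ → ℝ} (hF : ErrO σ F) (hG : ErrO σ G) :
    ErrO σ (fun x => F x + G x) := by
  intro s hs
  obtain ⟨C, hC⟩ := hF s hs
  obtain ⟨C', hC'⟩ := hG s hs
  refine ⟨C + C', fun x hx => (abs_add_le _ _).trans ?_⟩
  rw [add_mul]
  exact add_le_add (hC x hx) (hC' x hx)

theorem mul {σ τ : ℝ} {F G : ℝ → ℝ} (hF : ErrO σ F) (hG : ErrO τ G) :
    ErrO (σ + τ) (fun x => F x * G x) := by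
  intro s hs
  obtain ⟨C, hC0, hC⟩ := hF.nonneg_const (s := σ - (σ + τ - s) / 2) (by linarith)
  obtain ⟨C', hC0', hC'⟩ := hG.nonneg_const (s := τ - (σ + τ - s) / 2) (by linarith)
  refine ⟨C * C', fun x hx => ?_⟩
  have hx0 : 0 < x := by linarith
  have e : x ^ (-s) = x ^ (-(σ - (σ + τ - s) / 2)) * x ^ (-(τ - (σ + τ - s) / 2)) := by
    rw [← Real.rpow_add hx0]; congr 1; ring
  rw [abs_mul, e]
  calc |F x| * |G x| ≤ _ := mul_le_mul (hC x hx) (hC' x hx) (abs_nonneg _)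
        (mul_nonneg hC0 (Real.rpow_nonneg hx0.le _))
    _ = _ := by ring

theorem const (c : ℝ) : ErrO 0 (fun _ => c) := by
  intro s hs
  refine ⟨|c|, fun x hx => ?_⟩
  have : 1 ≤ x ^ (-s) := Real.one_le_rpow hx (by linarith)
  nlinarith [abs_nonneg c]

theorem const_mul {σ : ℝ} {F : ℝ → ℝ} (h : ErrO σ F) (c : ℝ) : ErrO σ (fun x => c * F x) :=
  ((ErrO.const c).mul h).mono (by simp)

theorem log : ErrO 0 Real.log := by
  intro s hs
  refine ⟨(-s)⁻¹, fun x hx => ?_⟩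
  have h := Real.log_le_rpow_div (x := x) (by linarith) (ε := -s) (by linarith)
  rw [abs_of_nonneg (Real.log_nonneg hx), mul_comm]
  simpa [div_eq_mul_inv] using h

theorem log_pow (k : ℕ) : ErrO 0 (fun x => Real.log x ^ k) := by
  induction k with
  | zero => simpa using const 1
  | succ k ih => simpa [pow_succ] using ih.mul log

theorem sum {ι : Type*} {σ : ℝ} {F : ι → ℝ → ℝ} (s : Finset ι) (h : ∀ i ∈ s, ErrO σ (F i)) :
    ErrO σ (fun x => ∑ i ∈ s, F i x) := by
  classical
  induction s using Finset.induction_on with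
  | empty => intro t _; exact ⟨0, fun x _ => by simp⟩
  | insert a s ha ih =>
    simp_rw [Finset.sum_insert ha]
    exact (h a (by simp)).add (ih fun i hi => h i (by simp [hi]))

theorem poly (P : Polynomial ℝ) : ErrO 0 (fun x => P.eval (Real.log x)) := by
  simp_rw [Polynomial.eval_eq_sum_range]
  exact ErrO.sum _ fun i _ => (log_pow i).const_mul _

theorem rpow_neg (a : ℝ) : ErrO a (fun x => x ^ (-a)) := by
  intro s hs
  refine ⟨1, fun x hx => ?_⟩
  rw [abs_of_nonneg (Real.rpow_nonneg (by linarith) _), one_mul]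
  exact Real.rpow_le_rpow_of_exponent_le hx (by linarith)

theorem comp_rpow {σ : ℝ} {F : ℝ → ℝ} (h : ErrO σ F) {c : ℝ} (hc : 0 < c) :
    ErrO (c * σ) (fun x => F (x ^ c)) := by
  intro s hs
  obtain ⟨C, hC⟩ := h (s / c) (by rwa [div_lt_iff₀ hc, mul_comm])
  refine ⟨C, fun x hx => (hC _ (Real.one_le_rpow hx hc.le)).trans (le_of_eq ?_)⟩
  rw [← Real.rpow_mul (by linarith)]
  congr 2
  field_simp

end ErrO

namespace PolyLog

theorem congr {D : ℕ} {σ : ℝ} {F G : ℝ → ℝ} (h : PolyLog D σ F)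
    (hFG : ∀ x, 1 ≤ x → G x = F x) : PolyLog D σ G := by
  obtain ⟨P, hP, hE⟩ := h
  exact ⟨P, hP, hE.congr fun x hx => by rw [hFG x hx]⟩

theorem mono {D D' : ℕ} {σ τ : ℝ} {F : ℝ → ℝ} (h : PolyLog D σ F) (hD : D ≤ D') (hτ : τ ≤ σ) :
    PolyLog D' τ F := by
  obtain ⟨P, hP, hE⟩ := h
  exact ⟨P, hP.trans hD, hE.mono hτ⟩

theorem of_errO {σ : ℝ} {F : ℝ → ℝ} (h : ErrO σ F) : PolyLog 0 σ F :=
  ⟨0, by simp, by simpa using h⟩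

theorem add {D : ℕ} {σ : ℝ} {F G : ℝ → ℝ} (hF : PolyLog D σ F) (hG : PolyLog D σ G) :
    PolyLog D σ (fun x => F x + G x) := by
  obtain ⟨P, hP, hE⟩ := hF
  obtain ⟨Q, hQ, hE'⟩ := hG
  refine ⟨P + Q, (Polynomial.natDegree_add_le _ _).trans (max_le hP hQ),
    (hE.add hE').congr fun x _ => ?_⟩
  simp only [Polynomial.eval_add]; ring

theorem polyLog_mul {D k : ℕ} {σ : ℝ} {F : ℝ → ℝ} (hF : PolyLog D σ F) {Q : Polynomial ℝ}
    (hQ : Q.natDegree ≤ k) : PolyLog (k + D) σ (fun x => Q.eval (Real.log x) * F x) := by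
  obtain ⟨P, hP, hE⟩ := hF
  refine ⟨Q * P, Polynomial.natDegree_mul_le.trans (add_le_add hQ hP),
    (((ErrO.poly Q).mul hE).mono (by simp)).congr fun x _ => ?_⟩
  simp only [Polynomial.eval_mul]; ring

theorem log_pow_mul {D : ℕ} {σ : ℝ} {F : ℝ → ℝ} (hF : PolyLog D σ F) (k : ℕ) :
    PolyLog (k + D) σ (fun x => Real.log x ^ k * F x) := by
  simpa using hF.polyLog_mul (Q := Polynomial.X ^ k) (k := k) (by simp)

theorem const_mul {D : ℕ} {σ : ℝ} {F : ℝ → ℝ} (hF : PolyLog D σ F) (c : ℝ) :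
    PolyLog D σ (fun x => c * F x) := by
  simpa using hF.polyLog_mul (Q := Polynomial.C c) (k := 0) (by simp)

theorem sub {D : ℕ} {σ : ℝ} {F G : ℝ → ℝ} (hF : PolyLog D σ F) (hG : PolyLog D σ G) :
    PolyLog D σ (fun x => F x - G x) :=
  (hF.add (hG.const_mul (-1))).congr fun x _ => by ring

theorem sum {ι : Type*} {D : ℕ} {σ : ℝ} {F : ι → ℝ → ℝ} (s : Finset ι)
    (h : ∀ i ∈ s, PolyLog D σ (F i)) : PolyLog D σ (fun x => ∑ i ∈ s, F i x) := by
  classical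
  induction s using Finset.induction_on with
  | empty => exact ⟨0, by simp, fun t _ => ⟨0, fun x _ => by simp⟩⟩
  | insert a s ha ih =>
    simp_rw [Finset.sum_insert ha]
    exact (h a (by simp)).add (ih fun i hi => h i (by simp [hi]))

theorem comp_rpow {D : ℕ} {σ : ℝ} {F : ℝ → ℝ} (h : PolyLog D σ F) {c : ℝ} (hc : 0 < c) :
    PolyLog D (c * σ) (fun x => F (x ^ c)) := by
  obtain ⟨P, hP, hE⟩ := h
  refine ⟨P.comp (Polynomial.C c * Polynomial.X), ?_, (hE.comp_rpow hc).congr fun x hx => ?_⟩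
  · refine Polynomial.natDegree_comp_le.trans ?_
    have : (Polynomial.C c * Polynomial.X).natDegree ≤ 1 := by
      simpa using Polynomial.natDegree_C_mul_X_pow_le c 1
    nlinarith
  · simp [Real.log_rpow (show 0 < x by linarith)]

theorem errO {D : ℕ} {σ : ℝ} (hσ : 0 ≤ σ) {F : ℝ → ℝ} (h : PolyLog D σ F) : ErrO 0 F := by
  obtain ⟨P, hP, hE⟩ := h
  exact ((hE.mono hσ).add (ErrO.poly P)).congr fun x _ => by ring

/-- Convolution-type sums of a polynomial in `log (x / m)`. -/
theorem sum_eval_log_sub {β : ℕ → ℝ} {D : ℕ} {σ c : ℝ} (hc : 0 < c)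
    (h : ∀ l : ℕ, PolyLog (D + l) σ
      (fun z => ∑ m ∈ Ioc 0 ⌊z⌋₊, β m / m * Real.log m ^ l))
    (P : Polynomial ℝ) :
    PolyLog (D + P.natDegree) (c * σ)
      (fun x => ∑ m ∈ Ioc 0 ⌊x ^ c⌋₊, β m / m * P.eval (Real.log x - Real.log m)) := by
  have key : ∀ k ≤ P.natDegree, PolyLog (D + P.natDegree) (c * σ)
      (fun x => ∑ l ∈ range (k + 1), ((-1) ^ (l + k) * (k.choose l : ℝ) * P.coeff k * (-1) ^ k) *
        (Real.log x ^ (k - l) * ∑ m ∈ Ioc 0 ⌊x ^ c⌋₊, β m / m * Real.log m ^ l)) := by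
    intro k hk
    refine PolyLog.sum _ fun l hl => ?_
    have hl : l ≤ k := by simpa [Nat.lt_succ_iff] using hl
    exact ((((h l).comp_rpow hc).log_pow_mul (k - l)).mono (by omega) le_rfl).const_mul _
  refine (PolyLog.sum (range (P.natDegree + 1)) (fun k hk => key k ?_)).congr fun x hx => ?_
  · simpa [Nat.lt_succ_iff] using hk
  · simp_rw [Polynomial.eval_eq_sum_range, Finset.mul_sum]
    rw [Finset.sum_comm]
    refine Finset.sum_congr rfl fun k _ => ?_
    rw [Finset.sum_comm]
    refine Finset.sum_congr rfl fun m _ => ?_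
    rw [sub_eq_neg_add, add_pow, Finset.mul_sum, Finset.mul_sum]
    refine Finset.sum_congr rfl fun l _ => ?_
    rw [neg_pow, pow_add]
    have : ((-1 : ℝ) ^ k) * (-1) ^ k = 1 := by rw [← mul_pow]; simp
    linear_combination (-((-1 : ℝ) ^ l * (k.choose l : ℝ) * P.coeff k *
        (Real.log x ^ (k - l) * (β m / m * Real.log m ^ l)))) * this

end PolyLog

theorem Polynomial.exists_derivative_eq (P : Polynomial ℝ) :
    ∃ Q : Polynomial ℝ, Q.natDegree ≤ P.natDegree + 1 ∧ Polynomial.derivative Q = P := by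
  refine ⟨∑ k ∈ range (P.natDegree + 1), Polynomial.monomial (k + 1) (P.coeff k / (k + 1)),
    ?_, ?_⟩
  · refine Polynomial.natDegree_sum_le_of_forall_le _ _ fun k hk => ?_
    refine (Polynomial.natDegree_monomial_le _).trans ?_
    have := Finset.mem_range.1 hk
    omega
  · rw [Polynomial.derivative_sum]
    conv_rhs => rw [P.as_sum_range' (P.natDegree + 1) (Nat.lt_succ_self _)]
    refine Finset.sum_congr rfl fun k _ => ?_
    rw [Polynomial.derivative_monomial]
    have : ((k : ℝ) + 1) ≠ 0 := by positivity
    simp [div_mul_cancel₀ _ this]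

theorem integral_polynomial_log_div (Q : Polynomial ℝ) {y : ℝ} (hy : 1 ≤ y) :
    ∫ t in (1 : ℝ)..y, (Polynomial.derivative Q).eval (Real.log t) / t =
      Q.eval (Real.log y) - Q.eval 0 := by
  have hpos : ∀ t ∈ Set.uIcc 1 y, 0 < t := by
    intro t ht
    rw [Set.uIcc_of_le hy] at ht
    linarith [ht.1]
  have := intervalIntegral.integral_eq_sub_of_hasDerivAt (a := 1) (b := y)
    (f := fun t => Q.eval (Real.log t))
    (f' := fun t => (Polynomial.derivative Q).eval (Real.log t) / t) ?_ ?_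
  · simpa using this
  · intro t ht
    have := (Q.hasDerivAt (Real.log t)).comp t (Real.hasDerivAt_log (hpos t ht).ne')
    rw [div_eq_mul_inv]; exact this
  · apply ContinuousOn.intervalIntegrable
    refine ContinuousOn.div (Q.derivative.continuous.comp_continuousOn ?_) continuousOn_id
      fun t ht => (hpos t ht).ne'
    exact Real.continuousOn_log.mono fun t ht => (hpos t ht).ne'

theorem ErrO.integral {σ : ℝ} (hσ : 0 < σ) {E : ℝ → ℝ} (h : ErrO σ E)
    (hint : ∀ y, MeasureTheory.IntegrableOn (fun t => E t / t) (Set.Ioc 1 y)) :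
    ∃ c : ℝ, ErrO σ (fun y => (∫ t in Set.Ioc 1 y, E t / t) - c) := by
  have hbd : ∀ s, 0 < s → s < σ → ∃ C, 0 ≤ C ∧ ∀ t : ℝ, 1 ≤ t → ‖E t / t‖ ≤ C * t ^ (-s - 1) := by
    intro s _ hs
    obtain ⟨C, hC0, hC⟩ := h.nonneg_const hs
    refine ⟨C, hC0, fun t ht => ?_⟩
    have ht0 : 0 < t := by linarith
    rw [norm_div, Real.norm_eq_abs, Real.norm_eq_abs, abs_of_pos ht0, Real.rpow_sub ht0,
      Real.rpow_one, ← mul_div_assoc]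
    exact div_le_div_of_nonneg_right (hC t ht) ht0.le
  have hmeas : MeasureTheory.AEStronglyMeasurable (fun t => E t / t)
      (MeasureTheory.volume.restrict (Set.Ioi 1)) := by
    have hU : Set.Ioi (1 : ℝ) = ⋃ n : ℕ, Set.Ioc 1 (n : ℝ) := by
      ext t
      simp only [Set.mem_Ioi, Set.mem_iUnion, Set.mem_Ioc, exists_and_left, iff_self_and]
      exact fun _ => exists_nat_ge t
    rw [hU, aestronglyMeasurable_iUnion_iff]
    exact fun n => (hint n).aestronglyMeasurable
  have hI : MeasureTheory.IntegrableOn (fun t => E t / t) (Set.Ioi 1) := by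
    obtain ⟨C, hC0, hC⟩ := hbd (σ / 2) (by linarith) (by linarith)
    refine MeasureTheory.Integrable.mono'
      ((integrableOn_Ioi_rpow_of_lt (a := -(σ / 2) - 1) (by linarith) one_pos).const_mul C)
      hmeas ?_
    refine (MeasureTheory.ae_restrict_iff' measurableSet_Ioi).2 (.of_forall fun t ht => ?_)
    exact hC t (le_of_lt ht)
  refine ⟨∫ t in Set.Ioi 1, E t / t, ?_⟩
  suffices H : ∀ s, 0 < s → s < σ → ∃ C : ℝ, ∀ x : ℝ, 1 ≤ x →
      |(∫ t in Set.Ioc 1 x, E t / t) - ∫ t in Set.Ioi 1, E t / t| ≤ C * x ^ (-s) by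
    intro s hs
    obtain ⟨C, hC⟩ := H (max s (σ / 2)) (by positivity) (max_lt hs (by linarith))
    refine ⟨|C|, fun x hx => (hC x hx).trans ?_⟩
    refine mul_le_mul (le_abs_self _) ?_ (Real.rpow_nonneg (by linarith) _) (abs_nonneg _)
    exact Real.rpow_le_rpow_of_exponent_le hx (by simp)
  intro s hs0 hs
  obtain ⟨C, hC0, hC⟩ := hbd s hs0 hs
  refine ⟨C / s, fun x hx => ?_⟩
  have hx0 : 0 < x := by linarith
  have hsplit : ∫ t in Set.Ioi 1, E t / t =
      (∫ t in Set.Ioc 1 x, E t / t) + ∫ t in Set.Ioi x, E t / t := by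
    rw [← MeasureTheory.setIntegral_union _ measurableSet_Ioi (hint x)
      (hI.mono_set (Set.Ioi_subset_Ioi hx)), Set.Ioc_union_Ioi_eq_Ioi hx]
    exact Set.disjoint_left.2 fun t ht ht' => absurd ht.2 (not_le.2 ht')
  rw [hsplit, sub_add_cancel_left, abs_neg, ← Real.norm_eq_abs]
  calc ‖∫ t in Set.Ioi x, E t / t‖ ≤ ∫ t in Set.Ioi x, C * t ^ (-s - 1) := by
        refine MeasureTheory.norm_integral_le_of_norm_le
          ((integrableOn_Ioi_rpow_of_lt (a := -s - 1) (by linarith) hx0).const_mul C) ?_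
        refine (MeasureTheory.ae_restrict_iff' measurableSet_Ioi).2 (.of_forall fun t ht => ?_)
        exact hC t (hx.trans (le_of_lt ht))
    _ = C / s * x ^ (-s) := by
        rw [MeasureTheory.integral_const_mul, integral_Ioi_rpow_of_lt (by linarith) hx0]
        have : -s - 1 + 1 = -s := by ring
        rw [this]
        field_simp

theorem PolyLog.integral {D : ℕ} {σ : ℝ} (hσ : 0 < σ) {F : ℝ → ℝ} (h : PolyLog D σ F)
    (hint : ∀ y, MeasureTheory.IntegrableOn (fun t => F t / t) (Set.Ioc 1 y)) :
    PolyLog (D + 1) σ (fun y => ∫ t in Set.Ioc 1 y, F t / t) := by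
  obtain ⟨P, hP, hE⟩ := h
  obtain ⟨Q, hQ, rfl⟩ := P.exists_derivative_eq
  have hcont : ∀ y, MeasureTheory.IntegrableOn
      (fun t => Q.derivative.eval (Real.log t) / t) (Set.Ioc 1 y) := by
    intro y
    refine (ContinuousOn.integrableOn_Icc ?_).mono_set Set.Ioc_subset_Icc_self
    have hpos : ∀ t ∈ Set.Icc 1 y, t ≠ 0 := fun t ht => by linarith [ht.1]
    exact ContinuousOn.div (Q.derivative.continuous.comp_continuousOn
      (Real.continuousOn_log.mono hpos)) continuousOn_id hpos
  obtain ⟨c, hc⟩ := hE.integral hσ fun y => by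
    simp_rw [sub_div]; exact (hint y).sub (hcont y)
  refine ⟨Q - Polynomial.C (Q.eval 0) + Polynomial.C c, ?_, hc.congr fun y hy => ?_⟩
  · refine (Polynomial.natDegree_add_C).le.trans ?_
    rw [Polynomial.natDegree_sub_C]
    omega
  · have h1 := integral_polynomial_log_div Q hy
    rw [intervalIntegral.integral_of_le hy] at h1
    simp_rw [sub_div]
    rw [MeasureTheory.integral_sub (hint y) (hcont y), h1]
    simp only [Polynomial.eval_add, Polynomial.eval_sub, Polynomial.eval_C]
    ring

theorem sum_Icc_zero_eq_sum_Ioc {c : ℕ → ℝ} (hc : c 0 = 0) (n : ℕ) :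
    ∑ k ∈ Icc 0 n, c k = ∑ k ∈ Ioc 0 n, c k := by
  rw [← Finset.add_sum_Ioc_eq_sum_Icc (Nat.zero_le n), hc, zero_add]

theorem hasDerivAt_log_pow_div (l : ℕ) {t : ℝ} (ht : 0 < t) :
    HasDerivAt (fun t => Real.log t ^ l / t)
      ((l * Real.log t ^ (l - 1) - Real.log t ^ l) / t ^ 2) t := by
  have h := ((Real.hasDerivAt_log ht.ne').pow l).div (hasDerivAt_id t) ht.ne'
  have e : (l * Real.log t ^ (l - 1) - Real.log t ^ l) / t ^ 2 =
      (l * Real.log t ^ (l - 1) * t⁻¹ * id t - (Real.log ^ l) t * 1) / id t ^ 2 := by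
    simp only [id, Pi.pow_apply]
    field_simp
  rw [e]
  exact h

/-- Partial summation with the weights `(log n) ^ l / n`. -/
theorem PolyLog.sum_log_pow_div {α : ℕ → ℝ} (hα : α 0 = 0) {D : ℕ} {σ : ℝ} (hσ : 0 < σ)
    (h : PolyLog D σ (fun x => (∑ n ∈ Ioc 0 ⌊x⌋₊, α n) / x)) (l : ℕ) :
    PolyLog (D + 1 + l) σ (fun z => ∑ m ∈ Ioc 0 ⌊z⌋₊, α m / m * Real.log m ^ l) := by
  set A : ℝ → ℝ := fun x => ∑ n ∈ Ioc 0 ⌊x⌋₊, α n with hA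
  set ψ : Polynomial ℝ := Polynomial.C (l : ℝ) * Polynomial.X ^ (l - 1) - Polynomial.X ^ l with hψ
  have hψd : ψ.natDegree ≤ l := by
    refine (Polynomial.natDegree_sub_le _ _).trans (max_le ?_ (by simp))
    exact (Polynomial.natDegree_C_mul_X_pow_le _ _).trans (by omega)
  have hψe : ∀ u, ψ.eval u = l * u ^ (l - 1) - u ^ l := by intro u; simp [hψ]
  have hcont : ∀ y, ContinuousOn (fun t : ℝ => ψ.eval (Real.log t) / t ^ 2) (Set.Icc 1 y) := by
    intro y
    have hpos : ∀ t ∈ Set.Icc 1 y, t ≠ 0 := fun t ht => by linarith [ht.1]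
    exact ContinuousOn.div (ψ.continuous.comp_continuousOn (Real.continuousOn_log.mono hpos))
      (continuousOn_pow 2) fun t ht => pow_ne_zero _ (hpos t ht)
  have hint : ∀ y, MeasureTheory.IntegrableOn
      (fun t => ψ.eval (Real.log t) * (A t / t) / t) (Set.Ioc 1 y) := by
    intro y
    have := (integrableOn_mul_sum_Icc (m := 0) α zero_le_one
      (hcont y).integrableOn_Icc).mono_set Set.Ioc_subset_Icc_self
    refine this.congr_fun (fun t ht => ?_) measurableSet_Ioc
    have : t ≠ 0 := by linarith [ht.1]
    simp only [hA]
    rw [sum_Icc_zero_eq_sum_Ioc hα]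
    field_simp
  have h1 := (h.polyLog_mul hψd).integral hσ hint
  have h2 := h.log_pow_mul l
  refine ((h2.mono (by omega) le_rfl).sub (h1.mono (by omega) le_rfl)).congr fun z hz => ?_
  have hderiv : ∀ t ∈ Set.Icc 1 z, HasDerivAt (fun t => Real.log t ^ l / t)
      (ψ.eval (Real.log t) / t ^ 2) t := fun t ht => by
    rw [hψe]; exact hasDerivAt_log_pow_div l (by linarith [ht.1])
  have habel := sum_mul_eq_sub_integral_mul₀ (f := fun t => Real.log t ^ l / t) α hα z
    (fun t ht => (hderiv t ht).differentiableAt)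
    ((hcont z).integrableOn_Icc.congr_fun (fun t ht => (hderiv t ht).deriv.symm)
      measurableSet_Icc)
  rw [sum_Icc_zero_eq_sum_Ioc (c := fun k => Real.log k ^ l / k * α k) (by simp [hα]),
    sum_Icc_zero_eq_sum_Ioc hα] at habel
  have e1 : ∫ t in Set.Ioc 1 z, deriv (fun t => Real.log t ^ l / t) t * ∑ k ∈ Icc 0 ⌊t⌋₊, α k =
      ∫ t in Set.Ioc 1 z, ψ.eval (Real.log t) * (A t / t) / t := by
    refine MeasureTheory.setIntegral_congr_fun measurableSet_Ioc fun t ht => ?_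
    have : t ≠ 0 := by linarith [ht.1]
    rw [(hderiv t (Set.Ioc_subset_Icc_self ht)).deriv, sum_Icc_zero_eq_sum_Ioc hα]
    simp only [hA]
    field_simp
  rw [e1] at habel
  calc _ = ∑ k ∈ Ioc 0 ⌊z⌋₊, Real.log k ^ l / k * α k :=
        Finset.sum_congr rfl fun k _ => by ring
    _ = _ := by rw [habel]; ring

/-- The summatory function of an arithmetic function. -/
noncomputable def summatory (a : ArithmeticFunction ℝ) (x : ℝ) : ℝ := ∑ n ∈ Ioc 0 ⌊x⌋₊, a n

theorem summatory_nonneg {a : ArithmeticFunction ℝ} (ha : ∀ n, 0 ≤ a n) (x : ℝ) :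
    0 ≤ summatory a x := Finset.sum_nonneg fun n _ => ha n

theorem summatory_mul (a b : ArithmeticFunction ℝ) (x : ℝ) :
    summatory (a * b) x = ∑ m ∈ Ioc 0 ⌊x⌋₊, a m * summatory b (x / m) := by
  simp only [summatory, ArithmeticFunction.sum_Ioc_mul_eq_sum_sum, Nat.floor_div_natCast]

/-- Dirichlet's hyperbola method for a convolution with the constant function. -/
theorem abs_summatory_mul_zeta_sub_le {α : ArithmeticFunction ℝ} (hα : ∀ n, 0 ≤ α n)
    {c x : ℝ} (hx : 1 ≤ x) :
    |summatory (α * (ArithmeticFunction.zeta : ArithmeticFunction ℕ)) x / x -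
        ((∑ b ∈ Ioc 0 ⌊x ^ (1 - c)⌋₊, 1 / (b : ℝ) * (summatory α (x / b) / (x / b))) +
        (∑ a ∈ Ioc 0 ⌊x ^ c⌋₊, α a / a) - summatory α (x ^ c) / x ^ c)| ≤
      summatory α (x ^ c) / x := by
  have hx0 : 0 < x := by linarith
  set y := x ^ c with hy
  set z := x ^ (1 - c) with hz
  have hy0 : 0 < y := Real.rpow_pos_of_pos hx0 _
  have hz0 : 0 < z := Real.rpow_pos_of_pos hx0 _
  have hyz : y * z = x := by rw [hy, hz, ← Real.rpow_add hx0]; simp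
  have hS : summatory (α * (ArithmeticFunction.zeta : ArithmeticFunction ℕ)) x =
      ∑ a ∈ Ioc 0 ⌊x⌋₊, α a * (⌊x / a⌋₊ : ℝ) := by
    rw [summatory, ArithmeticFunction.sum_Ioc_mul_zeta_eq_sum]
    simp only [Nat.floor_div_natCast]
  have hfirst : (∑ b ∈ Ioc 0 ⌊z⌋₊, 1 / (b : ℝ) * (summatory α (x / b) / (x / b))) * x =
      ∑ a ∈ Ioc 0 ⌊x⌋₊, α a * (min ⌊z⌋₊ ⌊x / a⌋₊ : ℕ) := by
    have e1 : (∑ b ∈ Ioc 0 ⌊z⌋₊, 1 / (b : ℝ) * (summatory α (x / b) / (x / b))) * x =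
        ∑ b ∈ Ioc 0 ⌊z⌋₊, ∑ a ∈ Ioc 0 (⌊x⌋₊ / b), α a := by
      rw [Finset.sum_mul]
      refine Finset.sum_congr rfl fun b hb => ?_
      have hb0 : (b : ℝ) ≠ 0 := by
        have := (Finset.mem_Ioc.1 hb).1
        positivity
      rw [← Nat.floor_div_natCast]
      simp only [summatory]
      field_simp
    rw [e1, Finset.sum_comm' (t' := Ioc 0 ⌊x⌋₊) (s' := fun a => Ioc 0 (min ⌊z⌋₊ ⌊x / a⌋₊))]
    · refine Finset.sum_congr rfl fun a _ => ?_
      simp [mul_comm]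
    · intro b a
      simp only [Finset.mem_Ioc, Nat.floor_div_natCast, le_min_iff]
      constructor
      · rintro ⟨⟨hb, hbz⟩, ha, hab⟩
        have h := (Nat.le_div_iff_mul_le hb).1 hab
        refine ⟨⟨hb, hbz, (Nat.le_div_iff_mul_le ha).2 (by linarith)⟩, ha, ?_⟩
        exact hab.trans (Nat.div_le_self _ _)
      · rintro ⟨⟨hb, hbz, hba⟩, ha, hax⟩
        have h := (Nat.le_div_iff_mul_le ha).1 hba
        exact ⟨⟨hb, hbz⟩, ha, (Nat.le_div_iff_mul_le hb).2 (by linarith)⟩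
  have hdiff : ∑ a ∈ Ioc 0 ⌊x⌋₊, α a * (⌊x / a⌋₊ : ℝ) -
      ∑ a ∈ Ioc 0 ⌊x⌋₊, α a * (min ⌊z⌋₊ ⌊x / a⌋₊ : ℕ) =
      ∑ a ∈ Ioc 0 ⌊y⌋₊, α a * ((⌊x / a⌋₊ : ℝ) - ⌊z⌋₊) := by
    rw [← Finset.sum_sub_distrib]
    have hle : ∀ a : ℕ, 0 < a → a ≤ ⌊y⌋₊ → ⌊z⌋₊ ≤ ⌊x / a⌋₊ := fun a ha hay => by
      apply Nat.floor_le_floor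
      have : (a : ℝ) ≤ y := (Nat.le_floor_iff hy0.le).1 hay
      rw [le_div_iff₀ (by positivity), ← hyz, mul_comm]
      gcongr
    have hge : ∀ a : ℕ, ⌊y⌋₊ < a → ⌊x / a⌋₊ ≤ ⌊z⌋₊ := fun a hay => by
      apply Nat.floor_le_floor
      have : y < (a : ℝ) := (Nat.floor_lt hy0.le).1 hay
      rw [div_le_iff₀ (by linarith), ← hyz, mul_comm]
      gcongr
    have hzero : ∀ a : ℕ, ⌊x⌋₊ < a → ⌊x / a⌋₊ = 0 := fun a ha => by
      rw [Nat.floor_div_natCast, Nat.div_eq_of_lt ha]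
    have hterm : ∀ a ∈ Ioc 0 (max ⌊x⌋₊ ⌊y⌋₊),
        α a * (⌊x / a⌋₊ : ℝ) - α a * (min ⌊z⌋₊ ⌊x / a⌋₊ : ℕ) =
          if a ≤ ⌊y⌋₊ then α a * ((⌊x / a⌋₊ : ℝ) - ⌊z⌋₊) else 0 := by
      intro a ha
      have ha0 := (Finset.mem_Ioc.1 ha).1
      split_ifs with hay
      · rw [min_eq_left (hle a ha0 hay)]; ring
      · rw [min_eq_right (hge a (not_le.1 hay))]; ring
    have e1 : ∑ a ∈ Ioc 0 ⌊x⌋₊,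
        (α a * (⌊x / a⌋₊ : ℝ) - α a * (min ⌊z⌋₊ ⌊x / a⌋₊ : ℕ)) =
        ∑ a ∈ Ioc 0 (max ⌊x⌋₊ ⌊y⌋₊),
          (α a * (⌊x / a⌋₊ : ℝ) - α a * (min ⌊z⌋₊ ⌊x / a⌋₊ : ℕ)) := by
      refine Finset.sum_subset (Finset.Ioc_subset_Ioc_right (le_max_left _ _)) fun a ha ha' => ?_
      have : ⌊x⌋₊ < a := by
        simp only [Finset.mem_Ioc] at ha ha'
        omega
      rw [hzero a this]; simp
    rw [e1, Finset.sum_congr rfl hterm, ← Finset.sum_filter]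
    refine Finset.sum_congr ?_ fun _ _ => rfl
    ext a
    simp only [Finset.mem_filter, Finset.mem_Ioc, le_max_iff]
    omega
  have hmain : summatory (α * (ArithmeticFunction.zeta : ArithmeticFunction ℕ)) x / x -
        ((∑ b ∈ Ioc 0 ⌊z⌋₊, 1 / (b : ℝ) * (summatory α (x / b) / (x / b))) +
        (∑ a ∈ Ioc 0 ⌊y⌋₊, α a / a) - summatory α y / y) =
      (∑ a ∈ Ioc 0 ⌊y⌋₊, α a * ((⌊x / a⌋₊ : ℝ) - ⌊z⌋₊ - (x / a - z))) / x := by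
    have e2 : ∑ a ∈ Ioc 0 ⌊y⌋₊, α a * ((⌊x / a⌋₊ : ℝ) - ⌊z⌋₊ - (x / a - z)) =
        ∑ a ∈ Ioc 0 ⌊y⌋₊, α a * ((⌊x / a⌋₊ : ℝ) - ⌊z⌋₊) -
          x * (∑ a ∈ Ioc 0 ⌊y⌋₊, α a / a) + z * summatory α y := by
      rw [summatory, Finset.mul_sum, Finset.mul_sum, ← Finset.sum_sub_distrib,
        ← Finset.sum_add_distrib]
      refine Finset.sum_congr rfl fun a _ => ?_
      ring
    rw [e2, ← hdiff, ← hfirst, ← hS]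
    have : z = x / y := by rw [← hyz]; field_simp
    rw [this]
    field_simp
    ring
  rw [hmain, abs_div, abs_of_pos hx0]
  refine div_le_div_of_nonneg_right ?_ hx0.le
  refine (Finset.abs_sum_le_sum_abs _ _).trans (Finset.sum_le_sum fun a _ => ?_)
  rw [abs_mul, abs_of_nonneg (hα a)]
  refine mul_le_of_le_one_right (hα a) ?_
  have h1 := Nat.floor_le (a := x / a) (by positivity)
  have h2 := Nat.lt_floor_add_one (x / a)
  have h3 := Nat.floor_le hz0.le
  have h4 := Nat.lt_floor_add_one z
  rw [abs_le]
  constructor <;> linarith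

local notation "Zt" => ((ArithmeticFunction.zeta : ArithmeticFunction ℕ) : ArithmeticFunction ℝ)

theorem zeta_pow_nonneg (j n : ℕ) : 0 ≤ (Zt ^ j) n := by
  induction j generalizing n with
  | zero => rw [pow_zero, ArithmeticFunction.one_apply]; split_ifs <;> simp
  | succ j ih =>
    rw [pow_succ, ArithmeticFunction.mul_apply]
    refine Finset.sum_nonneg fun d _ => mul_nonneg (ih _) ?_
    rw [ArithmeticFunction.natCoe_apply]
    positivity

theorem summatory_zeta (x : ℝ) : summatory Zt x = ⌊x⌋₊ := by
  have := ArithmeticFunction.sum_Ioc_zeta ⌊x⌋₊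
  simp only [summatory, ArithmeticFunction.natCoe_apply]
  exact_mod_cast this

theorem polyLog_zeta : PolyLog 0 1 (fun x => summatory Zt x / x) := by
  refine ⟨1, by simp, ((ErrO.rpow_neg 1).of_le 1 fun x hx => ?_)⟩
  have hx0 : 0 < x := by linarith
  have h1 := Nat.floor_le hx0.le
  have h2 := Nat.lt_floor_add_one x
  beta_reduce
  rw [summatory_zeta, one_mul, Real.rpow_neg_one, abs_of_pos (inv_pos.2 hx0), Polynomial.eval_one,
    div_sub_one hx0.ne', abs_div, abs_of_pos hx0, inv_eq_one_div]
  refine div_le_div_of_nonneg_right ?_ hx0.le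
  rw [abs_le]; constructor <;> linarith

theorem polyLog_sum_log_pow_div (l : ℕ) :
    PolyLog (1 + l) 1 (fun z => ∑ m ∈ Ioc 0 ⌊z⌋₊, 1 / (m : ℝ) * Real.log m ^ l) := by
  have h := PolyLog.sum_log_pow_div (α := Zt) (by simp) one_pos polyLog_zeta l
  refine (h.mono (by omega) le_rfl).congr fun x _ => Finset.sum_congr rfl fun m hm => ?_
  have : m ≠ 0 := by have := (Finset.mem_Ioc.1 hm).1; omega
  simp [this]

/-- An error term `E` of size `x ^ (-σ)` contributes an error of size `x ^ (-c * σ)`. -/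
theorem ErrO.sum_div {σ c : ℝ} (hσ : 0 < σ) (hc : 0 < c) (hc1 : c < 1) {E : ℝ → ℝ}
    (h : ErrO σ E) :
    ErrO (c * σ) (fun x => ∑ b ∈ Ioc 0 ⌊x ^ (1 - c)⌋₊, 1 / (b : ℝ) * E (x / b)) := by
  intro s hs
  set s₁ := max 0 ((s / c + σ) / 2) with hs₁
  have hsc : s / c < σ := by rwa [div_lt_iff₀ hc, mul_comm]
  have h1 : s₁ < σ := max_lt hσ (by linarith)
  have h2 : s < c * s₁ := by
    have h3 : s / c < s₁ := lt_of_lt_of_le (by linarith) (le_max_right _ _)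
    rwa [div_lt_iff₀ hc, mul_comm] at h3
  obtain ⟨C, hC0, hC⟩ := h.nonneg_const h1
  have hH : ErrO 0 (fun x => ∑ m ∈ Ioc 0 ⌊x ^ (1 - c)⌋₊, 1 / (m : ℝ)) := by
    have := ((polyLog_sum_log_pow_div 0).errO zero_le_one).comp_rpow (c := 1 - c) (by linarith)
    simpa using this
  refine ((hH.mul (ErrO.rpow_neg (c * s₁))).of_le C (G := fun x =>
    ∑ b ∈ Ioc 0 ⌊x ^ (1 - c)⌋₊, 1 / (b : ℝ) * E (x / b)) fun x hx => ?_) s (by simpa using h2)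
  have hx0 : 0 < x := by linarith
  refine (Finset.abs_sum_le_sum_abs _ _).trans ?_
  rw [abs_of_nonneg (mul_nonneg (Finset.sum_nonneg fun _ _ => by positivity)
    (Real.rpow_nonneg hx0.le _)), Finset.sum_mul, Finset.mul_sum]
  refine Finset.sum_le_sum fun b hb => ?_
  obtain ⟨hb0, hb1⟩ := Finset.mem_Ioc.1 hb
  have hb0' : (0 : ℝ) < b := by exact_mod_cast hb0
  have hbz : (b : ℝ) ≤ x ^ (1 - c) := (Nat.le_floor_iff (Real.rpow_nonneg hx0.le _)).1 hb1
  have hxb : x ^ c ≤ x / b := by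
    rw [le_div_iff₀ hb0']
    calc x ^ c * b ≤ x ^ c * x ^ (1 - c) := by gcongr
      _ = x := by rw [← Real.rpow_add hx0]; simp
  have hle : |E (x / b)| ≤ C * x ^ (-(c * s₁)) := by
    refine (hC _ ((Real.one_le_rpow hx hc.le).trans hxb)).trans ?_
    refine mul_le_mul_of_nonneg_left ?_ hC0
    calc (x / b) ^ (-s₁) ≤ (x ^ c) ^ (-s₁) :=
          Real.rpow_le_rpow_of_nonpos (Real.rpow_pos_of_pos hx0 _) hxb (by simp [hs₁])
      _ = x ^ (-(c * s₁)) := by rw [← Real.rpow_mul hx0.le]; ring_nf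
  rw [abs_mul, abs_of_nonneg (by positivity : (0 : ℝ) ≤ 1 / b)]
  calc 1 / (b : ℝ) * |E (x / b)| ≤ 1 / (b : ℝ) * (C * x ^ (-(c * s₁))) := by gcongr
    _ = _ := by ring

theorem polyLog_mul_zeta {α : ArithmeticFunction ℝ} (hα : ∀ n, 0 ≤ α n) {D : ℕ} {σ c : ℝ}
    (hσ : 0 < σ) (hc : 0 < c) (hc1 : c < 1) (h : PolyLog D σ (fun x => summatory α x / x)) :
    PolyLog (D + 1) (min (c * σ) (1 - c)) (fun x => summatory (α * Zt) x / x) := by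
  have hL := ((PolyLog.sum_log_pow_div (α := α) (by simp) hσ h 0).comp_rpow hc).mono
    (show D + 1 + 0 ≤ D + 1 by omega) (min_le_left (c * σ) (1 - c))
  have hA := (h.comp_rpow hc).mono (show D ≤ D + 1 by omega) (min_le_left (c * σ) (1 - c))
  have hA0 : ErrO 0 (fun x => summatory α (x ^ c) / x ^ c) := by
    simpa using (h.errO hσ.le).comp_rpow hc
  obtain ⟨P, hP, hE⟩ := h
  have h1 := ((PolyLog.sum_eval_log_sub (β := fun _ => 1) (c := 1 - c) (by linarith)
    polyLog_sum_log_pow_div P).mono (show 1 + P.natDegree ≤ D + 1 by omega)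
    (show min (c * σ) (1 - c) ≤ (1 - c) * 1 by simp))
  have h2 := (PolyLog.of_errO (hE.sum_div hσ hc hc1)).mono (Nat.zero_le (D + 1))
    (min_le_left (c * σ) (1 - c))
  have h3 := (PolyLog.of_errO ((hA0.mul (ErrO.rpow_neg (1 - c))).of_le 1
    (G := fun x => summatory (α * Zt) x / x -
        ((∑ b ∈ Ioc 0 ⌊x ^ (1 - c)⌋₊, 1 / (b : ℝ) * (summatory α (x / b) / (x / b))) +
        (∑ a ∈ Ioc 0 ⌊x ^ c⌋₊, α a / a) - summatory α (x ^ c) / x ^ c)) fun x hx => by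
      have hx0 : 0 < x := by linarith
      refine (abs_summatory_mul_zeta_sub_le hα hx).trans ?_
      refine (le_of_eq ?_).trans (le_abs_self _ |>.trans_eq (one_mul _).symm)
      rw [neg_sub, Real.rpow_sub_one hx0.ne']
      have := (Real.rpow_pos_of_pos hx0 c).ne'
      field_simp)).mono (Nat.zero_le (D + 1))
    (show min (c * σ) (1 - c) ≤ 0 + (1 - c) by simp)
  refine ((((h1.add h2).add hL).sub hA).add h3).congr fun x hx => ?_
  have e : ∑ b ∈ Ioc 0 ⌊x ^ (1 - c)⌋₊, 1 / (b : ℝ) * (summatory α (x / b) / (x / b)) =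
      ∑ m ∈ Ioc 0 ⌊x ^ (1 - c)⌋₊, 1 / (m : ℝ) * P.eval (Real.log x - Real.log m) +
      ∑ b ∈ Ioc 0 ⌊x ^ (1 - c)⌋₊, 1 / (b : ℝ) *
        (summatory α (x / b) / (x / b) - P.eval (Real.log (x / b))) := by
    rw [← Finset.sum_add_distrib]
    refine Finset.sum_congr rfl fun b hb => ?_
    have : (b : ℝ) ≠ 0 := by
      have := (Finset.mem_Ioc.1 hb).1
      positivity
    rw [Real.log_div (by linarith) this]
    ring
  simp only [e, pow_zero, mul_one]
  ring

theorem polyLog_zeta_pow (j : ℕ) :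
    PolyLog j (1 / (j + 1)) (fun x => summatory (Zt ^ (j + 1)) x / x) := by
  induction j with
  | zero => simpa using polyLog_zeta
  | succ j ih =>
    have hj : (0 : ℝ) < j + 1 := by positivity
    have := polyLog_mul_zeta (zeta_pow_nonneg (j + 1)) (σ := 1 / (j + 1)) (by positivity)
      (c := ((j : ℝ) + 1) / (j + 2)) (by positivity)
      (by rw [div_lt_one (by positivity)]; linarith) ih
    rw [← pow_succ] at this
    refine this.mono le_rfl (le_min (le_of_eq ?_) (le_of_eq ?_))
    · push_cast
      have : (j : ℝ) + 2 ≠ 0 := by positivity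
      field_simp
      ring
    · push_cast
      have : (j : ℝ) + 2 ≠ 0 := by positivity
      field_simp
      ring

/-- Summability of a nonnegative multiplicative function from bounds on its local factors. -/
theorem summable_of_coprime_mul {F : ℕ → ℝ} (h0 : ∀ n, 0 ≤ F n) (hF0 : F 0 = 0) (h1 : F 1 = 1)
    (hmul : ∀ {m n : ℕ}, m.Coprime n → F (m * n) = F m * F n) {b : ℕ → ℝ} (hb0 : ∀ p, 0 ≤ b p)
    (hb : Summable b)
    (hloc : ∀ p : ℕ, p.Prime → Summable (fun k => F (p ^ (k + 1))) ∧
      ∑' k, F (p ^ (k + 1)) ≤ b p) : Summable F := by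
  have hsF : ∀ p : ℕ, p.Prime → Summable (fun k => F (p ^ k)) := fun p hp =>
    (summable_nat_add_iff (f := fun k => F (p ^ k)) 1).1 (hloc p hp).1
  have hs : ∀ {p : ℕ}, p.Prime → Summable (fun k => ‖F (p ^ k)‖) := fun {p} hp =>
    (hsF p hp).norm
  refine summable_of_sum_range_le (c := Real.exp (∑' p, b p)) h0 fun N => ?_
  obtain ⟨hS, hH⟩ :=
    EulerProduct.summable_and_hasSum_smoothNumbers_prod_primesBelow_tsum h1 hmul hs N
  have hle : ∑ n ∈ range N, F n ≤ ∑' m : N.smoothNumbers, F m := by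
    have hind : Summable ((N.smoothNumbers : Set ℕ).indicator F) :=
      summable_subtype_iff_indicator.1 hH.summable
    have hnn : ∀ n, 0 ≤ (N.smoothNumbers : Set ℕ).indicator F n :=
      fun n => Set.indicator_nonneg (fun m _ => h0 m) n
    rw [tsum_subtype (N.smoothNumbers) F]
    refine le_trans (Finset.sum_le_sum fun n hn => ?_) (hind.sum_le_tsum (range N) fun n _ => hnn n)
    rcases Nat.eq_zero_or_pos n with rfl | hpos
    · rw [hF0]; exact hnn 0
    · rw [Set.indicator_of_mem]
      exact Nat.mem_smoothNumbers_of_lt hpos (Finset.mem_range.1 hn)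
  refine hle.trans ?_
  rw [hH.tsum_eq]
  calc ∏ p ∈ N.primesBelow, ∑' n, F (p ^ n) ≤ ∏ p ∈ N.primesBelow, Real.exp (b p) := by
        refine Finset.prod_le_prod (fun p _ => tsum_nonneg fun _ => h0 _) fun p hp => ?_
        have hp := Nat.prime_of_mem_primesBelow hp
        rw [(hsF p hp).tsum_eq_zero_add, pow_zero, h1]
        calc 1 + ∑' k, F (p ^ (k + 1)) ≤ b p + 1 := by linarith [(hloc p hp).2]
          _ ≤ _ := Real.add_one_le_exp _
    _ = Real.exp (∑ p ∈ N.primesBelow, b p) := (Real.exp_sum _ _).symm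
    _ ≤ _ := Real.exp_le_exp.2 (hb.sum_le_tsum _ fun _ _ => hb0 _)

/-- The weight `1` for `k ≤ 1` and `p ^ (33 k / 34 - 1)` for `k ≥ 2`. -/
noncomputable def wt (p k : ℕ) : ℝ := if k ≤ 1 then 1 else (p : ℝ) ^ ((33 / 34 : ℝ) * k - 1)

theorem one_le_wt {p : ℕ} (hp : 1 ≤ p) (k : ℕ) : 1 ≤ wt p k := by
  rw [wt]
  split_ifs with h
  · exact le_rfl
  · have : (2 : ℝ) ≤ k := by exact_mod_cast not_le.1 h
    exact Real.one_le_rpow (by exact_mod_cast hp) (by linarith)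

theorem wt_mono {p : ℕ} (hp : 1 ≤ p) : Monotone (wt p) := by
  intro i j hij
  by_cases hi : i ≤ 1
  · rw [wt, if_pos hi]; exact one_le_wt hp j
  · have hj : ¬ j ≤ 1 := by omega
    rw [wt, wt, if_neg hi, if_neg hj]
    have : (i : ℝ) ≤ j := by exact_mod_cast hij
    exact Real.rpow_le_rpow_of_exponent_le (by exact_mod_cast hp) (by linarith)

/-- Bounds `O((k + 1) ^ D * wt p k)` for families indexed by prime powers. -/
def LocBound (F : ℕ → ℕ → ℝ) : Prop :=
  ∃ C : ℝ, 0 ≤ C ∧ ∃ D : ℕ, ∀ p : ℕ, p.Prime → ∀ k : ℕ, |F p k| ≤ C * (k + 1) ^ D * wt p k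

theorem summable_of_locBound {h : ArithmeticFunction ℝ} (hm : h.IsMultiplicative)
    (hp1 : ∀ p : ℕ, p.Prime → h p = 0) (hb : LocBound fun p k => h (p ^ k)) {s : ℝ}
    (hs : s < 1 / 34) : Summable (fun n : ℕ => |h n| * (n : ℝ) ^ (s - 1)) := by
  obtain ⟨C, hC0, D, hC⟩ := hb
  set δ := 1 / 34 - s with hδ
  have hδ0 : 0 < δ := by linarith
  set r : ℝ := 2 ^ (-δ) with hr
  have hr0 : 0 < r := Real.rpow_pos_of_pos two_pos _
  have hr1 : r < 1 := Real.rpow_lt_one_of_one_lt_of_neg one_lt_two (by linarith)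
  have hsum : Summable (fun k : ℕ => ((k : ℝ) + 2) ^ D * r ^ k) := by
    have h1 := (summable_nat_add_iff 2).2 (summable_pow_mul_geometric_of_norm_lt_one D
      (r := r) (by rwa [Real.norm_of_nonneg hr0.le]))
    refine (h1.mul_left (r ^ 2)⁻¹).congr fun k => ?_
    push_cast
    field_simp
    ring
  set K := ∑' k : ℕ, ((k : ℝ) + 2) ^ D * r ^ k with hK
  have hbound : ∀ p : ℕ, p.Prime → ∀ k : ℕ,
      |h (p ^ (k + 1))| * ((p ^ (k + 1) : ℕ) : ℝ) ^ (s - 1) ≤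
        C * (p : ℝ) ^ (-1 - δ) * (((k : ℝ) + 2) ^ D * r ^ k) := by
    intro p hp k
    have hp0 : (0 : ℝ) < p := by exact_mod_cast hp.pos
    have hp2 : (2 : ℝ) ≤ p := by exact_mod_cast hp.two_le
    rcases Nat.eq_zero_or_pos k with rfl | hk
    · simp only [zero_add, pow_one, hp1 p hp, abs_zero, zero_mul]
      positivity
    · have h2 := hC p hp (k + 1)
      rw [wt, if_neg (by omega)] at h2
      have e1 : (p : ℝ) ^ ((33 / 34 : ℝ) * ((k + 1 : ℕ) : ℝ) - 1) *
          ((p ^ (k + 1) : ℕ) : ℝ) ^ (s - 1) = (p : ℝ) ^ (-1 - δ) * ((p : ℝ) ^ (-δ)) ^ k := by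
        rw [Nat.cast_pow, ← Real.rpow_natCast, ← Real.rpow_natCast, ← Real.rpow_mul hp0.le,
          ← Real.rpow_mul hp0.le, ← Real.rpow_add hp0, ← Real.rpow_add hp0]
        congr 1
        push_cast
        rw [hδ]; ring
      have e2 : ((p : ℝ) ^ (-δ)) ^ k ≤ r ^ k := by
        refine pow_le_pow_left₀ (Real.rpow_nonneg hp0.le _) ?_ k
        exact Real.rpow_le_rpow_of_nonpos two_pos hp2 (by linarith)
      calc |h (p ^ (k + 1))| * ((p ^ (k + 1) : ℕ) : ℝ) ^ (s - 1)
          ≤ (C * ((k + 1 : ℕ) + 1) ^ D * (p : ℝ) ^ ((33 / 34 : ℝ) * ((k + 1 : ℕ) : ℝ) - 1)) *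
            ((p ^ (k + 1) : ℕ) : ℝ) ^ (s - 1) := by gcongr
        _ = C * ((k : ℝ) + 2) ^ D * ((p : ℝ) ^ (-1 - δ) * ((p : ℝ) ^ (-δ)) ^ k) := by
            rw [mul_assoc, e1]; push_cast; ring
        _ ≤ C * ((k : ℝ) + 2) ^ D * ((p : ℝ) ^ (-1 - δ) * r ^ k) := by gcongr
        _ = _ := by ring
  refine summable_of_coprime_mul (b := fun p => C * (p : ℝ) ^ (-1 - δ) * K)
    (fun n => by positivity) (by simp) (by simp [hm.map_one]) ?_ ?_ ?_ ?_
  · intro m n hmn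
    rw [hm.map_mul_of_coprime hmn, abs_mul, Nat.cast_mul,
      Real.mul_rpow (Nat.cast_nonneg _) (Nat.cast_nonneg _)]
    ring
  · intro p
    have : 0 ≤ K := tsum_nonneg fun k => by positivity
    positivity
  · exact ((Real.summable_nat_rpow.2 (by linarith)).mul_left C).mul_right K
  · intro p hp
    have hsummable := Summable.of_nonneg_of_le (fun k => by positivity) (hbound p hp)
      (hsum.mul_left _)
    refine ⟨hsummable, ?_⟩
    rw [hK, ← tsum_mul_left]
    exact hsummable.tsum_le_tsum (hbound p hp) (hsum.mul_left _)

/-- Convolution with a function whose Dirichlet series converges absolutely to the left of `1`. -/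
theorem polyLog_mul_of_summable {g a : ArithmeticFunction ℝ} {D : ℕ} {σ τ : ℝ} (hσ : 0 < σ)
    (hτ : σ ≤ τ) (hg : ∀ s < σ, Summable (fun n : ℕ => |g n| * (n : ℝ) ^ (s - 1)))
    (h : PolyLog D τ (fun x => summatory a x / x)) :
    PolyLog D σ (fun x => summatory (g * a) x / x) := by
  obtain ⟨P, hP, hE⟩ := h
  have hΛ : ∀ l : ℕ, PolyLog (0 + l) σ
      (fun z => ∑ m ∈ Ioc 0 ⌊z⌋₊, g m / m * Real.log m ^ l) := by
    intro l
    refine ⟨Polynomial.C (∑' m : ℕ, g m / m * Real.log m ^ l), by simp, fun s hs => ?_⟩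
    set s₁ := max s 0 with hs₁
    have hs₁σ : s₁ < σ := max_lt hs hσ
    obtain ⟨K, hK0, hK⟩ := (ErrO.log_pow l).nonneg_const (s := -((σ - s₁) / 2)) (by linarith)
    have hbd : ∀ m : ℕ, |g m / m * Real.log m ^ l| * (m : ℝ) ^ s₁ ≤
        K * (|g m| * (m : ℝ) ^ ((s₁ + σ) / 2 - 1)) := by
      intro m
      rcases Nat.eq_zero_or_pos m with rfl | hm
      · simp
      · have hm0 : (0 : ℝ) < m := by exact_mod_cast hm
        have h1 := hK m (by exact_mod_cast hm)
        rw [neg_neg] at h1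
        have e : (m : ℝ) ^ ((s₁ + σ) / 2 - 1) = (m : ℝ) ^ ((σ - s₁) / 2) * (m : ℝ) ^ s₁ / m := by
          rw [← Real.rpow_add hm0, ← Real.rpow_sub_one hm0.ne']
          congr 1; ring
        rw [e, abs_mul, abs_div, abs_of_pos hm0]
        calc |g m| / m * |Real.log m ^ l| * (m : ℝ) ^ s₁
            ≤ |g m| / m * (K * (m : ℝ) ^ ((σ - s₁) / 2)) * (m : ℝ) ^ s₁ := by gcongr
          _ = _ := by ring
    have hsum1 : Summable (fun m : ℕ => |g m / m * Real.log m ^ l| * (m : ℝ) ^ s₁) :=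
      Summable.of_nonneg_of_le (fun m => by positivity) hbd ((hg _ (by linarith)).mul_left K)
    have hsum0 : Summable (fun m : ℕ => g m / m * Real.log m ^ l) := by
      refine Summable.of_norm_bounded hsum1 fun m => ?_
      rcases Nat.eq_zero_or_pos m with rfl | hm
      · simp
      · rw [Real.norm_eq_abs]
        exact le_mul_of_one_le_right (abs_nonneg _)
          (Real.one_le_rpow (by exact_mod_cast hm) (le_max_right _ _))
    refine ⟨∑' m : ℕ, |g m / m * Real.log m ^ l| * (m : ℝ) ^ s₁, fun x hx => ?_⟩
    have hx0 : 0 < x := by linarith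
    have hsplit := hsum0.sum_add_tsum_subtype_compl (Ioc 0 ⌊x⌋₊)
    beta_reduce
    rw [Polynomial.eval_C, ← hsplit, sub_add_cancel_left, abs_neg, ← Real.norm_eq_abs]
    have hsub1 : Summable (fun m : {m : ℕ // m ∉ Ioc 0 ⌊x⌋₊} =>
        |g m / m * Real.log m ^ l| * (m : ℝ) ^ s₁ * x ^ (-s₁)) :=
      (hsum1.mul_right _).comp_injective Subtype.val_injective
    calc _ ≤ ∑' m : {m : ℕ // m ∉ Ioc 0 ⌊x⌋₊},
          |g m / m * Real.log m ^ l| * (m : ℝ) ^ s₁ * x ^ (-s₁) := by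
          refine tsum_of_norm_bounded hsub1.hasSum fun m => ?_
          rw [Real.norm_eq_abs]
          rcases Nat.eq_zero_or_pos m.1 with h0 | hm
          · rw [h0]; simp
          · have hxm : x ≤ m.1 := by
              have := m.2
              simp only [Finset.mem_Ioc, not_and, not_le] at this
              exact ((Nat.floor_lt hx0.le).1 (this hm)).le
            rw [mul_assoc]
            refine le_mul_of_one_le_right (abs_nonneg _) ?_
            rw [Real.rpow_neg hx0.le, ← div_eq_mul_inv, one_le_div (Real.rpow_pos_of_pos hx0 _)]
            exact Real.rpow_le_rpow hx0.le hxm (le_max_right _ _)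
      _ ≤ ∑' m : ℕ, |g m / m * Real.log m ^ l| * (m : ℝ) ^ s₁ * x ^ (-s₁) :=
          (hsum1.mul_right _).tsum_subtype_le _ {m : ℕ | m ∉ Ioc 0 ⌊x⌋₊} fun m => by positivity
      _ = (∑' m : ℕ, |g m / m * Real.log m ^ l| * (m : ℝ) ^ s₁) * x ^ (-s₁) := tsum_mul_right
      _ ≤ _ := by
          refine mul_le_mul_of_nonneg_left ?_ (tsum_nonneg fun m => by positivity)
          exact Real.rpow_le_rpow_of_exponent_le hx (neg_le_neg (le_max_left _ _))
  have h1 := ((PolyLog.sum_eval_log_sub (c := 1) one_pos hΛ P).mono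
    (show 0 + P.natDegree ≤ D by omega) (one_mul σ).ge)
  have h2 : ErrO σ (fun x => ∑ m ∈ Ioc 0 ⌊x⌋₊, g m / m *
      (summatory a (x / m) / (x / m) - P.eval (Real.log (x / m)))) := by
    intro s hs
    obtain ⟨C, hC0, hC⟩ := hE.nonneg_const (hs.trans_le hτ)
    refine ⟨C * ∑' n : ℕ, |g n| * (n : ℝ) ^ (s - 1), fun x hx => ?_⟩
    have hx0 : 0 < x := by linarith
    refine (Finset.abs_sum_le_sum_abs _ _).trans ?_
    calc _ ≤ ∑ m ∈ Ioc 0 ⌊x⌋₊, C * (|g m| * (m : ℝ) ^ (s - 1)) * x ^ (-s) := by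
          refine Finset.sum_le_sum fun m hm => ?_
          obtain ⟨hm0, hm1⟩ := Finset.mem_Ioc.1 hm
          have hm0' : (0 : ℝ) < m := by exact_mod_cast hm0
          have hmx : (m : ℝ) ≤ x := (Nat.le_floor_iff hx0.le).1 hm1
          have h3 := hC (x / m) ((one_le_div hm0').2 hmx)
          rw [abs_mul, abs_div, abs_of_pos hm0']
          calc _ ≤ |g m| / m * (C * (x / m) ^ (-s)) := by gcongr
            _ = _ := by
              rw [Real.div_rpow hx0.le hm0'.le, Real.rpow_neg hm0'.le, Real.rpow_sub_one hm0'.ne']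
              field_simp
      _ = C * (∑ m ∈ Ioc 0 ⌊x⌋₊, |g m| * (m : ℝ) ^ (s - 1)) * x ^ (-s) := by
          rw [Finset.mul_sum, Finset.sum_mul]
      _ ≤ _ := by
          refine mul_le_mul_of_nonneg_right (mul_le_mul_of_nonneg_left ?_ hC0)
            (Real.rpow_nonneg hx0.le _)
          exact (hg s hs).sum_le_tsum _ fun m _ => by positivity
  refine (h1.add ((PolyLog.of_errO h2).mono (Nat.zero_le _) le_rfl)).congr fun x hx => ?_
  have hx0 : 0 < x := by linarith
  rw [summatory_mul, Finset.sum_div, Real.rpow_one, ← Finset.sum_add_distrib]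
  refine Finset.sum_congr rfl fun m hm => ?_
  have hm0 : (m : ℝ) ≠ 0 := by
    have := (Finset.mem_Ioc.1 hm).1
    positivity
  rw [Real.log_div hx0.ne' hm0]
  field_simp
  ring

theorem LocBound.of_sub {F G : ℕ → ℕ → ℝ} (hF : LocBound F)
    (h0 : ∀ p : ℕ, p.Prime → G p 0 = F p 0)
    (hs : ∀ p : ℕ, p.Prime → ∀ k, G p (k + 1) = F p (k + 1) - F p k) : LocBound G := by
  obtain ⟨C, hC0, D, hC⟩ := hF
  refine ⟨2 * C, by positivity, D, fun p hp k => ?_⟩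
  have hnn : ∀ k : ℕ, 0 ≤ C * ((k : ℝ) + 1) ^ D * wt p k := fun k =>
    (abs_nonneg _).trans (hC p hp k)
  cases k with
  | zero =>
    rw [h0 p hp]
    linarith [hC p hp 0, hnn 0]
  | succ k =>
    rw [hs p hp]
    have h1 := hC p hp k
    have h2 := hC p hp (k + 1)
    have h3 : C * ((k : ℝ) + 1) ^ D * wt p k ≤ C * (((k + 1 : ℕ) : ℝ) + 1) ^ D * wt p (k + 1) := by
      have := wt_mono hp.one_le (Nat.le_succ k)
      have := one_le_wt hp.one_le k
      gcongr
      linarith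
    have := abs_sub (F p (k + 1)) (F p k)
    linarith

theorem mul_zeta_prime_pow_succ {g : ArithmeticFunction ℝ} {p : ℕ} (hp : p.Prime) (k : ℕ) :
    (g * Zt) (p ^ (k + 1)) = (g * Zt) (p ^ k) + g (p ^ (k + 1)) := by
  rw [ArithmeticFunction.coe_mul_zeta_apply, ArithmeticFunction.coe_mul_zeta_apply,
    Nat.sum_divisors_prime_pow hp, Nat.sum_divisors_prime_pow hp, Finset.sum_range_succ]

theorem exists_mul_zeta_pow {f : ArithmeticFunction ℝ} (hm : f.IsMultiplicative) {c : ℝ}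
    (hp : ∀ p : ℕ, p.Prime → f p = c) (hb : LocBound fun p k => f (p ^ k)) (j : ℕ) :
    ∃ g : ArithmeticFunction ℝ, g.IsMultiplicative ∧ (∀ p : ℕ, p.Prime → g p = c - j) ∧
      LocBound (fun p k => g (p ^ k)) ∧ g * Zt ^ j = f := by
  induction j with
  | zero => exact ⟨f, hm, by simpa using hp, hb, by simp⟩
  | succ j ih =>
    obtain ⟨g, hgm, hgp, hgb, hgf⟩ := ih
    set g' : ArithmeticFunction ℝ :=
      g * ((ArithmeticFunction.moebius : ArithmeticFunction ℤ) : ArithmeticFunction ℝ) with hg'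
    have hmul : g' * Zt = g := by
      rw [hg', mul_assoc, ArithmeticFunction.coe_moebius_mul_coe_zeta, mul_one]
    have hm' : g'.IsMultiplicative :=
      hgm.mul ArithmeticFunction.isMultiplicative_moebius.intCast
    have hrec : ∀ p : ℕ, p.Prime → ∀ k, g' (p ^ (k + 1)) = g (p ^ (k + 1)) - g (p ^ k) := by
      intro p hp k
      have := mul_zeta_prime_pow_succ (g := g') hp k
      rw [hmul] at this
      linarith
    refine ⟨g', hm', fun p hp => ?_, hgb.of_sub (fun p _ => ?_) hrec, ?_⟩
    · have := hrec p hp 0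
      simp only [zero_add, pow_one, pow_zero, hgm.map_one, hgp p hp] at this
      rw [this]; push_cast; ring
    · simp [hm'.map_one, hgm.map_one]
    · rw [pow_succ', ← mul_assoc, hmul, hgf]

theorem zeta_pow_prime_pow_le (j : ℕ) {p : ℕ} (hp : p.Prime) (k : ℕ) :
    (Zt ^ j) (p ^ k) ≤ ((k : ℝ) + 1) ^ j := by
  induction j generalizing k with
  | zero =>
    rw [pow_zero, pow_zero, ArithmeticFunction.one_apply]
    split_ifs <;> norm_num
  | succ j ih =>
    rw [pow_succ, ArithmeticFunction.coe_mul_zeta_apply, Nat.sum_divisors_prime_pow hp]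
    calc ∑ i ∈ range (k + 1), (Zt ^ j) (p ^ i) ≤ ∑ i ∈ range (k + 1), ((k : ℝ) + 1) ^ j := by
          refine Finset.sum_le_sum fun i hi => (ih i).trans ?_
          have : (i : ℝ) ≤ k := by exact_mod_cast Nat.lt_succ_iff.1 (Finset.mem_range.1 hi)
          gcongr
      _ = ((k : ℝ) + 1) ^ (j + 1) := by simp; ring

theorem isMultiplicative_zeta_pow (j : ℕ) : (Zt ^ j).IsMultiplicative :=
  ArithmeticFunction.isMultiplicative_zeta.natCast.pow

theorem zeta_pow_prime (j : ℕ) {p : ℕ} (hp : p.Prime) : (Zt ^ j) p = j := by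
  induction j with
  | zero => rw [pow_zero, ArithmeticFunction.one_apply, if_neg hp.one_lt.ne']; simp
  | succ j ih =>
    have := mul_zeta_prime_pow_succ (g := Zt ^ j) hp 0
    simp only [zero_add, pow_one, pow_zero] at this
    rw [← pow_succ, (isMultiplicative_zeta_pow _).map_one, ih] at this
    rw [this]; push_cast; ring

theorem exists_summatory_zeta_pow_ge (j : ℕ) :
    ∃ c : ℝ, 0 < c ∧ ∀ x : ℝ, 1 ≤ x → c * x * Real.log x ^ j ≤ summatory (Zt ^ (j + 1)) x := by
  induction j with
  | zero =>
    refine ⟨1 / 2, by norm_num, fun x hx => ?_⟩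
    have h1 : summatory (Zt ^ (0 + 1)) x = ⌊x⌋₊ := by
      rw [zero_add, pow_one, summatory,
        Finset.sum_congr rfl (g := fun _ => (1 : ℝ)) fun n hn => ?_]
      · simp
      · have := (Finset.mem_Ioc.1 hn).1
        simp [ArithmeticFunction.natCoe_apply, ArithmeticFunction.zeta_apply, this.ne']
    rw [h1, pow_zero, mul_one]
    have h2 := Nat.lt_floor_add_one x
    have h3 : (1 : ℝ) ≤ ⌊x⌋₊ := by exact_mod_cast Nat.floor_pos.2 hx
    linarith
  | succ j ih =>
    obtain ⟨c, hc, h⟩ := ih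
    refine ⟨c * (1 / 2) ^ (j + 1), by positivity, fun x hx => ?_⟩
    have hx0 : 0 < x := by linarith
    have hl := Real.log_nonneg hx
    have hsq : 1 ≤ √x := Real.one_le_sqrt.2 hx
    have hlsq : Real.log √x = Real.log x / 2 := Real.log_sqrt hx0.le
    rw [pow_succ' Zt (j + 1), summatory_mul]
    have hnn : ∀ y, 0 ≤ summatory (Zt ^ (j + 1)) y := summatory_nonneg (zeta_pow_nonneg _)
    have hH : Real.log x / 2 ≤ ∑ m ∈ Ioc 0 ⌊√x⌋₊, (m : ℝ)⁻¹ := by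
      have h1 := log_add_one_le_harmonic ⌊√x⌋₊
      rw [harmonic_eq_sum_Icc] at h1
      push_cast at h1
      rw [← hlsq]
      refine (Real.log_le_log (by linarith) (Nat.lt_floor_add_one _).le).trans (h1.trans ?_)
      exact le_of_eq (Finset.sum_congr (by ext; simp [Nat.succ_le_iff]) fun _ _ => rfl)
    calc c * (1 / 2) ^ (j + 1) * x * Real.log x ^ (j + 1)
        = c * x * (Real.log x / 2) ^ j * (Real.log x / 2) := by ring
      _ ≤ c * x * (Real.log x / 2) ^ j * ∑ m ∈ Ioc 0 ⌊√x⌋₊, (m : ℝ)⁻¹ := by gcongr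
      _ = ∑ m ∈ Ioc 0 ⌊√x⌋₊, c * (x / m) * (Real.log x / 2) ^ j := by
          rw [Finset.mul_sum]; exact Finset.sum_congr rfl fun m _ => by ring
      _ ≤ ∑ m ∈ Ioc 0 ⌊√x⌋₊, Zt m * summatory (Zt ^ (j + 1)) (x / m) := by
          refine Finset.sum_le_sum fun m hm => ?_
          obtain ⟨hm0, hm1⟩ := Finset.mem_Ioc.1 hm
          have hm1' : (m : ℝ) ≤ √x := (Nat.le_floor_iff (by linarith)).1 hm1
          have hm0' : (0 : ℝ) < m := by exact_mod_cast hm0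
          have hz : Zt m = 1 := by
            simp [ArithmeticFunction.natCoe_apply, ArithmeticFunction.zeta_apply, hm0.ne']
          have hdiv : √x ≤ x / m := by
            rw [le_div_iff₀ hm0']
            nlinarith [Real.mul_self_sqrt hx0.le]
          rw [hz, one_mul]
          refine le_trans ?_ (h (x / m) (hsq.trans hdiv))
          have : Real.log x / 2 ≤ Real.log (x / m) := by
            rw [← hlsq]; exact Real.log_le_log (by linarith) hdiv
          gcongr
      _ ≤ _ := by
          refine Finset.sum_le_sum_of_subset_of_nonneg (Finset.Ioc_subset_Ioc_right ?_)
            fun m _ _ => mul_nonneg ?_ (hnn _)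
          · refine Nat.floor_mono ?_
            nlinarith [Real.mul_self_sqrt hx0.le]
          · have := zeta_pow_nonneg 1 m
            rwa [pow_one] at this

open Classical in
/-- The restriction of the tenfold divisor function to squareful integers. -/
noncomputable def squarefulPart : ArithmeticFunction ℝ :=
  ⟨fun m => if ∀ p : ℕ, p.Prime → p ∣ m → p ^ 2 ∣ m then (Zt ^ 10) m else 0, by simp⟩

theorem squarefulPart_apply_of_pos {m : ℕ} (h : ∀ p : ℕ, p.Prime → p ∣ m → p ^ 2 ∣ m) :
    squarefulPart m = (Zt ^ 10) m := by
  simp only [squarefulPart, ArithmeticFunction.coe_mk]; exact if_pos h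

theorem squarefulPart_apply_of_neg {m : ℕ} (h : ¬ ∀ p : ℕ, p.Prime → p ∣ m → p ^ 2 ∣ m) :
    squarefulPart m = 0 := by
  simp only [squarefulPart, ArithmeticFunction.coe_mk]; exact if_neg h

theorem squarefulPart_nonneg (m : ℕ) : 0 ≤ squarefulPart m := by
  by_cases h : ∀ p : ℕ, p.Prime → p ∣ m → p ^ 2 ∣ m
  · rw [squarefulPart_apply_of_pos h]; exact zeta_pow_nonneg _ _
  · rw [squarefulPart_apply_of_neg h]

theorem squareful_mul_iff {m n : ℕ} (h : m.Coprime n) :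
    (∀ p : ℕ, p.Prime → p ∣ m * n → p ^ 2 ∣ m * n) ↔
      (∀ p : ℕ, p.Prime → p ∣ m → p ^ 2 ∣ m) ∧ ∀ p : ℕ, p.Prime → p ∣ n → p ^ 2 ∣ n := by
  constructor
  · intro H
    refine ⟨fun p hp hpm => ?_, fun p hp hpn => ?_⟩
    · exact (Nat.Coprime.dvd_mul_right (Nat.Coprime.pow_left 2
        (h.coprime_dvd_left hpm))).1 (H p hp (hpm.mul_right _))
    · exact (Nat.Coprime.dvd_mul_left (Nat.Coprime.pow_left 2
        (h.symm.coprime_dvd_left hpn))).1 (H p hp (hpn.mul_left _))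
  · rintro ⟨H1, H2⟩ p hp hd
    rcases hp.dvd_mul.1 hd with hd | hd
    · exact (H1 p hp hd).mul_right _
    · exact (H2 p hp hd).mul_left _

theorem isMultiplicative_squarefulPart : squarefulPart.IsMultiplicative := by
  refine ⟨?_, fun {m n} h => ?_⟩
  · rw [squarefulPart_apply_of_pos, (isMultiplicative_zeta_pow _).map_one]
    intro p hp hd
    exact absurd (Nat.dvd_one.1 hd) hp.one_lt.ne'
  · by_cases h1 : ∀ p : ℕ, p.Prime → p ∣ m → p ^ 2 ∣ m
    · by_cases h2 : ∀ p : ℕ, p.Prime → p ∣ n → p ^ 2 ∣ n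
      · rw [squarefulPart_apply_of_pos h1, squarefulPart_apply_of_pos h2,
          squarefulPart_apply_of_pos ((squareful_mul_iff h).2 ⟨h1, h2⟩),
          (isMultiplicative_zeta_pow _).map_mul_of_coprime h]
      · rw [squarefulPart_apply_of_neg h2, mul_zero,
          squarefulPart_apply_of_neg fun H => h2 ((squareful_mul_iff h).1 H).2]
    · rw [squarefulPart_apply_of_neg h1, zero_mul,
        squarefulPart_apply_of_neg fun H => h1 ((squareful_mul_iff h).1 H).1]

theorem squarefulPart_prime {p : ℕ} (hp : p.Prime) : squarefulPart p = 0 := by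
  refine squarefulPart_apply_of_neg fun H => ?_
  have := Nat.le_of_dvd hp.pos (H p hp dvd_rfl)
  nlinarith [hp.two_le]

theorem squarefulPart_le (m : ℕ) : squarefulPart m ≤ (Zt ^ 10) m := by
  by_cases h : ∀ p : ℕ, p.Prime → p ∣ m → p ^ 2 ∣ m
  · rw [squarefulPart_apply_of_pos h]
  · rw [squarefulPart_apply_of_neg h]; exact zeta_pow_nonneg _ _

theorem summable_squarefulPart : Summable (fun n : ℕ => squarefulPart n / n) := by
  have h := summable_of_locBound (h := squarefulPart) isMultiplicative_squarefulPart
    (fun p hp => squarefulPart_prime hp)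
    ⟨1, zero_le_one, 10, fun p hp k => by
      rw [abs_of_nonneg (squarefulPart_nonneg _), one_mul]
      refine ((squarefulPart_le _).trans (zeta_pow_prime_pow_le 10 hp k)).trans ?_
      exact le_mul_of_one_le_right (by positivity) (one_le_wt hp.one_le k)⟩
    (s := 0) (by norm_num)
  refine h.congr fun n => ?_
  rw [abs_of_nonneg (squarefulPart_nonneg _), zero_sub, Real.rpow_neg_one]; rfl

theorem exists_squareful_dvd {f : ArithmeticFunction ℝ} (hm : f.IsMultiplicative)
    (hp : ∀ p : ℕ, p.Prime → f p = 10) (n : ℕ) (hn : n ≠ 0) :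
    ∃ a b : ℕ, a * b = n ∧ squarefulPart a * f b = (Zt ^ 10) n := by
  induction n using Nat.recOnPosPrimePosCoprime with
  | zero => exact absurd rfl hn
  | one =>
    exact ⟨1, 1, rfl, by rw [isMultiplicative_squarefulPart.map_one, hm.map_one,
      (isMultiplicative_zeta_pow _).map_one, mul_one]⟩
  | prime_pow p k hp' hk =>
    rcases Nat.lt_or_ge 1 k with hk1 | hk1
    · refine ⟨p ^ k, 1, mul_one _, ?_⟩
      rw [hm.map_one, mul_one, squarefulPart_apply_of_pos]
      intro q hq hqd
      have := (Nat.prime_dvd_prime_iff_eq hq hp').1 (hq.dvd_of_dvd_pow hqd)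
      subst this
      exact pow_dvd_pow _ hk1
    · obtain rfl : k = 1 := by omega
      refine ⟨1, p, by simp, ?_⟩
      rw [isMultiplicative_squarefulPart.map_one, hp p hp', pow_one, zeta_pow_prime 10 hp']
      norm_num
  | coprime a b ha hb hab iha ihb =>
    obtain ⟨a1, a2, rfl, h1⟩ := iha (by omega)
    obtain ⟨b1, b2, rfl, h2⟩ := ihb (by omega)
    refine ⟨a1 * b1, a2 * b2, by ring, ?_⟩
    rw [isMultiplicative_squarefulPart.map_mul_of_coprime
        ((hab.coprime_dvd_left (dvd_mul_right _ _)).coprime_dvd_right (dvd_mul_right _ _)),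
      hm.map_mul_of_coprime
        ((hab.coprime_dvd_left (dvd_mul_left _ _)).coprime_dvd_right (dvd_mul_left _ _)),
      (isMultiplicative_zeta_pow _).map_mul_of_coprime hab, ← h1, ← h2]
    ring

theorem zeta_pow_le_squarefulPart_mul {f : ArithmeticFunction ℝ} (hm : f.IsMultiplicative)
    (h0 : ∀ n, 0 ≤ f n) (hp : ∀ p : ℕ, p.Prime → f p = 10) (n : ℕ) :
    (Zt ^ 10) n ≤ (squarefulPart * f) n := by
  rcases eq_or_ne n 0 with rfl | hn
  · simp
  obtain ⟨a, b, hab, h⟩ := exists_squareful_dvd hm hp n hn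
  rw [← h, ArithmeticFunction.mul_apply]
  exact Finset.single_le_sum (f := fun x : ℕ × ℕ => squarefulPart x.1 * f x.2)
    (fun x _ => mul_nonneg (squarefulPart_nonneg _) (h0 _))
    (Nat.mem_divisorsAntidiagonal.2 ⟨hab, hn⟩ : (a, b) ∈ n.divisorsAntidiagonal)

theorem abs_eval_le_one_add_pow (P : Polynomial ℝ) {D : ℕ} (hD : P.natDegree ≤ D) {t : ℝ}
    (ht : 0 ≤ t) : |P.eval t| ≤ (∑ i ∈ range (P.natDegree + 1), |P.coeff i|) * (1 + t) ^ D := by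
  rw [Polynomial.eval_eq_sum_range, Finset.sum_mul]
  refine (Finset.abs_sum_le_sum_abs _ _).trans (Finset.sum_le_sum fun i hi => ?_)
  rw [abs_mul, abs_of_nonneg (pow_nonneg ht _)]
  gcongr
  calc t ^ i ≤ (1 + t) ^ i := by gcongr; linarith
    _ ≤ (1 + t) ^ D := pow_le_pow_right₀ (by linarith)
        ((Nat.lt_succ_iff.1 (Finset.mem_range.1 hi)).trans hD)

/-- The summatory function of a multiplicative function which is `10` at primes is not
`O(x (1 + log x) ^ 8)`. -/
theorem not_summatory_le {f : ArithmeticFunction ℝ} (hm : f.IsMultiplicative)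
    (h0 : ∀ n, 0 ≤ f n) (hp : ∀ p : ℕ, p.Prime → f p = 10) (A : ℝ) (hA : 0 ≤ A)
    (h : ∀ y : ℝ, 1 ≤ y → summatory f y ≤ A * y * (1 + Real.log y) ^ 8) : False := by
  obtain ⟨c, hc, hlow⟩ := exists_summatory_zeta_pow_ge 9
  set S := ∑' n : ℕ, squarefulPart n / n with hS
  have hnn : ∀ n : ℕ, 0 ≤ squarefulPart n / n := fun n =>
    div_nonneg (squarefulPart_nonneg n) (Nat.cast_nonneg n)
  have hS0 : 0 ≤ S := tsum_nonneg hnn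
  have hup : ∀ x : ℝ, 1 ≤ x → summatory (Zt ^ (9 + 1)) x ≤ A * S * x * (1 + Real.log x) ^ 8 := by
    intro x hx
    calc summatory (Zt ^ (9 + 1)) x ≤ summatory (squarefulPart * f) x :=
          Finset.sum_le_sum fun n _ => zeta_pow_le_squarefulPart_mul hm h0 hp n
      _ = ∑ m ∈ Ioc 0 ⌊x⌋₊, squarefulPart m * summatory f (x / m) := summatory_mul _ _ _
      _ ≤ ∑ m ∈ Ioc 0 ⌊x⌋₊, A * x * (1 + Real.log x) ^ 8 * (squarefulPart m / m) := by
          refine Finset.sum_le_sum fun m hm => ?_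
          obtain ⟨hm0, hm1⟩ := Finset.mem_Ioc.1 hm
          have hm1' : (m : ℝ) ≤ x := (Nat.le_floor_iff (by linarith)).1 hm1
          have hm0' : (1 : ℝ) ≤ m := by exact_mod_cast hm0
          have h1 : 1 ≤ x / m := (one_le_div (by linarith)).2 hm1'
          have h2 : x / m ≤ x := div_le_self (by linarith) hm0'
          have hl := Real.log_nonneg h1
          have hl2 := Real.log_le_log (by linarith) h2
          calc squarefulPart m * summatory f (x / m)
              ≤ squarefulPart m * (A * (x / m) * (1 + Real.log x) ^ 8) := by
                refine mul_le_mul_of_nonneg_left ((h _ h1).trans ?_) (squarefulPart_nonneg _)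
                gcongr
            _ = _ := by ring
      _ ≤ A * x * (1 + Real.log x) ^ 8 * S := by
          rw [← Finset.mul_sum]
          have := Real.log_nonneg hx
          exact mul_le_mul_of_nonneg_left
            (summable_squarefulPart.sum_le_tsum _ fun n _ => hnn n) (by positivity)
      _ = _ := by ring
  set t : ℝ := max 1 (A * S * 2 ^ 8 / c + 1) with ht
  have ht1 : 1 ≤ t := le_max_left _ _
  have ht2 : A * S * 2 ^ 8 / c + 1 ≤ t := le_max_right _ _
  have hx : 1 ≤ Real.exp t := Real.one_le_exp (by linarith)
  have h1 := (hlow _ hx).trans (hup _ hx)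
  rw [Real.log_exp] at h1
  have h2 : (1 + t) ^ 8 ≤ (2 * t) ^ 8 := by gcongr; linarith
  have h3 : Real.exp t * (c * t ^ 9) ≤ Real.exp t * (A * S * (2 * t) ^ 8) := by
    calc Real.exp t * (c * t ^ 9) = c * Real.exp t * t ^ 9 := by ring
      _ ≤ _ := h1
      _ ≤ A * S * Real.exp t * (2 * t) ^ 8 := by gcongr
      _ = _ := by ring
  have h4 := le_of_mul_le_mul_left h3 (Real.exp_pos t)
  have h5 : t ^ 8 * (c * t) ≤ t ^ 8 * (A * S * 2 ^ 8) := by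
    calc t ^ 8 * (c * t) = c * t ^ 9 := by ring
      _ ≤ _ := h4
      _ = _ := by ring
  have h6 := le_of_mul_le_mul_left h5 (by positivity)
  have h7 : t ≤ A * S * 2 ^ 8 / c := by rw [le_div_iff₀ hc]; linarith
  linarith

/-- Asymptotics with power saving for nonnegative multiplicative functions equal to `10` at
the primes. -/
theorem exists_polynomial_of_locBound {f : ArithmeticFunction ℝ} (hm : f.IsMultiplicative)
    (h0 : ∀ n, 0 ≤ f n) (hp : ∀ p : ℕ, p.Prime → f p = 10) (hb : LocBound fun p k => f (p ^ k)) :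
    ∃ P : Polynomial ℝ, P.degree = 9 ∧
      ErrO (1 / 34) (fun x => summatory f x / x - P.eval (Real.log x)) := by
  obtain ⟨g, hgm, hgp, hgb, hgf⟩ := exists_mul_zeta_pow hm hp hb 10
  have h1 := polyLog_mul_of_summable (g := g) (a := Zt ^ (9 + 1)) (σ := 1 / 34) (by norm_num)
    (by norm_num) (fun s hs => summable_of_locBound hgm
      (fun p hp => by rw [hgp p hp]; norm_num) hgb hs) (polyLog_zeta_pow 9)
  rw [hgf] at h1
  obtain ⟨P, hP, hE⟩ := h1
  refine ⟨P, ?_, hE⟩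
  by_contra hne
  have hP8 : P.natDegree ≤ 8 := by
    by_contra hlt
    have h9 : P.natDegree = 9 := by omega
    exact hne ((Polynomial.degree_eq_iff_natDegree_eq_of_pos (by norm_num)).2 h9)
  obtain ⟨C, hC0, hC⟩ := hE.nonneg_const (s := 0) (by norm_num)
  refine not_summatory_le hm h0 hp
    (C + ∑ i ∈ range (P.natDegree + 1), |P.coeff i|) (by positivity) fun y hy => ?_
  have hl := Real.log_nonneg hy
  have h2 := hC y hy
  have h3 := abs_eval_le_one_add_pow P hP8 hl
  have h4 : (1 : ℝ) ≤ (1 + Real.log y) ^ 8 := one_le_pow₀ (by linarith)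
  simp only [neg_zero, Real.rpow_zero, mul_one] at h2
  have h5 : summatory f y / y ≤
      (C + ∑ i ∈ range (P.natDegree + 1), |P.coeff i|) * (1 + Real.log y) ^ 8 := by
    have := le_abs_self (summatory f y / y - P.eval (Real.log y))
    have := le_abs_self (P.eval (Real.log y))
    nlinarith
  rw [div_le_iff₀ (by linarith)] at h5
  linarith

/-- The number of unital subrings of `ℤ ^ ι` of additive index `N`. -/
noncomputable def numSubrings (ι : Type*) (N : ℕ) : ℕ :=
  Nat.card {R : Subring (ι → ℤ) // R.toAddSubgroup.index = N}

theorem finite_addSubgroup_index (ι : Type*) [Finite ι] {N : ℕ} (hN : N ≠ 0) :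
    {H : AddSubgroup (ι → ℤ) | H.index = N}.Finite := by
  have : NeZero N := ⟨hN⟩
  let φ : (ι → ℤ) →+ (ι → ZMod N) :=
    { toFun := fun x i => (x i : ZMod N)
      map_zero' := by ext; simp
      map_add' := fun x y => by ext; simp }
  refine Set.Finite.of_injOn (f := fun H => H.map φ) (t := Set.univ) (fun _ _ => Set.mem_univ _)
    ?_ Set.finite_univ
  have key : ∀ H : AddSubgroup (ι → ℤ), H.index = N → (H.map φ).comap φ = H := by
    intro H hH
    refine AddSubgroup.comap_map_eq_self fun x hx => ?_
    have hx' : ∀ i, ∃ y : ℤ, x i = N * y := fun i => by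
      have h1 : φ x i = 0 := by rw [AddMonoidHom.mem_ker.1 hx]; rfl
      exact (ZMod.intCast_zmod_eq_zero_iff_dvd (x i) N).1 h1
    choose y hy using hx'
    have h2 := H.nsmul_index_mem y
    rw [hH] at h2
    convert h2 using 1
    ext i
    simp [hy i]
  intro H hH H' hH' h
  rw [← key H hH, ← key H' hH']
  exact congrArg (AddSubgroup.comap φ) h

theorem finite_subring_index (ι : Type*) [Finite ι] {N : ℕ} (hN : N ≠ 0) :
    {R : Subring (ι → ℤ) | R.toAddSubgroup.index = N}.Finite := by
  refine Set.Finite.of_injOn (f := fun R => R.toAddSubgroup) (fun _ h => h) ?_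
    (finite_addSubgroup_index ι hN)
  intro R _ R' _ h
  exact Subring.toAddSubgroup_injective h

theorem Subring.nsmul_mem_of_index {A : Type*} [CommRing A] {R : Subring A} {N : ℕ}
    (h : R.toAddSubgroup.index = N) (x : A) : N • x ∈ R :=
  h ▸ R.toAddSubgroup.nsmul_index_mem x

theorem AddSubgroup.mem_of_coprime_nsmul_mem {A : Type*} [AddCommGroup A] (H : AddSubgroup A)
    {m n : ℕ} (hc : m.Coprime n) {x : A} (hm : m • x ∈ H) (hn : n • x ∈ H) : x ∈ H := by
  have h := H.add_mem (H.zsmul_mem hm (m.gcdA n)) (H.zsmul_mem hn (m.gcdB n))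
  rw [← natCast_zsmul, ← natCast_zsmul, ← mul_smul, ← mul_smul, ← add_smul, mul_comm,
    mul_comm (m.gcdB n), ← Nat.gcd_eq_gcd_ab, hc.gcd_eq_one, Nat.cast_one, one_smul] at h
  exact h

/-- An additive subgroup containing all `m`-multiples has index coprime to `n` whenever `m` and
`n` are coprime. -/
theorem AddSubgroup.coprime_index {A : Type*} [AddCommGroup A] (H : AddSubgroup A)
    {m n : ℕ} (hc : m.Coprime n) (h0 : H.index ≠ 0) (hm : ∀ x : A, m • x ∈ H) :
    H.index.Coprime n := by
  refine Nat.Coprime.symm (Nat.coprime_of_dvd fun q hq hqn hqi => ?_)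
  have : Fact q.Prime := ⟨hq⟩
  have : Finite (A ⧸ H) := AddSubgroup.index_ne_zero_iff_finite.1 h0
  obtain ⟨y, hy⟩ := exists_prime_addOrderOf_dvd_card' (G := A ⧸ H) q hqi
  induction y using QuotientAddGroup.induction_on with
  | H x =>
    have h1 : m • (x : A ⧸ H) = 0 := by
      rw [← QuotientAddGroup.mk_nsmul]; exact (QuotientAddGroup.eq_zero_iff _).2 (hm x)
    have h2 := addOrderOf_dvd_of_nsmul_eq_zero h1
    rw [hy] at h2
    exact hq.one_lt.ne' (Nat.dvd_one.1 (hc.gcd_eq_one ▸ Nat.dvd_gcd h2 hqn))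

/-- For a subring `R` containing all `mn`-multiples, with `m` and `n` coprime, the subring of
all `x` with `n x ∈ R`. -/
def Subring.divBy {A : Type*} [CommRing A] (R : Subring A) {m n : ℕ} (hc : m.Coprime n)
    (h : ∀ x : A, (m * n) • x ∈ R) : Subring A where
  carrier := {x | n • x ∈ R}
  mul_mem' {x y} hx hy := by
    refine R.toAddSubgroup.mem_of_coprime_nsmul_mem hc (x := n • (x * y)) ?_ ?_
    · rw [← mul_smul]; exact h _
    · have := R.mul_mem hx hy
      rwa [smul_mul_smul_comm, mul_smul] at this
  one_mem' := R.nsmul_mem R.one_mem n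
  add_mem' {x y} hx hy := by
    have := R.add_mem hx hy
    rwa [← smul_add] at this
  zero_mem' := by simp [R.zero_mem]
  neg_mem' {x} hx := by
    have := R.neg_mem hx
    rwa [← smul_neg] at this

theorem index_inf_of_coprime {A : Type*} [AddCommGroup A] {H K : AddSubgroup A} {m n : ℕ}
    (hc : m.Coprime n) (hm : H.index = m) (hn : K.index = n) (hm0 : m ≠ 0) (hn0 : n ≠ 0) :
    (H ⊓ K).index = m * n := by
  refine le_antisymm (hm ▸ hn ▸ AddSubgroup.index_inf_le) ?_
  refine Nat.le_of_dvd (Nat.pos_of_ne_zero (AddSubgroup.index_inf_ne_zero (hm ▸ hm0) (hn ▸ hn0)))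
    (hc.mul_dvd_of_dvd_of_dvd ?_ ?_)
  · rw [← hm]; exact AddSubgroup.index_dvd_of_le inf_le_left
  · rw [← hn]; exact AddSubgroup.index_dvd_of_le inf_le_right

theorem index_divBy {A : Type*} [CommRing A] {R : Subring A} {m n : ℕ} (hc : m.Coprime n)
    (hm0 : m ≠ 0) (hn0 : n ≠ 0) (hR : R.toAddSubgroup.index = m * n)
    (h1 : ∀ x : A, (m * n) • x ∈ R) (h2 : ∀ x : A, (n * m) • x ∈ R) :
    (R.divBy hc h1).toAddSubgroup.index = m ∧ (R.divBy hc.symm h2).toAddSubgroup.index = n := by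
  set R1 := R.divBy hc h1
  set R2 := R.divBy hc.symm h2
  have hle1 : R.toAddSubgroup ≤ R1.toAddSubgroup := fun x hx => R.nsmul_mem hx n
  have hle2 : R.toAddSubgroup ≤ R2.toAddSubgroup := fun x hx => R.nsmul_mem hx m
  have hinf : R1.toAddSubgroup ⊓ R2.toAddSubgroup = R.toAddSubgroup := by
    refine le_antisymm (fun x hx => ?_) (le_inf hle1 hle2)
    exact R.toAddSubgroup.mem_of_coprime_nsmul_mem hc hx.2 hx.1
  have hd1 := AddSubgroup.index_dvd_of_le hle1
  have hd2 := AddSubgroup.index_dvd_of_le hle2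
  rw [hR] at hd1 hd2
  have h01 : R1.toAddSubgroup.index ≠ 0 := fun h => by
    rw [h, Nat.zero_dvd] at hd1; exact mul_ne_zero hm0 hn0 hd1
  have h02 : R2.toAddSubgroup.index ≠ 0 := fun h => by
    rw [h, Nat.zero_dvd] at hd2; exact mul_ne_zero hm0 hn0 hd2
  have hc1 := R1.toAddSubgroup.coprime_index hc h01 fun x => by
    change n • (m • x) ∈ R
    rw [← mul_smul]; exact h2 x
  have hc2 := R2.toAddSubgroup.coprime_index hc.symm h02 fun x => by
    change m • (n • x) ∈ R
    rw [← mul_smul]; exact h1 x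
  have hd1' := Nat.le_of_dvd (Nat.pos_of_ne_zero hm0) (hc1.dvd_of_dvd_mul_right hd1)
  have hd2' := Nat.le_of_dvd (Nat.pos_of_ne_zero hn0) (hc2.dvd_of_dvd_mul_left hd2)
  have hge := AddSubgroup.index_inf_le (H := R1.toAddSubgroup) (K := R2.toAddSubgroup)
  rw [hinf, hR] at hge
  constructor <;> by_contra hne
  · have : R1.toAddSubgroup.index < m := lt_of_le_of_ne hd1' hne
    have := Nat.mul_lt_mul_of_lt_of_le this hd2' (Nat.pos_of_ne_zero hn0)
    omega
  · have : R2.toAddSubgroup.index < n := lt_of_le_of_ne hd2' hne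
    have := Nat.mul_lt_mul_of_le_of_lt hd1' this (Nat.pos_of_ne_zero hm0)
    omega

theorem numSubrings_mul (ι : Type*) {m n : ℕ} (hc : m.Coprime n) (hm0 : m ≠ 0) (hn0 : n ≠ 0) :
    numSubrings ι (m * n) = numSubrings ι m * numSubrings ι n := by
  rw [numSubrings, numSubrings, numSubrings, ← Nat.card_prod]
  have hs1 : ∀ R : Subring (ι → ℤ), R.toAddSubgroup.index = m * n → ∀ x, (m * n) • x ∈ R :=
    fun R h => R.nsmul_mem_of_index h
  have hs2 : ∀ R : Subring (ι → ℤ), R.toAddSubgroup.index = m * n → ∀ x, (n * m) • x ∈ R :=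
    fun R h => R.nsmul_mem_of_index (h.trans (mul_comm m n))
  let F : {R : Subring (ι → ℤ) // R.toAddSubgroup.index = m * n} →
      {R : Subring (ι → ℤ) // R.toAddSubgroup.index = m} ×
        {R : Subring (ι → ℤ) // R.toAddSubgroup.index = n} := fun R =>
    (⟨R.1.divBy hc (hs1 R.1 R.2),
        (index_divBy hc hm0 hn0 R.2 (hs1 R.1 R.2) (hs2 R.1 R.2)).1⟩,
      ⟨R.1.divBy hc.symm (hs2 R.1 R.2),
        (index_divBy hc hm0 hn0 R.2 (hs1 R.1 R.2) (hs2 R.1 R.2)).2⟩)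
  refine Nat.card_eq_of_bijective F ⟨fun R R' h => ?_, fun Q => ?_⟩
  · have h1 : ∀ x, n • x ∈ R.1 ↔ n • x ∈ R'.1 := fun x =>
      SetLike.ext_iff.1 (congrArg (fun Q => Q.1.1) h) x
    have h2 : ∀ x, m • x ∈ R.1 ↔ m • x ∈ R'.1 := fun x =>
      SetLike.ext_iff.1 (congrArg (fun Q => Q.2.1) h) x
    refine Subtype.ext (Subring.ext fun x => ⟨fun hx => ?_, fun hx => ?_⟩)
    · exact R'.1.toAddSubgroup.mem_of_coprime_nsmul_mem hc ((h2 x).1 (R.1.nsmul_mem hx m))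
        ((h1 x).1 (R.1.nsmul_mem hx n))
    · exact R.1.toAddSubgroup.mem_of_coprime_nsmul_mem hc ((h2 x).2 (R'.1.nsmul_mem hx m))
        ((h1 x).2 (R'.1.nsmul_mem hx n))
  · obtain ⟨⟨R1, h1⟩, ⟨R2, h2⟩⟩ := Q
    have hinf : (R1 ⊓ R2).toAddSubgroup = R1.toAddSubgroup ⊓ R2.toAddSubgroup := by ext; rfl
    refine ⟨⟨R1 ⊓ R2, by rw [hinf, index_inf_of_coprime hc h1 h2 hm0 hn0]⟩, ?_⟩
    refine Prod.ext (Subtype.ext (Subring.ext fun x => ?_)) (Subtype.ext (Subring.ext fun x => ?_))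
    · exact ⟨fun h => R1.toAddSubgroup.mem_of_coprime_nsmul_mem hc
        (R1.nsmul_mem_of_index h1 x) h.1,
        fun h => ⟨R1.nsmul_mem h n, R2.nsmul_mem_of_index h2 x⟩⟩
    · exact ⟨fun h => R2.toAddSubgroup.mem_of_coprime_nsmul_mem hc h.2
        (R2.nsmul_mem_of_index h2 x),
        fun h => ⟨R1.nsmul_mem_of_index h1 x, R2.nsmul_mem h m⟩⟩

theorem numSubrings_one (ι : Type*) : numSubrings ι 1 = 1 := by
  rw [numSubrings, Nat.card_eq_one_iff_unique]
  refine ⟨⟨fun R R' => Subtype.ext ?_⟩, ⟨⟨⊤, AddSubgroup.index_top⟩⟩⟩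
  have h1 := AddSubgroup.index_eq_one.1 R.2
  have h2 := AddSubgroup.index_eq_one.1 R'.2
  exact Subring.toAddSubgroup_injective (h1.trans h2.symm)

/-- The subring of `ℤ ^ ι` cut out by the congruence `x i ≡ x j` modulo `N`. -/
def congruenceSubring {ι : Type*} (N : ℕ) (i j : ι) : Subring (ι → ℤ) where
  carrier := {x | (N : ℤ) ∣ x i - x j}
  mul_mem' {x y} hx hy := by
    change (N : ℤ) ∣ x i * y i - x j * y j
    rw [show x i * y i - x j * y j = (x i - x j) * y i + x j * (y i - y j) by ring]
    exact (Dvd.dvd.mul_right hx _).add (Dvd.dvd.mul_left hy _)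
  one_mem' := by simp
  add_mem' {x y} hx hy := by
    change (N : ℤ) ∣ x i + y i - (x j + y j)
    rw [add_sub_add_comm]
    exact dvd_add hx hy
  zero_mem' := by simp
  neg_mem' {x} hx := by
    change (N : ℤ) ∣ -x i - -x j
    rw [neg_sub_neg]
    exact dvd_sub_comm.1 hx

theorem mem_congruenceSubring {ι : Type*} {N : ℕ} {i j : ι} {x : ι → ℤ} :
    x ∈ congruenceSubring N i j ↔ (N : ℤ) ∣ x i - x j := Iff.rfl

theorem index_congruenceSubring {ι : Type*} [DecidableEq ι] {N : ℕ} {i j : ι} (hij : i ≠ j) :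
    (congruenceSubring N i j).toAddSubgroup.index = N := by
  let φ : (ι → ℤ) →+ ZMod N :=
    { toFun := fun x => ((x i - x j : ℤ) : ZMod N)
      map_zero' := by simp
      map_add' := fun x y => by simp; ring }
  have hker : (congruenceSubring N i j).toAddSubgroup = φ.ker := by
    ext x
    exact (ZMod.intCast_zmod_eq_zero_iff_dvd (x i - x j) N).symm
  have hsurj : Function.Surjective φ := fun z => by
    obtain ⟨a, rfl⟩ := ZMod.intCast_surjective z
    refine ⟨Pi.single i a, ?_⟩
    change (((Pi.single i a : ι → ℤ) i - (Pi.single i a : ι → ℤ) j : ℤ) : ZMod N) = a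
    simp [Pi.single_eq_of_ne hij.symm]
  rw [hker, AddSubgroup.index_ker, AddMonoidHom.range_eq_top.2 hsurj, AddSubgroup.card_top,
    Nat.card_zmod]

theorem Subring.eq_top_of_single_mem {ι : Type*} [Fintype ι] [DecidableEq ι]
    {R : Subring (ι → ℤ)} (h : ∀ i, Pi.single i 1 ∈ R) : R = ⊤ := by
  refine eq_top_iff.2 fun x _ => ?_
  have : x = ∑ i, x i • (Pi.single i 1 : ι → ℤ) := by
    ext j
    simp [Finset.sum_apply, Pi.single_apply]
  rw [this]
  exact R.sum_mem fun i _ => R.zsmul_mem (h i) _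

theorem Subring.const_mem {ι : Type*} (R : Subring (ι → ℤ)) (c : ℤ) : (fun _ => c) ∈ R :=
  intCast_mem R c

theorem exists_le_congruenceSubring {ι : Type*} [Fintype ι] [DecidableEq ι] {p k : ℕ}
    (hp : p.Prime) {R : Subring (ι → ℤ)} (hR : R.toAddSubgroup.index = p ^ k) (hne : R ≠ ⊤) :
    ∃ i j, i ≠ j ∧ R ≤ congruenceSubring p i j := by
  by_contra! hcon
  have hcon' : ∀ i j, ∃ y : ι → ℤ, y ∈ R ∧ (i ≠ j → ¬ (p : ℤ) ∣ y i - y j) := by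
    intro i j
    by_cases hij : i = j
    · exact ⟨0, R.zero_mem, fun h => absurd hij h⟩
    · obtain ⟨y, hy, hy'⟩ := SetLike.not_le_iff_exists.1 (hcon i j hij)
      exact ⟨y, hy, fun _ => hy'⟩
  choose y hyR hy using hcon'
  refine hne (Subring.eq_top_of_single_mem fun i => ?_)
  set u : ℤ := ∏ j ∈ Finset.univ.erase i, (y i j i - y i j j) with hu
  have hz : (∏ j ∈ Finset.univ.erase i, (y i j - fun _ => y i j j)) ∈ R :=
    R.prod_mem fun j _ => R.sub_mem (hyR i j) (R.const_mem _)
  have hzu : (∏ j ∈ Finset.univ.erase i, (y i j - fun _ => y i j j)) = u • Pi.single i 1 := by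
    ext l
    rw [Finset.prod_apply]
    by_cases hl : l = i
    · subst hl; simp [hu]
    · rw [Finset.prod_eq_zero (i := l) (by simp [hl]) (by simp)]
      simp [Pi.single_eq_of_ne hl]
  have hpu : ¬ (p : ℤ) ∣ u := by
    rw [hu, Prime.dvd_finsetProd_iff (Nat.prime_iff_prime_int.1 hp)]
    rintro ⟨j, hj, hd⟩
    exact hy i j (Finset.ne_of_mem_erase hj).symm hd
  rw [hzu] at hz
  refine R.toAddSubgroup.mem_of_coprime_nsmul_mem (m := u.natAbs) (n := p ^ k) ?_ ?_ ?_
  · exact Nat.Coprime.pow_right k ((Nat.Prime.coprime_iff_not_dvd hp).2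
      fun h => hpu (Int.natCast_dvd.2 h)).symm
  · rw [← natCast_zsmul]
    rcases Int.natAbs_eq u with h | h
    · rw [← h]; exact hz
    · have := R.neg_mem hz
      rw [← neg_smul] at this
      rwa [show ((u.natAbs : ℕ) : ℤ) = -u by omega]
  · exact R.nsmul_mem_of_index hR _

theorem numSubrings_prime {p : ℕ} (hp : p.Prime) : numSubrings (Fin 5) p = 10 := by
  classical
  set S : Finset (Fin 5 × Fin 5) := Finset.univ.filter fun q => q.1 < q.2 with hS
  have hcard : S.card = 10 := by decide
  have himg : {R : Subring (Fin 5 → ℤ) | R.toAddSubgroup.index = p} =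
      (fun q : Fin 5 × Fin 5 => congruenceSubring p q.1 q.2) '' (S : Set (Fin 5 × Fin 5)) := by
    ext R
    constructor
    · intro (hR : R.toAddSubgroup.index = p)
      have hne : R ≠ ⊤ := by
        rintro rfl
        exact hp.one_lt.ne (AddSubgroup.index_top.symm.trans hR)
      have hfin : R.toAddSubgroup.FiniteIndex := ⟨hR ▸ hp.ne_zero⟩
      obtain ⟨i, j, hij, hle⟩ := exists_le_congruenceSubring (k := 1) hp (by rwa [pow_one]) hne
      have heq : ∀ i j, i ≠ j → R ≤ congruenceSubring p i j → congruenceSubring p i j = R := by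
        intro i j hij hle
        by_contra hne'
        have h1 : R.toAddSubgroup < (congruenceSubring p i j).toAddSubgroup :=
          lt_of_le_of_ne hle fun h => hne' (Subring.toAddSubgroup_injective h).symm
        have h2 := AddSubgroup.index_strictAnti h1
        rw [index_congruenceSubring hij, hR] at h2
        exact lt_irrefl _ h2
      rcases lt_or_gt_of_ne hij with h | h
      · exact ⟨(i, j), by simpa [hS] using h, heq i j hij hle⟩
      · refine ⟨(j, i), by simpa [hS] using h, heq j i hij.symm fun x hx => ?_⟩
        exact (dvd_sub_comm).1 (hle hx)
    · rintro ⟨q, hq, rfl⟩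
      exact index_congruenceSubring (by simpa [hS] using hq : q.1 < q.2).ne
  have hinj : Set.InjOn (fun q : Fin 5 × Fin 5 => congruenceSubring p q.1 q.2)
      (S : Set (Fin 5 × Fin 5)) := by
    rintro ⟨i, j⟩ hij ⟨k, l⟩ hkl h
    replace hij : i < j := by simpa [hS] using hij
    replace hkl : k < l := by simpa [hS] using hkl
    have hmem : ∀ i j t : Fin 5, i ≠ j →
        ((Pi.single t 1 : Fin 5 → ℤ) ∈ congruenceSubring p i j ↔ t ≠ i ∧ t ≠ j) := by
      intro i j t hij
      have h1 : ¬ (p : ℤ) ∣ 1 := fun h => hp.one_lt.ne' (by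
        exact_mod_cast Int.eq_one_of_dvd_one (by positivity) h)
      rw [mem_congruenceSubring]
      by_cases hi : t = i
      · subst hi; simpa [Pi.single_eq_of_ne hij.symm] using h1
      · by_cases hj : t = j
        · subst hj; simpa [Pi.single_eq_of_ne hij] using h1
        · simp [Ne.symm hi, Ne.symm hj, hi, hj]
    have hk := hmem i j k hij.ne
    have hl := hmem i j l hij.ne
    simp only at h
    rw [h, hmem k l _ hkl.ne] at hk hl
    have : i = k ∧ j = l := by
      clear h hmem himg
      omega
    rw [this.1, this.2]
  change Nat.card {R : Subring (Fin 5 → ℤ) | R.toAddSubgroup.index = p} = 10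
  rw [himg, Nat.card_coe_set_eq, hinj.ncard_image, Set.ncard_coe_finset, hcard]

theorem wt_nonneg (p k : ℕ) : 0 ≤ wt p k := by
  rw [wt]; split_ifs <;> positivity

theorem wt_mul_le {p : ℕ} (hp : 1 ≤ p) (i j : ℕ) : wt p i * wt p j ≤ wt p (i + j) := by
  rcases Nat.lt_or_ge 1 i with hi | hi
  · rcases Nat.lt_or_ge 1 j with hj | hj
    · have h1 : (1 : ℝ) ≤ p := by exact_mod_cast hp
      rw [wt, wt, wt, if_neg (by omega), if_neg (by omega), if_neg (by omega),
        ← Real.rpow_add (by positivity)]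
      refine Real.rpow_le_rpow_of_exponent_le h1 ?_
      push_cast
      linarith
    · rw [show wt p j = 1 from if_pos hj, mul_one]
      exact wt_mono hp (Nat.le_add_right _ _)
  · rw [show wt p i = 1 from if_pos hi, one_mul]
    exact wt_mono hp (Nat.le_add_left _ _)

/-- The subring `R` of `ℤ ^ ι` is not local at `p`: some element of `R` is not constant
modulo `p`. -/
def Nonlocal {ι : Type*} (p : ℕ) (R : Subring (ι → ℤ)) : Prop :=
  ∃ x ∈ R, ∃ i j, ¬ (p : ℤ) ∣ x i - x j

theorem Nonlocal.exists_indicator_mem {ι : Type*} {p k : ℕ} (hp : p.Prime)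
    {R : Subring (ι → ℤ)} (hR : ∀ x, (p ^ k) • x ∈ R) (h : Nonlocal p R) :
    ∃ S : Set ι, S.Nonempty ∧ Sᶜ.Nonempty ∧ S.indicator 1 ∈ R := by
  classical
  obtain ⟨x, hx, i, j, hij⟩ := h
  set y : ι → ℤ := x - fun _ => x j with hy
  have hyR : y ∈ R := R.sub_mem hx (R.const_mem _)
  refine ⟨{l | ¬ (p : ℤ) ∣ y l}, ⟨i, hij⟩, ⟨j, fun h => h (by simp [hy])⟩, ?_⟩
  set e : ι → ℤ := Set.indicator {l | ¬ (p : ℤ) ∣ y l} 1 with he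
  have hd : ∀ l, ((p ^ k : ℕ) : ℤ) ∣ (y ^ ((p - 1) * p ^ k)) l - e l := by
    intro l
    have h1 : (p : ℤ) ∣ y l ^ (p - 1) - e l := by
      by_cases hl : (p : ℤ) ∣ y l
      · have : e l = 0 := Set.indicator_of_notMem (s := {l | ¬ (p : ℤ) ∣ y l}) (fun h => h hl) _
        rw [this, sub_zero]
        exact dvd_pow hl (Nat.sub_ne_zero_of_lt hp.one_lt)
      · have : e l = 1 := Set.indicator_of_mem (s := {l | ¬ (p : ℤ) ∣ y l}) hl _
        rw [this]
        refine (Int.ModEq.pow_card_sub_one_eq_one hp ?_).symm.dvd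
        exact ((Nat.prime_iff_prime_int.1 hp).coprime_iff_not_dvd.2 hl).symm
    have h2 := dvd_sub_pow_of_dvd_sub h1 k
    have h3 : e l ^ p ^ k = e l := by
      have hpk : p ^ k ≠ 0 := pow_ne_zero _ hp.ne_zero
      rw [he, Set.indicator_apply]
      split_ifs
      · exact one_pow _
      · exact zero_pow hpk
    rw [h3, ← pow_mul] at h2
    rw [Pi.pow_apply]
    push_cast
    exact (pow_dvd_pow _ (Nat.le_succ k)).trans h2
  choose t ht using hd
  have : e = y ^ ((p - 1) * p ^ k) - (p ^ k) • t := by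
    ext l
    have := ht l
    rw [Pi.sub_apply, Pi.smul_apply, nsmul_eq_mul]
    linarith
  rw [this]
  exact R.sub_mem (R.pow_mem hyR _) (hR t)

/-- Restriction of coordinates as a ring homomorphism. -/
def restrictHom {ι : Type*} (S : Set ι) : (ι → ℤ) →+* ({i // i ∈ S} → ℤ) where
  toFun x i := x i
  map_one' := rfl
  map_mul' _ _ := rfl
  map_zero' := rfl
  map_add' _ _ := rfl

theorem mem_iff_of_indicator_mem {ι : Type*} {S : Set ι} {R : Subring (ι → ℤ)}
    (hS : S.indicator 1 ∈ R) (x : ι → ℤ) :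
    x ∈ R ↔ restrictHom S x ∈ R.map (restrictHom S) ∧
      restrictHom Sᶜ x ∈ R.map (restrictHom Sᶜ) := by
  classical
  refine ⟨fun h => ⟨⟨x, h, rfl⟩, ⟨x, h, rfl⟩⟩, ?_⟩
  rintro ⟨⟨y, hy, hyx⟩, ⟨z, hz, hzx⟩⟩
  have : x = S.indicator 1 * y + (1 - S.indicator 1) * z := by
    ext l
    by_cases hl : l ∈ S
    · have := congrFun hyx ⟨l, hl⟩
      simp only [restrictHom] at this
      simpa [hl] using this.symm
    · have := congrFun hzx ⟨l, hl⟩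
      simp only [restrictHom] at this
      simpa [hl] using this.symm
  rw [this]
  exact R.add_mem (R.mul_mem hS hy) (R.mul_mem (R.sub_mem R.one_mem hS) hz)

theorem index_of_indicator_mem {ι : Type*} {S : Set ι} {R : Subring (ι → ℤ)}
    (hS : S.indicator 1 ∈ R) :
    R.toAddSubgroup.index = (R.map (restrictHom S)).toAddSubgroup.index *
      (R.map (restrictHom Sᶜ)).toAddSubgroup.index := by
  classical
  let ψ : (ι → ℤ) →+ ({i // i ∈ S} → ℤ) × ({i // i ∈ Sᶜ} → ℤ) :=
    (restrictHom S).toAddMonoidHom.prod (restrictHom Sᶜ).toAddMonoidHom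
  have hψ : Function.Surjective ψ := fun ⟨u, v⟩ => by
    refine ⟨fun i => if h : i ∈ S then u ⟨i, h⟩ else v ⟨i, h⟩, Prod.ext ?_ ?_⟩
    · ext ⟨i, hi⟩
      exact dif_pos hi
    · ext ⟨i, hi⟩
      exact dif_neg hi
  have : R.toAddSubgroup = ((R.map (restrictHom S)).toAddSubgroup.prod
      (R.map (restrictHom Sᶜ)).toAddSubgroup).comap ψ := by
    ext x
    exact (mem_iff_of_indicator_mem hS x)
  rw [this, AddSubgroup.index_comap_of_surjective _ hψ, AddSubgroup.index_prod]

theorem numSubrings_eq_ncard (ι : Type*) (N : ℕ) :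
    numSubrings ι N = {R : Subring (ι → ℤ) | R.toAddSubgroup.index = N}.ncard :=
  Nat.card_coe_set_eq _

open Classical in
theorem ncard_nonlocal_le {ι : Type*} [Fintype ι] {p : ℕ} (hp : p.Prime) (k : ℕ) :
    {R : Subring (ι → ℤ) | R.toAddSubgroup.index = p ^ k ∧ Nonlocal p R}.ncard ≤
      ∑ S : {S : Set ι // S.Nonempty ∧ Sᶜ.Nonempty}, ∑ q ∈ antidiagonal k,
        numSubrings {i // i ∈ S.1} (p ^ q.1) * numSubrings {i // i ∈ S.1ᶜ} (p ^ q.2) := by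
  set s : {S : Set ι // S.Nonempty ∧ Sᶜ.Nonempty} × (ℕ × ℕ) → Set (Subring (ι → ℤ)) := fun z =>
    {R | z.1.1.indicator 1 ∈ R ∧ (R.map (restrictHom z.1.1)).toAddSubgroup.index = p ^ z.2.1 ∧
      (R.map (restrictHom z.1.1ᶜ)).toAddSubgroup.index = p ^ z.2.2} with hs
  have hfin : ∀ (κ : Type _) [Finite κ] (a : ℕ),
      {R : Subring (κ → ℤ) | R.toAddSubgroup.index = p ^ a}.Finite := fun κ _ a =>
    finite_subring_index κ (pow_ne_zero a hp.ne_zero)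
  have hfin2 : ∀ z : {S : Set ι // S.Nonempty ∧ Sᶜ.Nonempty} × (ℕ × ℕ), (s z).Finite ∧
      (s z).ncard ≤ numSubrings {i // i ∈ z.1.1} (p ^ z.2.1) *
        numSubrings {i // i ∈ z.1.1ᶜ} (p ^ z.2.2) := by
    intro z
    have hinj : Set.InjOn (fun R : Subring (ι → ℤ) =>
        (R.map (restrictHom z.1.1), R.map (restrictHom z.1.1ᶜ))) (s z) := by
      intro R hR R' hR' h
      have h1 := congrArg Prod.fst h
      have h2 := congrArg Prod.snd h
      simp only at h1 h2
      ext x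
      rw [mem_iff_of_indicator_mem hR.1, mem_iff_of_indicator_mem hR'.1, h1, h2]
    have hmaps : Set.MapsTo (fun R : Subring (ι → ℤ) =>
        (R.map (restrictHom z.1.1), R.map (restrictHom z.1.1ᶜ))) (s z)
        ({R | R.toAddSubgroup.index = p ^ z.2.1} ×ˢ {R | R.toAddSubgroup.index = p ^ z.2.2}) :=
      fun R hR => ⟨hR.2.1, hR.2.2⟩
    have hf := (hfin {i // i ∈ z.1.1} z.2.1).prod (hfin {i // i ∈ z.1.1ᶜ} z.2.2)
    refine ⟨Set.Finite.of_injOn hmaps hinj hf, ?_⟩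
    rw [numSubrings_eq_ncard, numSubrings_eq_ncard, ← Set.ncard_prod]
    exact Set.ncard_le_ncard_of_injOn _ hmaps hinj hf
  rw [← Finset.sum_product']
  have hsub : {R : Subring (ι → ℤ) | R.toAddSubgroup.index = p ^ k ∧ Nonlocal p R} ⊆
      ⋃ z ∈ (univ : Finset {S : Set ι // S.Nonempty ∧ Sᶜ.Nonempty}) ×ˢ antidiagonal k, s z := by
    rintro R ⟨hR, hN⟩
    obtain ⟨S, h1, h2, h3⟩ := hN.exists_indicator_mem hp (fun x => R.nsmul_mem_of_index hR x)
    have hidx := index_of_indicator_mem h3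
    rw [hR] at hidx
    obtain ⟨a, b, hab, ha, hb⟩ := (Nat.dvd_prime_pow hp).1 (Dvd.intro _ hidx.symm) |>.imp
      fun a ha => (Nat.dvd_prime_pow hp).1 (Dvd.intro_left _ hidx.symm) |>.imp
        fun b hb => (⟨(by
          rw [ha.2, hb.2, ← pow_add] at hidx
          exact Nat.pow_right_injective hp.two_le hidx : k = a + b), ha.2, hb.2⟩ :
            k = a + b ∧ _ ∧ _)
    simp only [Set.mem_iUnion]
    exact ⟨(⟨S, h1, h2⟩, (a, b)), by simp [hab], h3, ha, hb⟩
  refine (Set.ncard_le_ncard hsub ?_).trans ((Finset.set_ncard_biUnion_le _ _).trans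
    (Finset.sum_le_sum fun z _ => (hfin2 z).2))
  exact Set.Finite.biUnion (Finset.finite_toSet _) fun z _ => (hfin2 z).1

/-- Uniform bound for the numbers of subrings of index `p ^ k` of `ℤ ^ m`. -/
def SubringBound (m : ℕ) : Prop :=
  ∃ C : ℝ, 0 ≤ C ∧ ∃ D : ℕ, ∀ p : ℕ, p.Prime → ∀ (ι : Type) [Fintype ι], Fintype.card ι = m →
    ∀ k : ℕ, (numSubrings ι (p ^ k) : ℝ) ≤ C * (k + 1) ^ D * wt p k

theorem nonlocal_bound {m : ℕ} (h : ∀ m' < m, SubringBound m') :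
    ∃ C : ℝ, 0 ≤ C ∧ ∃ D : ℕ, ∀ p : ℕ, p.Prime → ∀ (ι : Type) [Fintype ι], Fintype.card ι = m →
      ∀ k : ℕ, ({R : Subring (ι → ℤ) | R.toAddSubgroup.index = p ^ k ∧ Nonlocal p R}.ncard : ℝ) ≤
        C * (k + 1) ^ D * wt p k := by
  classical
  choose C hC D hD using fun m' : Fin m => h m' m'.2
  set C₀ : ℝ := ∑ m', C m' with hC₀
  set D₀ : ℕ := ∑ m', D m' with hD₀
  have hC₀n : 0 ≤ C₀ := Finset.sum_nonneg fun i _ => hC i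
  have hb : ∀ p : ℕ, p.Prime → ∀ (ι : Type) [Fintype ι], Fintype.card ι < m →
      ∀ k : ℕ, (numSubrings ι (p ^ k) : ℝ) ≤ C₀ * (k + 1) ^ D₀ * wt p k := by
    intro p hp ι _ hι k
    refine (hD ⟨_, hι⟩ p hp ι rfl k).trans ?_
    have h1 : C ⟨_, hι⟩ ≤ C₀ := Finset.single_le_sum (fun i _ => hC i) (mem_univ _)
    have h2 : D ⟨_, hι⟩ ≤ D₀ := Finset.single_le_sum (fun i _ => Nat.zero_le _) (mem_univ _)
    have h3 : (1 : ℝ) ≤ (k : ℝ) + 1 := by linarith [Nat.cast_nonneg (α := ℝ) k]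
    have h4 := wt_nonneg p k
    gcongr
  refine ⟨2 ^ m * C₀ ^ 2, by positivity, 2 * D₀ + 1, fun p hp ι _ hι k => ?_⟩
  have hterm : ∀ S : {S : Set ι // S.Nonempty ∧ Sᶜ.Nonempty}, ∀ q ∈ antidiagonal k,
      ((numSubrings {i // i ∈ S.1} (p ^ q.1) * numSubrings {i // i ∈ S.1ᶜ} (p ^ q.2) : ℕ) : ℝ) ≤
        C₀ ^ 2 * (k + 1) ^ (2 * D₀) * wt p k := by
    rintro ⟨S, h1, h2⟩ q hq
    have hq' := mem_antidiagonal.1 hq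
    have c1 : Fintype.card {i // i ∈ S} < m := by
      rw [← hι]
      exact Fintype.card_subtype_lt h2.some_mem
    have c2 : Fintype.card {i // i ∈ Sᶜ} < m := by
      rw [← hι]
      exact Fintype.card_subtype_lt (x := h1.some) fun h => h h1.some_mem
    push_cast
    have e1 : (q.1 : ℝ) ≤ k := by exact_mod_cast (by omega : q.1 ≤ k)
    have e2 : (q.2 : ℝ) ≤ k := by exact_mod_cast (by omega : q.2 ≤ k)
    have w1 := wt_nonneg p q.1
    have w2 := wt_nonneg p q.2
    calc _ ≤ (C₀ * (q.1 + 1) ^ D₀ * wt p q.1) * (C₀ * (q.2 + 1) ^ D₀ * wt p q.2) :=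
          mul_le_mul (hb p hp _ c1 _) (hb p hp _ c2 _) (Nat.cast_nonneg _) (by positivity)
      _ ≤ (C₀ * (k + 1) ^ D₀ * wt p q.1) * (C₀ * (k + 1) ^ D₀ * wt p q.2) := by gcongr
      _ = C₀ ^ 2 * (k + 1) ^ (2 * D₀) * (wt p q.1 * wt p q.2) := by ring
      _ ≤ _ := by
          rw [← hq']
          gcongr
          exact wt_mul_le hp.one_le _ _
  have hcS : (Fintype.card {S : Set ι // S.Nonempty ∧ Sᶜ.Nonempty} : ℝ) ≤ 2 ^ m := by
    have := Fintype.card_subtype_le fun S : Set ι => S.Nonempty ∧ Sᶜ.Nonempty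
    rw [Fintype.card_set, hι] at this
    exact_mod_cast this
  have hw := wt_nonneg p k
  calc _ ≤ ((∑ S : {S : Set ι // S.Nonempty ∧ Sᶜ.Nonempty}, ∑ q ∈ antidiagonal k,
        numSubrings {i // i ∈ S.1} (p ^ q.1) * numSubrings {i // i ∈ S.1ᶜ} (p ^ q.2) : ℕ) : ℝ) := by
        exact_mod_cast ncard_nonlocal_le hp k
    _ ≤ ∑ S : {S : Set ι // S.Nonempty ∧ Sᶜ.Nonempty}, ∑ q ∈ antidiagonal k,
        C₀ ^ 2 * (k + 1) ^ (2 * D₀) * wt p k := by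
        rw [Nat.cast_sum]
        refine Finset.sum_le_sum fun S _ => ?_
        rw [Nat.cast_sum]
        exact Finset.sum_le_sum fun q hq => hterm S q hq
    _ = Fintype.card {S : Set ι // S.Nonempty ∧ Sᶜ.Nonempty} *
        ((k + 1) * (C₀ ^ 2 * (k + 1) ^ (2 * D₀) * wt p k)) := by
        simp [Finset.Nat.card_antidiagonal]
    _ ≤ 2 ^ m * ((k + 1) * (C₀ ^ 2 * (k + 1) ^ (2 * D₀) * wt p k)) := by gcongr
    _ = _ := by ring

/-- The additive subgroup of all `x` with `N x ∈ H`. -/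
def AddSubgroup.divNat {A : Type*} [AddCommGroup A] (H : AddSubgroup A) (N : ℕ) : AddSubgroup A :=
  H.comap (nsmulAddMonoidHom N)

theorem AddSubgroup.mem_divNat {A : Type*} [AddCommGroup A] {H : AddSubgroup A} {N : ℕ} {x : A} :
    x ∈ H.divNat N ↔ N • x ∈ H := Iff.rfl

/-- All elements of `R` are constant modulo `N`. -/
def ConstMod {ι : Type*} (N : ℕ) (R : Subring (ι → ℤ)) : Prop :=
  ∀ x ∈ R, ∀ i j, (N : ℤ) ∣ x i - x j

theorem ConstMod.mem_iff {ι : Type*} {N : ℕ} {R : Subring (ι → ℤ)} (h : ConstMod N R) (i₀ : ι)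
    (x : ι → ℤ) : x ∈ R ↔ ∃ c : ℤ, ∃ y ∈ R.toAddSubgroup.divNat N, x = (fun _ => c) + N • y := by
  constructor
  · intro hx
    choose y hy using fun i => h x hx i i₀
    have hxy : x = (fun _ => x i₀) + N • y := by
      ext i
      rw [Pi.add_apply, Pi.smul_apply, nsmul_eq_mul, ← hy]
      ring
    refine ⟨x i₀, y, ?_, hxy⟩
    have : N • y = x - fun _ => x i₀ := by
      rw [eq_sub_iff_add_eq, add_comm, ← hxy]
    rw [AddSubgroup.mem_divNat, this]
    exact R.sub_mem hx (R.const_mem _)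
  · rintro ⟨c, y, hy, rfl⟩
    exact R.add_mem (R.const_mem c) hy

theorem ConstMod.index_divNat {ι : Type*} [Fintype ι] {n N : ℕ} (hN : N ≠ 0)
    (hι : Fintype.card ι = n + 1) {R : Subring (ι → ℤ)} (h : ConstMod N R) :
    (R.toAddSubgroup.divNat N).index * N ^ n = R.toAddSubgroup.index := by
  classical
  have : NeZero N := ⟨hN⟩
  obtain ⟨i₀⟩ : Nonempty ι := Fintype.card_pos_iff.1 (by omega)
  let φ : (ι → ℤ) →+ ({i // i ≠ i₀} → ZMod N) :=
    { toFun := fun x i => ((x i - x i₀ : ℤ) : ZMod N)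
      map_zero' := by ext; simp
      map_add' := fun x y => by ext; simp; ring }
  have hφ : Function.Surjective φ := fun z => by
    choose u hu using fun i => ZMod.intCast_surjective (z i)
    refine ⟨fun i => if hi : i ≠ i₀ then u ⟨i, hi⟩ else 0, ?_⟩
    ext ⟨i, hi⟩
    change (((if hi : i ≠ i₀ then u ⟨i, hi⟩ else 0) -
      (if hi : i₀ ≠ i₀ then u ⟨i₀, hi⟩ else 0) : ℤ) : ZMod N) = _
    rw [dif_pos hi, dif_neg (by simp), sub_zero, hu]
  have hidx : φ.ker.index = N ^ n := by
    rw [AddSubgroup.index_ker, AddMonoidHom.range_eq_top.2 hφ, AddSubgroup.card_top,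
      Nat.card_fun, Nat.card_zmod, Nat.card_eq_fintype_card, Fintype.card_subtype_compl]
    simp [hι]
  have hmem : ∀ x, x ∈ φ.ker ↔ ∀ i, (N : ℤ) ∣ x i - x i₀ := by
    intro x
    rw [AddMonoidHom.mem_ker, funext_iff]
    constructor
    · intro hx i
      by_cases hi : i = i₀
      · subst hi; simp
      · exact (ZMod.intCast_zmod_eq_zero_iff_dvd _ N).1 (hx ⟨i, hi⟩)
    · exact fun hx i => (ZMod.intCast_zmod_eq_zero_iff_dvd _ N).2 (hx i)
  have hsup : (nsmulAddMonoidHom (α := ι → ℤ) N).range ⊔ R.toAddSubgroup = φ.ker := by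
    refine le_antisymm (sup_le ?_ fun x hx => (hmem x).2 fun i => h x hx i i₀) fun x hx => ?_
    · rintro _ ⟨y, rfl⟩
      refine (hmem _).2 fun i => ?_
      simp only [nsmulAddMonoidHom_apply, Pi.smul_apply, nsmul_eq_mul, ← mul_sub]
      exact dvd_mul_right _ _
    · choose y hy using (hmem x).1 hx
      refine AddSubgroup.mem_sup.2 ⟨N • y, ⟨y, rfl⟩, fun _ => x i₀, R.const_mem _, ?_⟩
      ext i
      rw [Pi.add_apply, Pi.smul_apply, nsmul_eq_mul, ← hy]
      ring
  have hle : R.toAddSubgroup ≤ φ.ker := hsup ▸ le_sup_right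
  rw [AddSubgroup.divNat, AddSubgroup.index_comap, ← AddSubgroup.relIndex_sup_right, hsup, ← hidx]
  exact AddSubgroup.relIndex_mul_index hle

theorem exists_constMod {ι : Type*} {p k : ℕ} (hp : p.Prime) {i₀ j₀ : ι} (hij : i₀ ≠ j₀)
    {R : Subring (ι → ℤ)} (hR : R.toAddSubgroup.index = p ^ k) (hloc : ¬ Nonlocal p R) :
    ∃ a, 1 ≤ a ∧ a ≤ k ∧ ConstMod (p ^ a) R ∧ ¬ ConstMod (p ^ (a + 1)) R := by
  classical
  have h1 : ConstMod (p ^ 1) R := fun x hx i j => by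
    by_contra h
    exact hloc ⟨x, hx, i, j, by simpa using h⟩
  have hle : ∀ a, ConstMod (p ^ a) R → a ≤ k := by
    intro a ha
    have h2 := ha _ (R.nsmul_mem_of_index hR (Pi.single i₀ 1)) i₀ j₀
    simp only [Pi.smul_apply, Pi.single_eq_same, Pi.single_eq_of_ne hij.symm, nsmul_eq_mul,
      mul_one, smul_zero, sub_zero] at h2
    exact (Nat.pow_dvd_pow_iff_le_right hp.one_lt).1 (Int.natCast_dvd_natCast.1 h2)
  refine ⟨Nat.findGreatest (fun a => ConstMod (p ^ a) R) k, ?_, Nat.findGreatest_le k, ?_, ?_⟩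
  · exact Nat.le_findGreatest (hle 1 h1) h1
  · exact Nat.findGreatest_spec (P := fun a => ConstMod (p ^ a) R) (hle 1 h1) h1
  · intro h
    exact absurd (Nat.le_findGreatest (P := fun a => ConstMod (p ^ a) R) (hle _ h) h) (by omega)

/-- The additive subgroups of `ℤ ^ ι` of index `p ^ j` containing `1`, with `p ^ a M M ⊆ M`, and
generating the subring `K`. -/
def scaledSubrings {A : Type*} [CommRing A] (p a j : ℕ) (K : Subring A) :
    Set (AddSubgroup A) :=
  {M | M.index = p ^ j ∧ 1 ∈ M ∧ (∀ x ∈ M, ∀ y ∈ M, (p ^ a) • (x * y) ∈ M) ∧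
    Subring.closure (M : Set A) = K}

theorem Nonlocal.of_not_constMod {ι : Type*} {p a : ℕ} {R : Subring (ι → ℤ)}
    (h : ConstMod (p ^ a) R) (h' : ¬ ConstMod (p ^ (a + 1)) R) (i₀ : ι) :
    Nonlocal p (Subring.closure (R.toAddSubgroup.divNat (p ^ a) : Set (ι → ℤ))) := by
  simp only [ConstMod, not_forall] at h'
  obtain ⟨x, hx, i, j, hd⟩ := h'
  obtain ⟨c, y, hy, rfl⟩ := (h.mem_iff i₀ x).1 hx
  refine ⟨y, Subring.subset_closure hy, i, j, fun hy' => hd ?_⟩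
  rw [Pi.add_apply, Pi.add_apply, Pi.smul_apply, Pi.smul_apply, add_sub_add_left_eq_sub,
    nsmul_eq_mul, nsmul_eq_mul, ← mul_sub, pow_succ, Nat.cast_mul]
  exact mul_dvd_mul_left _ hy'

theorem scaledSubrings_finite {ι : Type*} [Finite ι] {p : ℕ} (hp : p.Prime) (a j : ℕ)
    (K : Subring (ι → ℤ)) : (scaledSubrings p a j K).Finite :=
  (finite_addSubgroup_index ι (pow_ne_zero j hp.ne_zero)).subset fun _ h => h.1

theorem ncard_local_le {ι : Type*} [Fintype ι] {n p : ℕ} (hp : p.Prime) (hn : 1 ≤ n)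
    (hι : Fintype.card ι = n + 1) (k : ℕ) (g : ℕ → ℕ → ℝ)
    (hg : ∀ a i κ, 1 ≤ a → n * a + (κ + i) = k → ∀ K : Subring (ι → ℤ),
      K.toAddSubgroup.index = p ^ κ → ((scaledSubrings p a (κ + i) K).ncard : ℝ) ≤ g a κ)
    (hg0 : ∀ a κ, 0 ≤ g a κ) :
    ({R : Subring (ι → ℤ) | R.toAddSubgroup.index = p ^ k ∧ ¬ Nonlocal p R}.ncard : ℝ) ≤
      ∑ a ∈ Icc 1 k, ∑ κ ∈ range (k + 1),
        {K : Subring (ι → ℤ) | K.toAddSubgroup.index = p ^ κ ∧ Nonlocal p K}.ncard * g a κ := by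
  classical
  obtain ⟨i₀, j₀, hij⟩ := Fintype.exists_pair_of_one_lt_card (α := ι) (by omega)
  have hKfin : ∀ κ, {K : Subring (ι → ℤ) | K.toAddSubgroup.index = p ^ κ ∧ Nonlocal p K}.Finite :=
    fun κ => (finite_subring_index ι (pow_ne_zero κ hp.ne_zero)).subset fun _ h => h.1
  set T : Finset (ℕ × ℕ) := (Icc 1 k ×ˢ range (k + 1)).filter fun z => n * z.1 + z.2 ≤ k with hT
  set s : ℕ × ℕ → Set (Subring (ι → ℤ)) := fun z =>
    ⋃ K ∈ (hKfin z.2).toFinset, {R | ConstMod (p ^ z.1) R ∧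
      R.toAddSubgroup.divNat (p ^ z.1) ∈ scaledSubrings p z.1 (k - n * z.1) K} with hs
  have hsK : ∀ (z : ℕ × ℕ) (K : Subring (ι → ℤ)),
      {R | ConstMod (p ^ z.1) R ∧
        R.toAddSubgroup.divNat (p ^ z.1) ∈ scaledSubrings p z.1 (k - n * z.1) K}.Finite ∧
      {R | ConstMod (p ^ z.1) R ∧
        R.toAddSubgroup.divNat (p ^ z.1) ∈ scaledSubrings p z.1 (k - n * z.1) K}.ncard ≤
        (scaledSubrings p z.1 (k - n * z.1) K).ncard := by
    intro z K
    have hmaps : Set.MapsTo (fun R : Subring (ι → ℤ) => R.toAddSubgroup.divNat (p ^ z.1))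
        {R | ConstMod (p ^ z.1) R ∧
          R.toAddSubgroup.divNat (p ^ z.1) ∈ scaledSubrings p z.1 (k - n * z.1) K}
        (scaledSubrings p z.1 (k - n * z.1) K) := fun R hR => hR.2
    have hinj : Set.InjOn (fun R : Subring (ι → ℤ) => R.toAddSubgroup.divNat (p ^ z.1))
        {R | ConstMod (p ^ z.1) R ∧
          R.toAddSubgroup.divNat (p ^ z.1) ∈ scaledSubrings p z.1 (k - n * z.1) K} := by
      intro R hR R' hR' h
      simp only at h
      ext x
      rw [hR.1.mem_iff i₀, hR'.1.mem_iff i₀, h]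
    have hf := scaledSubrings_finite hp z.1 (k - n * z.1) K
    exact ⟨Set.Finite.of_injOn hmaps hinj hf, Set.ncard_le_ncard_of_injOn _ hmaps hinj hf⟩
  have hsub : {R : Subring (ι → ℤ) | R.toAddSubgroup.index = p ^ k ∧ ¬ Nonlocal p R} ⊆
      ⋃ z ∈ T, s z := by
    rintro R ⟨hR, hloc⟩
    obtain ⟨a, ha1, hak, hc, hc'⟩ := exists_constMod hp hij hR hloc
    have hidx := hc.index_divNat (pow_ne_zero a hp.ne_zero) hι
    set M := R.toAddSubgroup.divNat (p ^ a) with hM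
    rw [hR] at hidx
    obtain ⟨j, -, hj⟩ := (Nat.dvd_prime_pow hp).1 (Dvd.intro _ hidx)
    have hk : k = j + n * a := by
      rw [hj, ← pow_mul, ← pow_add] at hidx
      have := Nat.pow_right_injective hp.two_le hidx
      rw [mul_comm n a]
      exact this.symm
    set K := Subring.closure (M : Set (ι → ℤ)) with hK
    have hMK : M ≤ K.toAddSubgroup := Subring.subset_closure
    have hd := AddSubgroup.index_dvd_of_le hMK
    rw [hj] at hd
    obtain ⟨κ, hκ, hKi⟩ := (Nat.dvd_prime_pow hp).1 hd
    simp only [Set.mem_iUnion]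
    refine ⟨(a, κ), ?_, ?_⟩
    · simp only [hT, mem_filter, mem_product, mem_Icc, mem_range]
      omega
    · simp only [hs, Set.mem_iUnion]
      refine ⟨K, (hKfin κ).mem_toFinset.2 ⟨hKi, Nonlocal.of_not_constMod hc hc' i₀⟩, hc, ?_⟩
      refine ⟨by rw [hk, Nat.add_sub_cancel]; exact hj, R.nsmul_mem R.one_mem _, ?_, rfl⟩
      intro x hx y hy
      have : (p ^ a) • x * (p ^ a) • y ∈ R := R.mul_mem hx hy
      rw [smul_mul_smul_comm, mul_smul] at this
      exact this
  have hsfin : ∀ z, (s z).Finite := fun z =>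
    Set.Finite.biUnion (Finset.finite_toSet _) fun K _ => (hsK z K).1
  have hsz : ∀ z ∈ T, ((s z).ncard : ℝ) ≤
      {K : Subring (ι → ℤ) | K.toAddSubgroup.index = p ^ z.2 ∧ Nonlocal p K}.ncard * g z.1 z.2 := by
    intro z hz
    simp only [hT, mem_filter, mem_product, mem_Icc, mem_range] at hz
    calc ((s z).ncard : ℝ) ≤ ((∑ K ∈ (hKfin z.2).toFinset,
          (scaledSubrings p z.1 (k - n * z.1) K).ncard : ℕ) : ℝ) := by
          exact_mod_cast (Finset.set_ncard_biUnion_le _ _).trans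
            (Finset.sum_le_sum fun K _ => (hsK z K).2)
      _ ≤ ∑ K ∈ (hKfin z.2).toFinset, g z.1 z.2 := by
          rw [Nat.cast_sum]
          refine Finset.sum_le_sum fun K hK => ?_
          have hK' := (hKfin z.2).mem_toFinset.1 hK
          have := hg z.1 (k - n * z.1 - z.2) z.2 hz.1.1.1 (by omega) K hK'.1
          rwa [show z.2 + (k - n * z.1 - z.2) = k - n * z.1 by omega] at this
      _ = _ := by
          rw [Finset.sum_const, nsmul_eq_mul, ← Set.ncard_eq_toFinset_card _ (hKfin z.2)]
  calc _ ≤ ((∑ z ∈ T, (s z).ncard : ℕ) : ℝ) := by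
        exact_mod_cast (Set.ncard_le_ncard hsub (Set.Finite.biUnion (Finset.finite_toSet _)
          fun z _ => hsfin z)).trans (Finset.set_ncard_biUnion_le _ _)
    _ ≤ ∑ z ∈ T, {K : Subring (ι → ℤ) | K.toAddSubgroup.index = p ^ z.2 ∧
          Nonlocal p K}.ncard * g z.1 z.2 := by
        rw [Nat.cast_sum]
        exact Finset.sum_le_sum hsz
    _ ≤ ∑ z ∈ Icc 1 k ×ˢ range (k + 1), {K : Subring (ι → ℤ) | K.toAddSubgroup.index = p ^ z.2 ∧
          Nonlocal p K}.ncard * g z.1 z.2 :=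
        Finset.sum_le_sum_of_subset_of_nonneg (Finset.filter_subset _ _)
          fun z _ _ => mul_nonneg (Nat.cast_nonneg _) (hg0 _ _)
    _ = _ := Finset.sum_product _ _ _

/-- Uniform bound for the numbers of scaled subrings generating a given subring of `ℤ ^ (n + 1)`. -/
def ScaledBound (n : ℕ) : Prop :=
  ∃ C : ℝ, 0 ≤ C ∧ ∃ D : ℕ, ∀ p : ℕ, p.Prime → ∀ (ι : Type) [Fintype ι],
    Fintype.card ι = n + 1 → ∀ a i κ : ℕ, 1 ≤ a → ∀ K : Subring (ι → ℤ),
      K.toAddSubgroup.index = p ^ κ →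
        ((scaledSubrings p a (κ + i) K).ncard : ℝ) * wt p κ ≤
          C * (a + 1) ^ D * wt p (n * a + (κ + i))

theorem subringBound_succ {n : ℕ} (hn : 1 ≤ n) (h : ∀ m' < n + 1, SubringBound m')
    (hs : ScaledBound n) : SubringBound (n + 1) := by
  obtain ⟨C₁, hC₁, D₁, h₁⟩ := nonlocal_bound h
  obtain ⟨C₂, hC₂, D₂, h₂⟩ := hs
  refine ⟨C₁ + C₁ * C₂, by positivity, D₁ + D₂ + 2, fun p hp ι _ hι k => ?_⟩
  have hfin := finite_subring_index ι (pow_ne_zero k hp.ne_zero)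
  have hsplit : (numSubrings ι (p ^ k) : ℝ) ≤
      {R : Subring (ι → ℤ) | R.toAddSubgroup.index = p ^ k ∧ Nonlocal p R}.ncard +
      {R : Subring (ι → ℤ) | R.toAddSubgroup.index = p ^ k ∧ ¬ Nonlocal p R}.ncard := by
    rw [numSubrings_eq_ncard, ← Nat.cast_add]
    refine Nat.cast_le.2 ((Set.ncard_le_ncard (fun R hR => ?_)
      ((hfin.subset fun R h => h.1).union (hfin.subset fun R h => h.1))).trans
      (Set.ncard_union_le _ _))
    by_cases hN : Nonlocal p R
    · exact Or.inl ⟨hR, hN⟩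
    · exact Or.inr ⟨hR, hN⟩
  have hwk := wt_nonneg p k
  have hk1 : (1 : ℝ) ≤ (k : ℝ) + 1 := by linarith [Nat.cast_nonneg (α := ℝ) k]
  have hloc := ncard_local_le hp hn hι k (fun a κ => C₂ * (a + 1) ^ D₂ * wt p k / wt p κ)
    (fun a i κ ha hk K hK => by
      rw [le_div_iff₀ (lt_of_lt_of_le one_pos (one_le_wt hp.one_le κ)), ← hk]
      exact h₂ p hp ι hι a i κ ha K hK)
    (fun a κ => div_nonneg (by positivity) (wt_nonneg p κ))
  have hterm : ∀ a ∈ Icc 1 k, ∀ κ ∈ range (k + 1),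
      ({K : Subring (ι → ℤ) | K.toAddSubgroup.index = p ^ κ ∧ Nonlocal p K}.ncard : ℝ) *
        (C₂ * (a + 1) ^ D₂ * wt p k / wt p κ) ≤ C₁ * C₂ * (k + 1) ^ (D₁ + D₂) * wt p k := by
    intro a ha κ hκ
    have hw : 0 < wt p κ := lt_of_lt_of_le one_pos (one_le_wt hp.one_le κ)
    have ha' : (a : ℝ) ≤ k := by exact_mod_cast (mem_Icc.1 ha).2
    have hκ' : (κ : ℝ) ≤ k := by exact_mod_cast Nat.lt_succ_iff.1 (mem_range.1 hκ)
    calc _ ≤ (C₁ * (κ + 1) ^ D₁ * wt p κ) * (C₂ * (a + 1) ^ D₂ * wt p k / wt p κ) :=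
          mul_le_mul_of_nonneg_right (h₁ p hp ι hι κ) (by positivity)
      _ = C₁ * C₂ * ((κ + 1) ^ D₁ * (a + 1) ^ D₂) * wt p k := by
          field_simp
      _ ≤ C₁ * C₂ * ((k + 1) ^ D₁ * (k + 1) ^ D₂) * wt p k := by gcongr
      _ = _ := by rw [pow_add]
  calc (numSubrings ι (p ^ k) : ℝ) ≤ C₁ * (k + 1) ^ D₁ * wt p k +
        ∑ a ∈ Icc 1 k, ∑ κ ∈ range (k + 1), C₁ * C₂ * (k + 1) ^ (D₁ + D₂) * wt p k :=
        hsplit.trans (add_le_add (h₁ p hp ι hι k) (hloc.trans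
          (Finset.sum_le_sum fun a ha => Finset.sum_le_sum fun κ hκ => hterm a ha κ hκ)))
    _ = C₁ * (k + 1) ^ D₁ * wt p k + C₁ * C₂ * (k * (k + 1) * (k + 1) ^ (D₁ + D₂)) * wt p k := by
        simp only [sum_const, Nat.card_Icc, card_range, nsmul_eq_mul, Nat.add_sub_cancel]
        push_cast
        ring
    _ ≤ C₁ * (k + 1) ^ (D₁ + D₂ + 2) * wt p k +
        C₁ * C₂ * ((k + 1) * (k + 1) * (k + 1) ^ (D₁ + D₂)) * wt p k := by
        gcongr
        · omega
        · linarith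
    _ = _ := by ring

open Classical in
/-- In a finite abelian group, a positive proportion of `r`-tuples generate the group modulo a
given subgroup of index dividing `p ^ r`. -/
theorem card_pow_le_generating {G : Type*} [AddCommGroup G] [Fintype G] {p : ℕ} (hp : p.Prime)
    (r : ℕ) (Q : AddSubgroup G) (hQ : Q.index ∣ p ^ r) :
    Fintype.card G ^ r ≤ 2 ^ r * (univ.filter fun v : Fin r → G =>
      AddSubgroup.closure (Set.range v) ⊔ Q = ⊤).card := by
  induction r generalizing Q with
  | zero =>
    have hQ' : Q = ⊤ := AddSubgroup.index_eq_one.1 (Nat.dvd_one.1 (by simpa using hQ))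
    simp [hQ']
  | succ r ih =>
    set N := fun (r : ℕ) (Q : AddSubgroup G) => (univ.filter fun v : Fin r → G =>
      AddSubgroup.closure (Set.range v) ⊔ Q = ⊤).card with hN
    have hcons : ∀ (g : G) (w : Fin r → G),
        AddSubgroup.closure (Set.range (Fin.cons g w : Fin (r + 1) → G)) ⊔ Q =
          AddSubgroup.closure (Set.range w) ⊔ (Q ⊔ AddSubgroup.zmultiples g) := by
      intro g w
      rw [Fin.range_cons, Set.insert_eq, AddSubgroup.closure_union,
        ← AddSubgroup.zmultiples_eq_closure]
      ac_rfl
    have hrec : N (r + 1) Q = ∑ g : G, N r (Q ⊔ AddSubgroup.zmultiples g) := by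
      simp only [hN]
      rw [← Finset.card_sigma]
      refine Finset.card_bij' (fun v _ => ⟨v 0, Fin.tail v⟩) (fun w _ => Fin.cons w.1 w.2)
        ?_ ?_ ?_ ?_
      · intro v hv
        simp only [mem_sigma, mem_univ, true_and, mem_filter] at hv ⊢
        rw [← hcons, Fin.cons_self_tail]
        exact hv
      · intro w hw
        simp only [mem_sigma, mem_univ, true_and, mem_filter] at hw ⊢
        rw [hcons]
        exact hw
      · intro v _
        exact Fin.cons_self_tail v
      · intro w _
        simp
    set Sg := univ.filter fun g : G => (Q ⊔ AddSubgroup.zmultiples g).index ∣ p ^ r with hSg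
    have hhalf : Fintype.card G ≤ 2 * Sg.card := by
      by_cases hd : Q.index ∣ p ^ r
      · have : Sg = univ := by
          refine Finset.filter_true_of_mem fun g _ =>
            (AddSubgroup.index_dvd_of_le le_sup_left).trans hd
        rw [this, Finset.card_univ]
        omega
      · have hQi : Q.index = p ^ (r + 1) := by
          obtain ⟨s, hs, hsQ⟩ := (Nat.dvd_prime_pow hp).1 hQ
          rcases Nat.lt_or_ge r s with h | h
          · rw [hsQ, show s = r + 1 by omega]
          · exact absurd (hsQ ▸ pow_dvd_pow p h) hd
        have hsub : univ.filter (fun g : G => g ∉ Q) ⊆ Sg := by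
          intro g hg
          simp only [mem_filter, mem_univ, true_and, hSg] at hg ⊢
          have hlt : Q < Q ⊔ AddSubgroup.zmultiples g :=
            lt_of_le_of_ne le_sup_left fun h => hg (h ▸ AddSubgroup.mem_sup_right
              (AddSubgroup.mem_zmultiples g))
          obtain ⟨s, hs, hsQ⟩ := (Nat.dvd_prime_pow hp).1
            ((AddSubgroup.index_dvd_of_le hlt.le).trans hQ)
          have h2 := AddSubgroup.index_strictAnti hlt
          rw [hsQ, hQi] at h2
          rw [hsQ]
          exact pow_dvd_pow p (Nat.lt_succ_iff.1 ((Nat.pow_lt_pow_iff_right hp.one_lt).1 h2))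
        have hcard : Nat.card Q * p ^ (r + 1) = Fintype.card G := by
          rw [← hQi, AddSubgroup.card_mul_index, Nat.card_eq_fintype_card]
        have hcQ : (univ.filter fun g : G => g ∈ Q).card = Nat.card Q := by
          rw [Nat.card_eq_fintype_card, Fintype.card_subtype]
        have h3 := Finset.card_filter_add_card_filter_not (s := univ) (fun g : G => g ∈ Q)
        have h4 := Finset.card_le_card hsub
        rw [Finset.card_univ, hcQ] at h3
        have h5 : Nat.card Q * 2 ≤ Nat.card Q * p ^ (r + 1) :=
          Nat.mul_le_mul_left _ (hp.two_le.trans (Nat.le_self_pow (by omega) p))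
        omega
    calc Fintype.card G ^ (r + 1) = Fintype.card G * Fintype.card G ^ r := by ring
      _ ≤ (2 * Sg.card) * Fintype.card G ^ r := Nat.mul_le_mul_right _ hhalf
      _ = 2 * ∑ g ∈ Sg, Fintype.card G ^ r := by rw [sum_const, smul_eq_mul]; ring
      _ ≤ 2 * ∑ g ∈ Sg, 2 ^ r * N r (Q ⊔ AddSubgroup.zmultiples g) := by
          refine Nat.mul_le_mul_left _ (Finset.sum_le_sum fun g hg => ?_)
          exact ih _ (by simpa [hSg] using hg)
      _ ≤ 2 * ∑ g : G, 2 ^ r * N r (Q ⊔ AddSubgroup.zmultiples g) :=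
          Nat.mul_le_mul_left _ (Finset.sum_le_sum_of_subset (Finset.subset_univ _))
      _ = 2 ^ (r + 1) * N (r + 1) Q := by
          rw [hrec, ← Finset.mul_sum]; ring

/-- Double counting of pairs consisting of a subgroup and a tuple generating it modulo `P`. -/
theorem ncard_mul_card_pow_le {X : Type*} [AddCommGroup X] [Finite X] {p : ℕ} (hp : p.Prime)
    {i r : ℕ} (P : AddSubgroup X) (S : Set (AddSubgroup X)) (hi : ∀ M ∈ S, M.index = p ^ i)
    (hr : ∀ M ∈ S, P.relIndex M ∣ p ^ r) (V : Set (Fin r → X)) (g : ℕ)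
    (hV : ∀ v, (∃ M ∈ S, (∀ l, v l ∈ M) ∧ AddSubgroup.closure (Set.range v) ⊔ P = M ⊔ P) → v ∈ V)
    (hg : ∀ v ∈ V, {M ∈ S | (∀ l, v l ∈ M) ∧
      AddSubgroup.closure (Set.range v) ⊔ P = M ⊔ P}.ncard ≤ g) :
    S.ncard * Nat.card X ^ r ≤ 2 ^ r * p ^ (r * i) * (V.ncard * g) := by
  classical
  have : Fintype X := Fintype.ofFinite X
  have hSfin : S.Finite := Set.toFinite S
  set rel : AddSubgroup X → (Fin r → X) → Prop := fun M v =>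
    (∀ l, v l ∈ M) ∧ AddSubgroup.closure (Set.range v) ⊔ P = M ⊔ P with hrel
  have hM : ∀ M ∈ hSfin.toFinset, Nat.card X ^ r ≤
      2 ^ r * p ^ (r * i) * (univ.filter fun v => rel M v).card := by
    intro M hMS
    rw [hSfin.mem_toFinset] at hMS
    have h1 := card_pow_le_generating (G := M) hp r (P.addSubgroupOf M) (hr M hMS)
    have h2 : Nat.card X = Fintype.card M * p ^ i := by
      rw [← hi M hMS, ← AddSubgroup.card_mul_index M, Nat.card_eq_fintype_card]
    have h3 : (univ.filter fun v : Fin r → M =>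
        AddSubgroup.closure (Set.range v) ⊔ P.addSubgroupOf M = ⊤).card ≤
        (univ.filter fun v => rel M v).card := by
      refine Finset.card_le_card_of_injOn (fun v l => (v l : X)) ?_ ?_
      · intro v hv
        simp only [coe_filter, mem_univ, true_and, Set.mem_ofPred_eq] at hv ⊢
        refine ⟨fun l => (v l).2, le_antisymm (sup_le (le_sup_of_le_left ?_) le_sup_right)
          (sup_le (fun x hx => ?_) le_sup_right)⟩
        · rw [AddSubgroup.closure_le]
          rintro _ ⟨l, rfl⟩
          exact (v l).2
        · have hx' : (⟨x, hx⟩ : M) ∈ AddSubgroup.closure (Set.range v) ⊔ P.addSubgroupOf M :=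
            hv ▸ AddSubgroup.mem_top _
          obtain ⟨y, hy, z, hz, hyz⟩ := AddSubgroup.mem_sup.1 hx'
          refine AddSubgroup.mem_sup.2 ⟨y, ?_, z, hz, congrArg Subtype.val hyz⟩
          have := AddSubgroup.mem_map_of_mem M.subtype hy
          rw [AddMonoidHom.map_closure, ← Set.range_comp] at this
          exact this
      · intro v _ v' _ h
        ext l
        exact congrFun h l
    calc Nat.card X ^ r = Fintype.card M ^ r * p ^ (r * i) := by rw [h2, mul_pow]; ring
      _ ≤ (2 ^ r * (univ.filter fun v => rel M v).card) * p ^ (r * i) :=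
          Nat.mul_le_mul_right _ (h1.trans (Nat.mul_le_mul_left _ h3))
      _ = _ := by ring
  have hcount : ∑ M ∈ hSfin.toFinset, (univ.filter fun v => rel M v).card ≤ V.ncard * g := by
    have e1 : ∑ M ∈ hSfin.toFinset, (univ.filter fun v => rel M v).card =
        ∑ v, (hSfin.toFinset.filter fun M => rel M v).card :=
      Finset.sum_card_bipartiteAbove_eq_sum_card_bipartiteBelow rel
    have hVfin : V.Finite := Set.toFinite V
    have e2 : ∑ v, (hSfin.toFinset.filter fun M => rel M v).card =
        ∑ v ∈ hVfin.toFinset, (hSfin.toFinset.filter fun M => rel M v).card := by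
      refine (Finset.sum_subset (Finset.subset_univ _) fun v _ hv => ?_).symm
      rw [Finset.card_eq_zero, Finset.filter_eq_empty_iff]
      intro M hMS hMv
      exact hv (hVfin.mem_toFinset.2 (hV v ⟨M, hSfin.mem_toFinset.1 hMS, hMv⟩))
    rw [e1, e2, Set.ncard_eq_toFinset_card V hVfin, ← smul_eq_mul, ← Finset.sum_const]
    refine Finset.sum_le_sum fun v hv => ?_
    refine le_trans (le_of_eq ?_) (hg v (hVfin.mem_toFinset.1 hv))
    rw [← Set.ncard_coe_finset]
    congr 1
    ext M
    simp [hrel]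
  calc S.ncard * Nat.card X ^ r = ∑ M ∈ hSfin.toFinset, Nat.card X ^ r := by
        rw [sum_const, smul_eq_mul, Set.ncard_eq_toFinset_card S hSfin]
    _ ≤ ∑ M ∈ hSfin.toFinset, 2 ^ r * p ^ (r * i) * (univ.filter fun v => rel M v).card :=
        Finset.sum_le_sum hM
    _ ≤ _ := by
        rw [← Finset.mul_sum]
        exact Nat.mul_le_mul_left _ hcount

theorem le_of_forall_eq_add_nsmul {X : Type*} [AddCommGroup X] {p i : ℕ} {A N : AddSubgroup X}
    (hpi : ∀ x : X, (p ^ i) • x = 0) (h : ∀ x ∈ A, ∃ n ∈ N, ∃ y ∈ A, x = n + p • y) : A ≤ N := by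
  have key : ∀ t : ℕ, ∀ x ∈ A, ∃ n ∈ N, ∃ y ∈ A, x = n + (p ^ t) • y := by
    intro t
    induction t with
    | zero => exact fun x hx => ⟨0, N.zero_mem, x, hx, by simp⟩
    | succ t ih =>
      intro x hx
      obtain ⟨n, hn, y, hy, rfl⟩ := ih x hx
      obtain ⟨m, hm, z, hz, rfl⟩ := h y hy
      exact ⟨n + (p ^ t) • m, N.add_mem hn (N.nsmul_mem hm _), z, hz, by
        rw [smul_add, ← mul_smul, pow_succ, add_assoc]⟩
  intro x hx
  obtain ⟨n, hn, y, -, rfl⟩ := key i x hx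
  rwa [hpi, add_zero]

/-- The subgroup of all `p`-multiples. -/
def pMul (X : Type*) [AddCommGroup X] (p : ℕ) : AddSubgroup X :=
  (nsmulAddMonoidHom p : X →+ X).range

theorem mem_pMul {X : Type*} [AddCommGroup X] {p : ℕ} {x : X} : x ∈ pMul X p ↔ ∃ y, p • y = x :=
  Iff.rfl

/-- The subgroup generated by all `p`-multiples and `1`. -/
def pMulOne (X : Type*) [CommRing X] (p : ℕ) : AddSubgroup X :=
  pMul X p ⊔ AddSubgroup.zmultiples 1

/-- The scaled generating subgroups `M` of index `p ^ i` for which `M + pX` has index `p ^ d`. -/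
def layer (X : Type*) [CommRing X] (p a i d : ℕ) : Set (AddSubgroup X) :=
  {M ∈ scaledSubrings p a i (⊤ : Subring X) | (M ⊔ pMul X p).index = p ^ d}

/-- The members of a layer containing the tuple `v` and generated by it modulo `ℤ + pX`. -/
def layerTuple {X : Type*} [CommRing X] (p a i d : ℕ) {r : ℕ} (v : Fin r → X) :
    Set (AddSubgroup X) :=
  {M ∈ layer X p a i d | (∀ l, v l ∈ M) ∧
    AddSubgroup.closure (Set.range v) ⊔ pMulOne X p = M ⊔ pMulOne X p}

theorem sup_pMulOne {X : Type*} [CommRing X] {p : ℕ} {M : AddSubgroup X} (h : 1 ∈ M) :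
    M ⊔ pMulOne X p = M ⊔ pMul X p :=
  le_antisymm (sup_le le_sup_left (sup_le le_sup_right
    (le_sup_of_le_left ((AddSubgroup.zmultiples_le).2 h))))
    (sup_le le_sup_left (le_sup_of_le_right le_sup_left))

theorem pMul_mul_mem {X : Type*} [CommRing X] {p : ℕ} {x : X} (hx : x ∈ pMul X p) (y : X) :
    x * y ∈ pMul X p := by
  obtain ⟨z, rfl⟩ := hx
  exact ⟨z * y, by simp [mul_assoc]⟩

/-- If `S` contains `v`, `1` and `pX`, and is stable under multiplication by the `v l`, where `v`
generates, modulo `ℤ + pX`, a set generating the ring `X`, then `S` is everything. -/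
theorem eq_top_of_stable {X : Type*} [CommRing X] {p r : ℕ} {v : Fin r → X}
    {M S : AddSubgroup X} (hM : Subring.closure (M : Set X) = ⊤)
    (hv : AddSubgroup.closure (Set.range v) ⊔ pMulOne X p = M ⊔ pMulOne X p)
    (hS : pMulOne X p ≤ S) (hst : ∀ l, ∀ s ∈ S, v l * s ∈ S) : S = ⊤ := by
  let St : Subring X :=
    { carrier := {y | ∀ s ∈ S, y * s ∈ S}
      mul_mem' := fun {x y} hx hy s hs => by rw [mul_assoc]; exact hx _ (hy s hs)
      one_mem' := fun s hs => by rwa [one_mul]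
      add_mem' := fun {x y} hx hy s hs => by rw [add_mul]; exact S.add_mem (hx s hs) (hy s hs)
      zero_mem' := fun s _ => by rw [zero_mul]; exact S.zero_mem
      neg_mem' := fun {x} hx s hs => by rw [neg_mul]; exact S.neg_mem (hx s hs) }
  have h1 : AddSubgroup.closure (Set.range v) ⊔ pMulOne X p ≤ St.toAddSubgroup := by
    refine sup_le ?_ (sup_le ?_ ?_)
    · rw [AddSubgroup.closure_le]
      rintro _ ⟨l, rfl⟩
      exact hst l
    · intro x hx s _
      exact hS (AddSubgroup.mem_sup_left (pMul_mul_mem hx s))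
    · rw [AddSubgroup.zmultiples_le]
      exact St.one_mem
  have h2 : St = ⊤ := by
    rw [eq_top_iff, ← hM, Subring.closure_le]
    exact fun x hx => h1 (hv ▸ AddSubgroup.mem_sup_left hx)
  refine eq_top_iff.2 fun x _ => ?_
  have hx : x ∈ St := h2 ▸ Subring.mem_top x
  have := hx 1 (hS (AddSubgroup.mem_sup_right (AddSubgroup.mem_zmultiples 1)))
  rwa [mul_one] at this

theorem dvd_pow_pred_of_lt {p d j N N' : ℕ} (hp : p.Prime) (h : N ∣ p ^ (d - j)) (h' : N' ∣ N)
    (hlt : N' < N) : N' ∣ p ^ (d - (j + 1)) := by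
  obtain ⟨s, hs, rfl⟩ := (Nat.dvd_prime_pow hp).1 h
  obtain ⟨t, ht, rfl⟩ := (Nat.dvd_prime_pow hp).1 h'
  have := (Nat.pow_lt_pow_iff_right hp.one_lt).1 hlt
  exact pow_dvd_pow p (by omega)

/-- For a tuple `v`, a chain of products of the `v l` generating `X` modulo `v` and `ℤ + pX`. -/
theorem exists_chain {X : Type*} [CommRing X] {p a i d r : ℕ} (hp : p.Prime) {v : Fin r → X}
    {M₀ : AddSubgroup X} (hM₀ : M₀ ∈ layerTuple p a i d v) (j : ℕ) :
    ∃ w : Fin j → X, (∀ M ∈ layerTuple p a i d v, ∀ l : Fin j,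
      (p ^ ((l.1 + 1) * a)) • w l ∈ M) ∧
      (AddSubgroup.closure (Set.range v) ⊔ pMulOne X p ⊔
        AddSubgroup.closure (Set.range w)).index ∣ p ^ (d - j) := by
  induction j with
  | zero =>
    refine ⟨Fin.elim0, fun M _ l => l.elim0, ?_⟩
    rw [Set.range_eq_empty (Fin.elim0 : Fin 0 → X), AddSubgroup.closure_empty, sup_bot_eq, hM₀.2.2,
      sup_pMulOne hM₀.1.1.2.1, hM₀.1.2, Nat.sub_zero]
  | succ j ih =>
    obtain ⟨w, hw, hidx⟩ := ih
    set S := AddSubgroup.closure (Set.range v) ⊔ pMulOne X p ⊔ AddSubgroup.closure (Set.range w)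
      with hS
    have hsnoc : ∀ x, AddSubgroup.closure (Set.range v) ⊔ pMulOne X p ⊔
        AddSubgroup.closure (Set.range (Fin.snoc w x : Fin (j + 1) → X)) =
          S ⊔ AddSubgroup.zmultiples x := by
      intro x
      rw [Fin.range_snoc, Set.insert_eq, AddSubgroup.closure_union,
        ← AddSubgroup.zmultiples_eq_closure, hS]
      ac_rfl
    have hmem : ∀ x, (∀ M ∈ layerTuple p a i d v, (p ^ ((j + 1) * a)) • x ∈ M) →
        ∀ M ∈ layerTuple p a i d v, ∀ l : Fin (j + 1),
          (p ^ ((l.1 + 1) * a)) • (Fin.snoc w x : Fin (j + 1) → X) l ∈ M := by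
      intro x hx M hM l
      refine Fin.lastCases ?_ (fun l => ?_) l
      · rw [Fin.snoc_last]
        exact hx M hM
      · rw [Fin.snoc_castSucc]
        exact hw M hM l
    by_cases hSt : S = ⊤
    · refine ⟨Fin.snoc w 0, hmem 0 fun M _ => by rw [smul_zero]; exact M.zero_mem, ?_⟩
      rw [hsnoc, hSt, top_sup_eq, AddSubgroup.index_top]
      exact one_dvd _
    · have hex : ∃ l, ∃ x ∈ Set.range v ∪ Set.range w, v l * x ∉ S := by
        by_contra! hcon
        refine hSt (eq_top_of_stable hM₀.1.1.2.2.2 hM₀.2.2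
          (le_sup_of_le_left le_sup_right) fun l s hs => ?_)
        have hle : S ≤ S.comap (AddMonoidHom.mulLeft (v l)) := by
          refine sup_le (sup_le ?_ (sup_le ?_ ?_)) ?_
          · rw [AddSubgroup.closure_le]
            exact fun x hx => hcon l x (Or.inl hx)
          · intro x hx
            change v l * x ∈ S
            rw [mul_comm]
            exact AddSubgroup.mem_sup_left (AddSubgroup.mem_sup_right
              (AddSubgroup.mem_sup_left (pMul_mul_mem hx _)))
          · rw [AddSubgroup.zmultiples_le]
            change v l * 1 ∈ S
            rw [mul_one]
            exact AddSubgroup.mem_sup_left (AddSubgroup.mem_sup_left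
              (AddSubgroup.subset_closure ⟨l, rfl⟩))
          · rw [AddSubgroup.closure_le]
            exact fun x hx => hcon l x (Or.inr hx)
        exact hle hs
      obtain ⟨l, x, hx, hlx⟩ := hex
      refine ⟨Fin.snoc w (v l * x), hmem _ ?_, ?_⟩
      · intro M hM
        have hv := hM.2.1 l
        rcases hx with ⟨l', rfl⟩ | ⟨l', rfl⟩
        · have := M.nsmul_mem (hM.1.1.2.2.1 _ hv _ (hM.2.1 l')) (p ^ (j * a))
          rwa [← mul_smul, ← pow_add, show j * a + a = (j + 1) * a by ring] at this
        · have := M.nsmul_mem (hM.1.1.2.2.1 _ hv _ (hw M hM l')) (p ^ ((j - (l'.1 + 1)) * a))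
          rw [mul_smul_comm, ← mul_smul, ← mul_smul, ← pow_add, ← pow_add] at this
          have he : (j - (l'.1 + 1)) * a + (a + (l'.1 + 1) * a) = (j + 1) * a := by
            obtain ⟨t, ht⟩ := Nat.exists_eq_add_of_le (Nat.succ_le_of_lt l'.2)
            rw [show j - (l'.1 + 1) = t by omega, show j + 1 = t + 1 + (l'.1 + 1) by omega]
            ring
          rwa [← he, ← add_assoc]
      · rw [hsnoc]
        have hlt : S < S ⊔ AddSubgroup.zmultiples (v l * x) :=
          lt_of_le_of_ne le_sup_left fun h => hlx (h ▸ AddSubgroup.mem_sup_right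
            (AddSubgroup.mem_zmultiples _))
        have hfin : S.FiniteIndex := ⟨fun h => by
          rw [h, Nat.zero_dvd] at hidx
          exact pow_ne_zero _ hp.ne_zero hidx⟩
        exact dvd_pow_pred_of_lt hp hidx (AddSubgroup.index_dvd_of_le le_sup_left)
          (AddSubgroup.index_strictAnti hlt)

/-- The subgroups of `ℤ ^ d` of index `p ^ e` containing `p ^ ((l + 1) a - 1)` times the `l`-th
basis vector. -/
def latticeSet (p a d e : ℕ) : Set (AddSubgroup (Fin d → ℤ)) :=
  {H | H.index = p ^ e ∧ ∀ l : Fin d, Pi.single l ((p : ℤ) ^ ((l.1 + 1) * a - 1)) ∈ H}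

theorem latticeSet_finite {p : ℕ} (hp : p.Prime) (a d e : ℕ) : (latticeSet p a d e).Finite :=
  (finite_addSubgroup_index (Fin d) (pow_ne_zero e hp.ne_zero)).subset fun _ h => h.1

theorem layerTuple_embeds {X : Type*} [CommRing X] {p a i d r : ℕ} (hp : p.Prime) (ha : 1 ≤ a)
    (hpi : ∀ x : X, (p ^ i) • x = 0) (v : Fin r → X) (hne : (layerTuple p a i d v).Nonempty) :
    d ≤ i ∧ ∃ f : AddSubgroup X → AddSubgroup (Fin d → ℤ),
      Set.MapsTo f (layerTuple p a i d v) (latticeSet p a d (i - d)) ∧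
      Set.InjOn f (layerTuple p a i d v) := by
  obtain ⟨M₀, hM₀⟩ := hne
  obtain ⟨w, hw, hidx⟩ := exists_chain hp hM₀ d
  rw [Nat.sub_self, pow_zero, Nat.dvd_one, AddSubgroup.index_eq_one] at hidx
  have hdi : d ≤ i := by
    have := AddSubgroup.index_dvd_of_le (le_sup_left : M₀ ≤ M₀ ⊔ pMul X p)
    rw [hM₀.1.2, hM₀.1.1.1] at this
    exact (Nat.pow_dvd_pow_iff_le_right hp.one_lt).1 this
  refine ⟨hdi, ?_⟩
  let Φ : (Fin d → ℤ) →+ X :=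
    { toFun := fun c => p • ∑ l, c l • w l
      map_zero' := by simp
      map_add' := fun c c' => by simp [add_smul, Finset.sum_add_distrib] }
  set V := AddSubgroup.closure (Set.range v) ⊔ AddSubgroup.zmultiples 1 with hV
  have hΦsingle : ∀ l (c : ℤ), Φ (Pi.single l c) = p • c • w l := by
    intro l c
    change p • ∑ l', (Pi.single l c : Fin d → ℤ) l' • w l' = _
    rw [Finset.sum_eq_single l (fun b _ hb => by simp [Pi.single_eq_of_ne hb]) (by simp)]
    simp
  have hwΦ : ∀ x ∈ AddSubgroup.closure (Set.range w), p • x ∈ Φ.range := by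
    have : AddSubgroup.closure (Set.range w) ≤ Φ.range.comap (nsmulAddMonoidHom p) := by
      rw [AddSubgroup.closure_le]
      rintro _ ⟨l, rfl⟩
      exact ⟨Pi.single l 1, by rw [hΦsingle]; simp⟩
    exact this
  have hpV : pMul X p ≤ V ⊔ Φ.range := by
    refine le_of_forall_eq_add_nsmul hpi ?_
    rintro _ ⟨x, rfl⟩
    have hx : x ∈ V ⊔ pMul X p ⊔ AddSubgroup.closure (Set.range w) := by
      have : V ⊔ pMul X p ⊔ AddSubgroup.closure (Set.range w) = ⊤ := by
        rw [← hidx, hV, pMulOne]; ac_rfl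
      rw [this]; exact AddSubgroup.mem_top x
    obtain ⟨y, hy, z, hz, rfl⟩ := AddSubgroup.mem_sup.1 hx
    obtain ⟨s, hs, t, ht, rfl⟩ := AddSubgroup.mem_sup.1 hy
    refine ⟨p • s + p • z, AddSubgroup.add_mem _
      (AddSubgroup.mem_sup_left (AddSubgroup.nsmul_mem _ hs p))
      (AddSubgroup.mem_sup_right (hwΦ z hz)), t, ht, ?_⟩
    simp only [nsmulAddMonoidHom_apply, smul_add]
    abel
  have hVM : ∀ M ∈ layerTuple p a i d v, V ≤ M := fun M hM =>
    sup_le ((AddSubgroup.closure_le _).2 (by rintro _ ⟨l, rfl⟩; exact hM.2.1 l))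
      (AddSubgroup.zmultiples_le.2 hM.1.1.2.1)
  have hΦp : Φ.range ≤ pMul X p := by
    rintro _ ⟨c, rfl⟩
    exact ⟨_, rfl⟩
  have hMrange : ∀ M ∈ layerTuple p a i d v, M ≤ V ⊔ Φ.range := by
    intro M hM
    have h1 : M ≤ M ⊔ pMulOne X p := le_sup_left
    rw [← hM.2.2, pMulOne] at h1
    refine h1.trans (sup_le (le_sup_of_le_left le_sup_left) (sup_le hpV
      (le_sup_of_le_left le_sup_right)))
  refine ⟨fun M => M.comap Φ, fun M hM => ⟨?_, fun l => ?_⟩, fun M hM M' hM' h => ?_⟩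
  · have h1 : Φ.range ⊔ M = M ⊔ pMul X p :=
      le_antisymm (sup_le (hΦp.trans le_sup_right) le_sup_left) (sup_le le_sup_right
        (hpV.trans (sup_le ((hVM M hM).trans le_sup_right) le_sup_left)))
    have h2 : M.relIndex (M ⊔ pMul X p) * p ^ d = p ^ i := by
      rw [← hM.1.2, ← hM.1.1.1]
      exact AddSubgroup.relIndex_mul_index le_sup_left
    rw [AddSubgroup.index_comap, ← AddSubgroup.relIndex_sup_right, h1]
    refine Nat.eq_of_mul_eq_mul_right (pow_pos hp.pos d) ?_
    rw [h2, ← pow_add, Nat.sub_add_cancel hdi]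
  · change Φ _ ∈ M
    have h1 : 1 ≤ (l.1 + 1) * a := Nat.mul_pos (Nat.succ_pos _) ha
    have h2 := hw M hM l
    rw [hΦsingle, ← Nat.cast_pow, natCast_zsmul, ← mul_smul, ← pow_succ', Nat.sub_add_cancel h1]
    exact h2
  · have key : ∀ M ∈ layerTuple p a i d v, ∀ M' ∈ layerTuple p a i d v,
        M.comap Φ = M'.comap Φ → M ≤ M' := by
      intro M hM M' hM' h x hx
      obtain ⟨y, hy, _, ⟨c, rfl⟩, rfl⟩ := AddSubgroup.mem_sup.1 (hMrange M hM hx)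
      have hc : c ∈ M.comap Φ := by
        have := M.sub_mem hx (hVM M hM hy)
        rwa [add_sub_cancel_left] at this
      rw [h] at hc
      exact M'.add_mem (hVM M' hM' hy) hc
    exact le_antisymm (key M hM M' hM' h) (key M' hM' M hM h.symm)

theorem ncard_layerTuple_le {X : Type*} [CommRing X] {p a i d r : ℕ} (hp : p.Prime)
    (ha : 1 ≤ a) (hpi : ∀ x : X, (p ^ i) • x = 0) (v : Fin r → X) :
    (layerTuple p a i d v).ncard ≤ (latticeSet p a d (i - d)).ncard := by
  rcases (layerTuple p a i d v).eq_empty_or_nonempty with h | h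
  · simp [h]
  · obtain ⟨-, f, hf, hinj⟩ := layerTuple_embeds hp ha hpi v h
    exact Set.ncard_le_ncard_of_injOn f hf hinj (latticeSet_finite hp _ _ _)

theorem index_pMulOne_dvd {X : Type*} [CommRing X] {p n : ℕ} (hp : p.Prime)
    (hpX : (pMul X p).index = p ^ (n + 1)) (h1 : (1 : X) ∉ pMul X p) :
    (pMulOne X p).index ∣ p ^ n := by
  have hlt : pMul X p < pMulOne X p :=
    lt_of_le_of_ne le_sup_left fun h => h1 (h ▸ AddSubgroup.mem_sup_right
      (AddSubgroup.mem_zmultiples 1))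
  have hfin : (pMul X p).FiniteIndex := ⟨by rw [hpX]; exact pow_ne_zero _ hp.ne_zero⟩
  have := dvd_pow_pred_of_lt (d := n + 1) (j := 0) hp (dvd_of_eq hpX)
    (AddSubgroup.index_dvd_of_le hlt.le) (AddSubgroup.index_strictAnti hlt)
  simpa using this

theorem exists_layer {X : Type*} [CommRing X] {p a i n : ℕ} (hp : p.Prime) (hi : 1 ≤ i)
    (hpi : ∀ x : X, (p ^ i) • x = 0) (hpX : (pMul X p).index = p ^ (n + 1))
    (h1 : (1 : X) ∉ pMul X p) {M : AddSubgroup X} (hM : M ∈ scaledSubrings p a i (⊤ : Subring X)) :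
    ∃ d ∈ Ico 1 n, M ∈ layer X p a i d := by
  have hdvd := AddSubgroup.index_dvd_of_le (le_sup_left : M ≤ M ⊔ pMul X p)
  rw [hM.1] at hdvd
  obtain ⟨d, -, hd⟩ := (Nat.dvd_prime_pow hp).1 hdvd
  have hd1 : 1 ≤ d := by
    by_contra h0
    rw [show d = 0 by omega, pow_zero, AddSubgroup.index_eq_one] at hd
    have : (⊤ : AddSubgroup X) ≤ M := le_of_forall_eq_add_nsmul hpi fun x hx => by
      rw [← hd] at hx
      obtain ⟨m, hm, _, ⟨y, rfl⟩, rfl⟩ := AddSubgroup.mem_sup.1 hx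
      exact ⟨m, hm, y, AddSubgroup.mem_top y, rfl⟩
    have h2 := hM.1
    rw [top_le_iff.1 this, AddSubgroup.index_top] at h2
    exact absurd h2.symm (Nat.one_lt_pow (by omega) hp.one_lt).ne'
  have hP := index_pMulOne_dvd hp hpX h1
  have hPM : pMulOne X p ≤ M ⊔ pMul X p := sup_pMulOne (p := p) hM.2.1 ▸ le_sup_right
  have hdP := AddSubgroup.index_dvd_of_le hPM
  rw [hd] at hdP
  have hdn : d ≤ n := (Nat.pow_dvd_pow_iff_le_right hp.one_lt).1 (hdP.trans hP)
  refine ⟨d, mem_Ico.2 ⟨hd1, lt_of_le_of_ne hdn ?_⟩, hM, hd⟩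
  rintro rfl
  have hPidx : (pMulOne X p).index = p ^ d := Nat.dvd_antisymm hP hdP
  have hPM' : pMulOne X p = M ⊔ pMul X p := by
    by_contra hne
    have hfin : (pMulOne X p).FiniteIndex := ⟨by rw [hPidx]; exact pow_ne_zero _ hp.ne_zero⟩
    have := AddSubgroup.index_strictAnti (lt_of_le_of_ne hPM hne)
    rw [hd, hPidx] at this
    exact lt_irrefl _ this
  have htop : pMulOne X p = ⊤ := by
    refine eq_top_of_stable (p := p) (r := 0) (v := Fin.elim0) (M := M) hM.2.2.2 ?_ le_rfl
      fun l => l.elim0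
    rw [Set.range_eq_empty (Fin.elim0 : Fin 0 → X), AddSubgroup.closure_empty, bot_sup_eq,
      sup_pMulOne hM.2.1, hPM']
  rw [htop, AddSubgroup.index_top] at hPidx
  exact absurd hPidx.symm (Nat.one_lt_pow (by omega) hp.one_lt).ne'

theorem ncard_layer_mul_le {X : Type*} [CommRing X] [Finite X] {p a i n d : ℕ} (hp : p.Prime)
    (ha : 1 ≤ a) (hdn : d ≤ n) (hpi : ∀ x : X, (p ^ i) • x = 0)
    (hpX : (pMul X p).index = p ^ (n + 1)) (h1 : (1 : X) ∉ pMul X p) (V : Set (Fin (n - d) → X))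
    (hV : ∀ v : Fin (n - d) → X, (layerTuple p a i d v).Nonempty → v ∈ V) :
    (layer X p a i d).ncard * Nat.card X ^ (n - d) ≤
      2 ^ (n - d) * p ^ ((n - d) * i) * (V.ncard * (latticeSet p a d (i - d)).ncard) := by
  refine ncard_mul_card_pow_le hp (pMulOne X p) (layer X p a i d) (fun M hM => hM.1.1)
    (fun M hM => ?_) V _ (fun v ⟨M, hM, hMv⟩ => hV v ⟨M, hM, hMv⟩)
    (fun v _ => ncard_layerTuple_le hp ha hpi v)
  have h2 := AddSubgroup.relIndex_mul_index (le_sup_right : pMulOne X p ≤ M ⊔ pMulOne X p)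
  rw [AddSubgroup.relIndex_sup_right, sup_pMulOne hM.1.2.1, hM.2] at h2
  have h3 := index_pMulOne_dvd hp hpX h1
  rw [← h2, show p ^ n = p ^ (n - d) * p ^ d by rw [← pow_add, Nat.sub_add_cancel hdn]] at h3
  exact Nat.dvd_of_mul_dvd_mul_right (pow_pos hp.pos d) h3

theorem ncard_layer_le {X : Type*} [CommRing X] [Finite X] {p a i n d : ℕ} (hp : p.Prime)
    (ha : 1 ≤ a) (hdn : d ≤ n) (hpi : ∀ x : X, (p ^ i) • x = 0)
    (hpX : (pMul X p).index = p ^ (n + 1)) (h1 : (1 : X) ∉ pMul X p) :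
    (layer X p a i d).ncard ≤
      2 ^ (n - d) * p ^ ((n - d) * i) * (latticeSet p a d (i - d)).ncard := by
  have h := ncard_layer_mul_le hp ha hdn hpi hpX h1 Set.univ fun v _ => Set.mem_univ v
  rw [Set.ncard_univ, Nat.card_fun, Nat.card_eq_fintype_card (α := Fin (n - d)),
    Fintype.card_fin] at h
  refine Nat.le_of_mul_le_mul_right (h.trans (le_of_eq (by ring)))
    (pow_pos (Nat.card_pos (α := X)) (n - d))

theorem le_of_mem_layer {X : Type*} [CommRing X] {p a i d : ℕ} (hp : p.Prime)
    {M : AddSubgroup X} (hM : M ∈ layer X p a i d) : d ≤ i := by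
  have := AddSubgroup.index_dvd_of_le (le_sup_left : M ≤ M ⊔ pMul X p)
  rw [hM.2, hM.1.1] at this
  exact (Nat.pow_dvd_pow_iff_le_right hp.one_lt).1 this

/-- The inclusion of `ℤ ^ d` into `ℤ ^ (d + 1)` as the first coordinates. -/
def snocZero (d : ℕ) : (Fin d → ℤ) →+ (Fin (d + 1) → ℤ) where
  toFun x := Fin.snoc (α := fun _ => ℤ) x 0
  map_zero' := by
    ext j
    refine Fin.lastCases ?_ (fun l => ?_) j <;> simp
  map_add' x y := by
    ext j
    refine Fin.lastCases ?_ (fun l => ?_) j <;> simp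

/-- The last coordinate. -/
def lastCoord (d : ℕ) : (Fin (d + 1) → ℤ) →+ ℤ := Pi.evalAddMonoidHom (fun _ => ℤ) (Fin.last d)

theorem lastCoord_surjective (d : ℕ) : Function.Surjective (lastCoord d) := fun z =>
  ⟨fun _ => z, rfl⟩

theorem range_snocZero (d : ℕ) : (snocZero d).range = (lastCoord d).ker := by
  ext y
  constructor
  · rintro ⟨x, rfl⟩
    exact Fin.snoc_last (α := fun _ => ℤ) 0 x
  · intro (hy : y (Fin.last d) = 0)
    refine ⟨Fin.init y, ?_⟩
    change Fin.snoc (α := fun _ => ℤ) (Fin.init y) 0 = y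
    rw [← hy, Fin.snoc_init_self]

theorem index_eq_snocZero_mul {d : ℕ} (H : AddSubgroup (Fin (d + 1) → ℤ)) :
    H.index = (H.comap (snocZero d)).index * (H.map (lastCoord d)).index := by
  rw [AddSubgroup.index_comap, AddSubgroup.index_map,
    AddMonoidHom.range_eq_top.2 (lastCoord_surjective d), AddSubgroup.index_top, mul_one,
    range_snocZero, ← AddSubgroup.relIndex_sup_right, sup_comm]
  exact (AddSubgroup.relIndex_mul_index le_sup_left).symm

theorem Int.mem_addSubgroup_iff_index_dvd (H : AddSubgroup ℤ) (z : ℤ) :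
    z ∈ H ↔ (H.index : ℤ) ∣ z := by
  obtain ⟨a, rfl⟩ := Int.subgroup_cyclic H
  rw [← AddSubgroup.zmultiples_eq_closure, Int.index_zmultiples, Int.mem_zmultiples_iff,
    Int.natAbs_dvd]

/-- The subgroups of `ℤ ^ (d + 1)` with given intersection with `ℤ ^ d` and given image under the
last coordinate embed into the `p ^ u`-torsion of the quotient. -/
theorem ncard_extensions_le {d p t b : ℕ} (H₁ : AddSubgroup (Fin d → ℤ))
    (hfin : H₁.index ≠ 0) (htb : t ≤ b) :
    {H : AddSubgroup (Fin (d + 1) → ℤ) | H.comap (snocZero d) = H₁ ∧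
      (H.map (lastCoord d)).index = p ^ t ∧ Pi.single (Fin.last d) ((p : ℤ) ^ b) ∈ H}.ncard ≤
      {q : (Fin d → ℤ) ⧸ H₁ | (p ^ (b - t)) • q = 0}.ncard := by
  classical
  have : Finite ((Fin d → ℤ) ⧸ H₁) := AddSubgroup.index_ne_zero_iff_finite.1 hfin
  set S := {H : AddSubgroup (Fin (d + 1) → ℤ) | H.comap (snocZero d) = H₁ ∧
      (H.map (lastCoord d)).index = p ^ t ∧ Pi.single (Fin.last d) ((p : ℤ) ^ b) ∈ H}
  have hex : ∀ H ∈ S, ∃ g : Fin d → ℤ, Fin.snoc (α := fun _ => ℤ) g ((p : ℤ) ^ t) ∈ H := by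
    intro H hH
    have : ((p : ℤ) ^ t) ∈ H.map (lastCoord d) := by
      rw [Int.mem_addSubgroup_iff_index_dvd, hH.2.1]
      push_cast
      exact dvd_rfl
    obtain ⟨y, hy, hyt⟩ := this
    refine ⟨Fin.init y, ?_⟩
    rw [← hyt]
    change Fin.snoc (α := fun _ => ℤ) (Fin.init y) (y (Fin.last d)) ∈ H
    rwa [Fin.snoc_init_self]
  choose! g hg using hex
  have hsn : ∀ (x : Fin d → ℤ), snocZero d x = Fin.snoc (α := fun _ => ℤ) x 0 := fun _ => rfl
  refine Set.ncard_le_ncard_of_injOn (fun H => (g H : (Fin d → ℤ) ⧸ H₁)) ?_ ?_ (Set.toFinite _)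
  · intro H hH
    change (p ^ (b - t)) • (g H : (Fin d → ℤ) ⧸ H₁) = 0
    rw [← QuotientAddGroup.mk_nsmul, QuotientAddGroup.eq_zero_iff, ← hH.1, AddSubgroup.mem_comap]
    have h1 := H.sub_mem (H.nsmul_mem (hg H hH) (p ^ (b - t))) hH.2.2
    convert h1 using 1
    ext j
    refine Fin.lastCases ?_ (fun l => ?_) j
    · rw [hsn, Fin.snoc_last, Pi.sub_apply, Pi.smul_apply, Fin.snoc_last, Pi.single_eq_same,
        nsmul_eq_mul]
      push_cast
      rw [← pow_add, Nat.sub_add_cancel htb, sub_self]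
    · rw [hsn, Fin.snoc_castSucc, Pi.sub_apply, Pi.smul_apply, Pi.smul_apply, Fin.snoc_castSucc,
        Pi.single_eq_of_ne (Fin.castSucc_lt_last l).ne, sub_zero]
  · have key : ∀ H ∈ S, ∀ H' ∈ S, (g H : (Fin d → ℤ) ⧸ H₁) = g H' → H ≤ H' := by
      intro H hH H' hH' h x hx
      obtain ⟨c, hc⟩ : ((p : ℤ) ^ t) ∣ lastCoord d x := by
        have h1 : lastCoord d x ∈ H.map (lastCoord d) := ⟨x, hx, rfl⟩
        rw [Int.mem_addSubgroup_iff_index_dvd, hH.2.1] at h1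
        exact_mod_cast h1
      have hgH' : Fin.snoc (α := fun _ => ℤ) (g H) ((p : ℤ) ^ t) ∈ H' := by
        have h2 : -g H + g H' ∈ H'.comap (snocZero d) := hH'.1 ▸ QuotientAddGroup.eq.1 h
        have h3 := H'.sub_mem (hg H' hH') h2
        convert h3 using 1
        ext j
        refine Fin.lastCases ?_ (fun l => ?_) j
        · rw [hsn, Pi.sub_apply, Fin.snoc_last, Fin.snoc_last, Fin.snoc_last, sub_zero]
        · rw [hsn, Pi.sub_apply, Fin.snoc_castSucc, Fin.snoc_castSucc, Fin.snoc_castSucc,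
            Pi.add_apply, Pi.neg_apply]
          ring
      have h4 : x - c • Fin.snoc (α := fun _ => ℤ) (g H) ((p : ℤ) ^ t) ∈ (snocZero d).range := by
        rw [range_snocZero]
        change x (Fin.last d) - c • Fin.snoc (α := fun _ => ℤ) (g H) ((p : ℤ) ^ t) (Fin.last d) = 0
        rw [Fin.snoc_last, smul_eq_mul]
        change x (Fin.last d) = _ at hc
        rw [hc]; ring
      obtain ⟨y, hy⟩ := h4
      have h5 : y ∈ H.comap (snocZero d) := by
        rw [AddSubgroup.mem_comap, hy]
        exact H.sub_mem hx (H.zsmul_mem (hg H hH) c)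
      rw [hH.1, ← hH'.1, AddSubgroup.mem_comap, hy] at h5
      have := H'.add_mem h5 (H'.zsmul_mem hgH' c)
      rwa [sub_add_cancel] at this
    exact fun H hH H' hH' h => le_antisymm (key H hH H' hH' h) (key H' hH' H hH h.symm)

/-- Data of a lattice with respect to the last coordinate. -/
theorem latticeSet_succ {p a d e : ℕ} (hp : p.Prime) {H : AddSubgroup (Fin (d + 1) → ℤ)}
    (hH : H ∈ latticeSet p a (d + 1) e) :
    ∃ s ≤ e, e - s ≤ (d + 1) * a - 1 ∧ H.comap (snocZero d) ∈ latticeSet p a d s ∧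
      (H.map (lastCoord d)).index = p ^ (e - s) := by
  have hidx := index_eq_snocZero_mul H
  rw [hH.1] at hidx
  obtain ⟨s, hs, hs'⟩ := (Nat.dvd_prime_pow hp).1 (Dvd.intro _ hidx.symm)
  have ht : (H.map (lastCoord d)).index = p ^ (e - s) := by
    rw [hs', ← Nat.sub_add_cancel hs, pow_add, mul_comm] at hidx
    exact (Nat.eq_of_mul_eq_mul_left (pow_pos hp.pos s) hidx).symm
  refine ⟨s, hs, ?_, ⟨hs', fun l => ?_⟩, ht⟩
  · have h1 : ((p : ℤ) ^ ((d + 1) * a - 1)) ∈ H.map (lastCoord d) :=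
      ⟨_, hH.2 (Fin.last d), Pi.single_eq_same (M := fun _ => ℤ) (Fin.last d) _⟩
    rw [Int.mem_addSubgroup_iff_index_dvd, ht] at h1
    exact (Nat.pow_dvd_pow_iff_le_right hp.one_lt).1 (by exact_mod_cast h1)
  · have h1 := hH.2 l.castSucc
    rw [AddSubgroup.mem_comap]
    convert h1 using 1
    ext j
    refine Fin.lastCases ?_ (fun m => ?_) j
    · rw [Pi.single_eq_of_ne (Fin.castSucc_lt_last l).ne']
      exact Fin.snoc_last (α := fun _ => ℤ) _ _
    · refine (Fin.snoc_castSucc (α := fun _ => ℤ) _ _ m).trans ?_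
      by_cases hml : m = l
      · subst hml; simp
      · rw [Pi.single_eq_of_ne hml, Pi.single_eq_of_ne]
        exact fun h => hml (Fin.castSucc_injective _ h)

theorem ncard_latticeSet_succ_le {p a d e : ℕ} (hp : p.Prime) (T : Finset ℕ) (G : ℕ)
    (hT : ∀ s, (latticeSet p a d s).Nonempty → s ∈ T)
    (hG : ∀ s ≤ e, e - s ≤ (d + 1) * a - 1 → ∀ H₁ ∈ latticeSet p a d s,
      (latticeSet p a d s).ncard *
        {q : (Fin d → ℤ) ⧸ H₁ | (p ^ ((d + 1) * a - 1 - (e - s))) • q = 0}.ncard ≤ G) :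
    (latticeSet p a (d + 1) e).ncard ≤ T.card * G := by
  classical
  have hfinS : ∀ s, (latticeSet p a d s).Finite := latticeSet_finite hp a d
  have hsub : latticeSet p a (d + 1) e ⊆ ⋃ s ∈ T.filter fun s => s ≤ e ∧ e - s ≤ (d + 1) * a - 1,
      ⋃ H₁ ∈ (hfinS s).toFinset, {H ∈ latticeSet p a (d + 1) e | H.comap (snocZero d) = H₁ ∧
        (H.map (lastCoord d)).index = p ^ (e - s)} := by
    intro H hH
    obtain ⟨s, hs, hs2, h1, h2⟩ := latticeSet_succ hp hH
    simp only [Set.mem_iUnion]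
    exact ⟨s, mem_filter.2 ⟨hT s ⟨_, h1⟩, hs, hs2⟩, _, (hfinS s).mem_toFinset.2 h1, hH, rfl, h2⟩
  have hlfin := latticeSet_finite hp a (d + 1) e
  refine (Set.ncard_le_ncard hsub (hlfin.subset ?_)).trans ?_
  · intro H hH
    simp only [Set.mem_iUnion] at hH
    obtain ⟨_, _, _, _, h, _⟩ := hH
    exact h
  refine (Finset.set_ncard_biUnion_le _ _).trans ((Finset.sum_le_card_nsmul _ _ G ?_).trans ?_)
  · intro s hs
    obtain ⟨-, hs1, hs2⟩ := mem_filter.1 hs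
    refine (Finset.set_ncard_biUnion_le _ _).trans ?_
    have hle : ∀ H₁ ∈ (hfinS s).toFinset, {H ∈ latticeSet p a (d + 1) e |
        H.comap (snocZero d) = H₁ ∧ (H.map (lastCoord d)).index = p ^ (e - s)}.ncard *
          (latticeSet p a d s).ncard ≤ G := by
      intro H₁ hH₁
      rw [(hfinS s).mem_toFinset] at hH₁
      have hidx : H₁.index ≠ 0 := by rw [hH₁.1]; exact pow_ne_zero _ hp.ne_zero
      refine le_trans ?_ (hG s hs1 hs2 H₁ hH₁)
      rw [mul_comm]
      refine Nat.mul_le_mul_left _ (le_trans (Set.ncard_le_ncard ?_ ?_)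
        (ncard_extensions_le H₁ hidx hs2))
      · exact fun H hH => ⟨hH.2.1, hH.2.2, hH.1.2 (Fin.last d)⟩
      · refine (finite_addSubgroup_index (Fin (d + 1)) (N := H₁.index * p ^ (e - s))
          (mul_ne_zero hidx (pow_ne_zero _ hp.ne_zero))).subset fun H hH => ?_
        change H.index = _
        rw [index_eq_snocZero_mul, hH.1, hH.2.1]
    rcases Nat.eq_zero_or_pos (hfinS s).toFinset.card with h0 | h0
    · rw [Finset.card_eq_zero.1 h0, Finset.sum_empty]
      exact Nat.zero_le _
    · refine Nat.le_of_mul_le_mul_right ?_ h0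
      rw [Finset.sum_mul, mul_comm G]
      refine Finset.sum_le_card_nsmul _ _ G fun H₁ hH₁ => ?_
      rw [← Set.ncard_eq_toFinset_card _ (hfinS s)]
      exact hle H₁ hH₁
  · rw [smul_eq_mul]
    exact Nat.mul_le_mul_right _ (Finset.card_le_card (Finset.filter_subset _ _))

theorem latticeSet_zero {p a s : ℕ} (hp : p.Prime) (h : (latticeSet p a 0 s).Nonempty) : s = 0 := by
  obtain ⟨H, hH⟩ := h
  have h1 : H = ⊤ := eq_top_iff.2 fun x _ => by rw [Subsingleton.elim x 0]; exact H.zero_mem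
  have h2 := hH.1
  rw [h1, AddSubgroup.index_top] at h2
  exact (Nat.pow_eq_one.1 h2.symm).resolve_left hp.one_lt.ne'

theorem ncard_torsion_le_index {G : Type*} [AddCommGroup G] (H : AddSubgroup G) (hH : H.index ≠ 0)
    (u : ℕ) : {q : G ⧸ H | u • q = 0}.ncard ≤ H.index := by
  have : Finite (G ⧸ H) := AddSubgroup.index_ne_zero_iff_finite.1 hH
  exact Set.ncard_le_card _

theorem ncard_torsion_le_of_cyclic (H : AddSubgroup (Fin 1 → ℤ)) (hH : H.index ≠ 0)
    {u : ℕ} (hu : 0 < u) : {q : (Fin 1 → ℤ) ⧸ H | u • q = 0}.ncard ≤ u := by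
  classical
  have : Finite ((Fin 1 → ℤ) ⧸ H) := AddSubgroup.index_ne_zero_iff_finite.1 hH
  have : Fintype ((Fin 1 → ℤ) ⧸ H) := Fintype.ofFinite _
  have : IsAddCyclic ((Fin 1 → ℤ) ⧸ H) := by
    refine isAddCyclic_of_surjective (G' := ℤ) ((QuotientAddGroup.mk' H).comp
      (AddMonoidHom.single (fun _ : Fin 1 => ℤ) 0)) ?_
    intro q
    obtain ⟨x, rfl⟩ := QuotientAddGroup.mk'_surjective H q
    refine ⟨x 0, congrArg (QuotientAddGroup.mk' H) ?_⟩
    ext j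
    rw [Subsingleton.elim j 0]
    simp
  have h := IsAddCyclic.card_nsmul_eq_zero_le (α := (Fin 1 → ℤ) ⧸ H) hu
  rw [← Set.ncard_coe_finset] at h
  simpa using h

theorem latticeSet_zero_ncard {p a s : ℕ} : (latticeSet p a 0 s).ncard ≤ 1 := by
  rw [Set.ncard_le_one_iff]
  intro H H' _ _
  ext x
  rw [Subsingleton.elim x 0]
  exact iff_of_true H.zero_mem H'.zero_mem

theorem latticeSet_one_bound {p a e : ℕ} (hp : p.Prime) :
    (latticeSet p a 1 e).ncard ≤ 1 ∧ ((latticeSet p a 1 e).Nonempty → e ≤ a - 1) := by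
  constructor
  · refine (ncard_latticeSet_succ_le (d := 0) hp {0} 1 (fun s hs => ?_) ?_).trans (by simp)
    · simpa using latticeSet_zero hp hs
    · intro s _ _ H₁ hH₁
      have h0 := latticeSet_zero hp ⟨H₁, hH₁⟩
      have h1 : H₁.index = 1 := by rw [hH₁.1, h0, pow_zero]
      refine (Nat.mul_le_mul latticeSet_zero_ncard
        ((ncard_torsion_le_index H₁ (by omega) _).trans h1.le)).trans (by simp)
  · rintro ⟨H, hH⟩
    obtain ⟨s, hs, hs2, h1, -⟩ := latticeSet_succ hp hH
    have := latticeSet_zero hp ⟨_, h1⟩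
    omega

theorem latticeSet_two_bound {p a e : ℕ} (hp : p.Prime) (ha : 1 ≤ a) :
    (latticeSet p a 2 e).ncard ≤ a * p ^ (a - 1) ∧
      (latticeSet p a 2 e).ncard ≤ a * p ^ (3 * a - 2 - e) ∧
      ((latticeSet p a 2 e).Nonempty → e ≤ 3 * a - 2) := by
  have hT : ∀ s, (latticeSet p a 1 s).Nonempty → s ∈ range a := fun s hs => by
    have := (latticeSet_one_bound hp).2 hs
    rw [mem_range]
    omega
  refine ⟨?_, ?_, ?_⟩
  · refine (ncard_latticeSet_succ_le (d := 1) hp (range a) (p ^ (a - 1)) hT ?_).trans (by simp)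
    intro s _ _ H₁ hH₁
    have h0 := (latticeSet_one_bound hp).2 ⟨H₁, hH₁⟩
    have h1 : H₁.index ≠ 0 := by rw [hH₁.1]; exact pow_ne_zero _ hp.ne_zero
    refine (Nat.mul_le_mul (latticeSet_one_bound hp).1 (ncard_torsion_le_index H₁ h1 _)).trans ?_
    rw [one_mul, hH₁.1]
    exact Nat.pow_le_pow_right hp.pos h0
  · refine (ncard_latticeSet_succ_le (d := 1) hp (range a) (p ^ (3 * a - 2 - e)) hT ?_).trans
      (by simp)
    intro s hs hs2 H₁ hH₁
    have h0 := (latticeSet_one_bound hp).2 ⟨H₁, hH₁⟩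
    have h1 : H₁.index ≠ 0 := by rw [hH₁.1]; exact pow_ne_zero _ hp.ne_zero
    refine (Nat.mul_le_mul (latticeSet_one_bound hp).1
      (ncard_torsion_le_of_cyclic H₁ h1 (pow_pos hp.pos _))).trans ?_
    rw [one_mul]
    exact Nat.pow_le_pow_right hp.pos (by omega)
  · rintro ⟨H, hH⟩
    obtain ⟨s, hs, hs2, h1, -⟩ := latticeSet_succ hp hH
    have := (latticeSet_one_bound hp).2 ⟨_, h1⟩
    omega

theorem latticeSet_three_bound {p a e : ℕ} (hp : p.Prime) (ha : 1 ≤ a) :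
    (latticeSet p a 3 e).ncard ≤ 3 * a * (a * p ^ (3 * a - 2)) ∧
      ((latticeSet p a 3 e).Nonempty → e ≤ 6 * a - 3) := by
  constructor
  · refine (ncard_latticeSet_succ_le (d := 2) hp (range (3 * a)) (a * p ^ (3 * a - 2))
      (fun s hs => ?_) ?_).trans (by simp)
    · have := (latticeSet_two_bound hp ha).2.2 hs
      rw [mem_range]
      omega
    · intro s _ _ H₁ hH₁
      have h0 := (latticeSet_two_bound hp ha).2.2 ⟨H₁, hH₁⟩
      have h1 : H₁.index ≠ 0 := by rw [hH₁.1]; exact pow_ne_zero _ hp.ne_zero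
      refine (Nat.mul_le_mul (latticeSet_two_bound hp ha).2.1
        (ncard_torsion_le_index H₁ h1 _)).trans (le_of_eq ?_)
      rw [hH₁.1, mul_assoc, ← pow_add, Nat.sub_add_cancel h0]
  · rintro ⟨H, hH⟩
    obtain ⟨s, hs, hs2, h1, -⟩ := latticeSet_succ hp hH
    have := (latticeSet_two_bound hp ha).2.2 ⟨_, h1⟩
    omega

theorem pow_le_wt {p E m : ℕ} (hp : 1 ≤ p) (h : 34 * (E + 1) ≤ 33 * m) : (p : ℝ) ^ E ≤ wt p m := by
  have hm : ¬ m ≤ 1 := by omega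
  rw [wt, if_neg hm, ← Real.rpow_natCast]
  refine Real.rpow_le_rpow_of_exponent_le (by exact_mod_cast hp) ?_
  have : (34 * (E + 1) : ℝ) ≤ 33 * m := by exact_mod_cast h
  linarith

theorem ncard_layer_le_wt {X : Type*} [CommRing X] [Finite X] {p a i n d c g : ℕ} (hp : p.Prime)
    (ha : 1 ≤ a) (hdn : d ≤ n) (hpi : ∀ x : X, (p ^ i) • x = 0)
    (hpX : (pMul X p).index = p ^ (n + 1)) (h1 : (1 : X) ∉ pMul X p)
    (hc : 2 ^ (n - d) * c ≤ 8 * (a + 1) ^ 2)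
    (hb : (latticeSet p a d (i - d)).Nonempty → d ≤ i → (latticeSet p a d (i - d)).ncard ≤ c * p ^ g ∧
      34 * ((n - d) * i + g + 1) ≤ 33 * (n * a + i)) :
    ((layer X p a i d).ncard : ℝ) ≤ 8 * (a + 1) ^ 2 * wt p (n * a + i) := by
  have h0 := wt_nonneg p (n * a + i)
  have hl := ncard_layer_le hp ha hdn hpi hpX h1
  rcases (latticeSet p a d (i - d)).eq_empty_or_nonempty with he | he
  · rw [he, Set.ncard_empty, mul_zero, Nat.le_zero] at hl
    rw [hl]
    push_cast
    positivity
  rcases (layer X p a i d).eq_empty_or_nonempty with hl' | ⟨M, hM⟩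
  · rw [hl', Set.ncard_empty]
    push_cast
    positivity
  obtain ⟨h2, h3⟩ := hb he (le_of_mem_layer hp hM)
  have h4 : (layer X p a i d).ncard ≤ 8 * (a + 1) ^ 2 * p ^ ((n - d) * i + g) := by
    refine (hl.trans (Nat.mul_le_mul_left _ h2)).trans ?_
    calc _ = 2 ^ (n - d) * c * p ^ ((n - d) * i + g) := by ring
      _ ≤ _ := Nat.mul_le_mul_right _ hc
  calc ((layer X p a i d).ncard : ℝ) ≤ 8 * (a + 1) ^ 2 * (p : ℝ) ^ ((n - d) * i + g) := by
        exact_mod_cast h4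
    _ ≤ _ := by
        have := pow_le_wt hp.one_lt.le h3
        gcongr

theorem ncard_layer_le_wt_of_le_four {X : Type*} [CommRing X] [Finite X] {p a i n d : ℕ}
    (hp : p.Prime) (ha : 1 ≤ a) (hn : n ≤ 4) (hd : d ∈ Ico 1 n) (hpi : ∀ x : X, (p ^ i) • x = 0)
    (hpX : (pMul X p).index = p ^ (n + 1)) (h1 : (1 : X) ∉ pMul X p)
    (hex : ¬ (n = 4 ∧ d = 2 ∧ a = 1 ∧ i = 3)) :
    ((layer X p a i d).ncard : ℝ) ≤ 8 * (a + 1) ^ 2 * wt p (n * a + i) := by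
  rw [mem_Ico] at hd
  have hd' : d = 1 ∨ d = 2 ∨ d = 3 := by omega
  rcases hd' with rfl | rfl | rfl
  · refine ncard_layer_le_wt (c := 1) (g := 0) hp ha hd.2.le hpi hpX h1 ?_ fun he hi => ?_
    · have : 2 ^ (n - 1) ≤ 2 ^ 3 := Nat.pow_le_pow_right (by norm_num) (by omega)
      nlinarith
    · obtain ⟨h2, h3⟩ := latticeSet_one_bound (p := p) (a := a) (e := i - 1) hp
      refine ⟨by simpa using h2, ?_⟩
      have := h3 he
      have hn' : n = 2 ∨ n = 3 ∨ n = 4 := by omega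
      rcases hn' with rfl | rfl | rfl <;> omega
  · obtain ⟨h2, h3, h4⟩ := latticeSet_two_bound (p := p) (a := a) (e := i - 2) hp ha
    have hn' : n = 3 ∨ n = 4 := by omega
    rcases hn' with rfl | rfl
    · refine ncard_layer_le_wt (c := a) (g := a - 1) hp ha hd.2.le hpi hpX h1 ?_ fun he hi => ?_
      · norm_num; nlinarith
      · have := h4 he
        exact ⟨h2, by omega⟩
    · by_cases h5 : a = 1
      · subst h5
        refine ncard_layer_le_wt (c := 1) (g := 0) hp ha hd.2.le hpi hpX h1 (by norm_num)
          fun he hi => ⟨by simpa using h2, ?_⟩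
        have := h4 he
        omega
      · refine ncard_layer_le_wt (c := a) (g := 3 * a - 2 - (i - 2)) hp ha hd.2.le hpi hpX h1 ?_
          fun he hi => ⟨h3, ?_⟩
        · norm_num; nlinarith
        · have := h4 he
          omega
  · obtain ⟨h2, h3⟩ := latticeSet_three_bound (p := p) (a := a) (e := i - 3) hp ha
    obtain rfl : n = 4 := by omega
    refine ncard_layer_le_wt (c := 3 * a * a) (g := 3 * a - 2) hp ha hd.2.le hpi hpX h1 ?_
      fun he hi => ⟨by rwa [mul_assoc], ?_⟩
    · norm_num; nlinarith
    · have := h3 he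
      omega

/-- The crude bound for the exceptional layer. -/
theorem ncard_layer_exceptional_le {X : Type*} [CommRing X] [Finite X] {p : ℕ} (hp : p.Prime)
    (hpi : ∀ x : X, (p ^ 3) • x = 0) (hpX : (pMul X p).index = p ^ (4 + 1))
    (h1 : (1 : X) ∉ pMul X p) : (layer X p 1 3 2).ncard ≤ 4 * p ^ 6 := by
  have h2 := (latticeSet_two_bound (p := p) (a := 1) (e := 1) hp le_rfl).1
  refine (ncard_layer_le hp le_rfl (by norm_num) hpi hpX h1).trans ?_
  calc _ ≤ 2 ^ 2 * p ^ 6 * (1 * p ^ (1 - 1)) := Nat.mul_le_mul_left _ h2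
    _ = _ := by ring

theorem pow_six_mul_wt_le {p κ : ℕ} (hp : 1 ≤ p) (hκ : κ ≠ 0) :
    (p : ℝ) ^ 6 * wt p κ ≤ wt p (κ + 7) := by
  have hp' : (1 : ℝ) ≤ p := by exact_mod_cast hp
  by_cases h : κ ≤ 1
  · obtain rfl : κ = 1 := by omega
    have := pow_le_wt (E := 6) (m := 1 + 7) hp (by norm_num)
    simpa [wt] using this
  · rw [wt, wt, if_neg h, if_neg (by omega), ← Real.rpow_natCast,
      ← Real.rpow_add (by linarith)]
    refine Real.rpow_le_rpow_of_exponent_le hp' ?_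
    push_cast
    linarith

theorem ncard_preimage_mul_card_le {G H : Type*} [AddCommGroup G] [AddCommGroup H] [Finite G]
    [Finite H] (φ : G →+ H) (hφ : Function.Surjective φ) (Z : Set H) :
    (φ ⁻¹' Z).ncard * Nat.card H ≤ Z.ncard * Nat.card G := by
  obtain ⟨s, hs⟩ := hφ.hasRightInverse
  have h1 : Nat.card φ.ker * Nat.card H = Nat.card G := by
    rw [← AddSubgroup.card_mul_index φ.ker, AddSubgroup.index_ker,
      AddMonoidHom.range_eq_top.2 hφ, AddSubgroup.card_top]
  have h2 : (φ ⁻¹' Z).ncard ≤ (Z ×ˢ (φ.ker : Set G)).ncard := by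
    refine Set.ncard_le_ncard_of_injOn (fun g => (φ g, g - s (φ g))) ?_ ?_ (Set.toFinite _)
    · intro g hg
      refine ⟨hg, ?_⟩
      change φ (g - s (φ g)) = 0
      rw [map_sub, hs, sub_self]
    · intro g _ g' _ h
      have h3 := congrArg Prod.fst h
      have h4 := congrArg Prod.snd h
      dsimp only at h3 h4
      rw [h3] at h4
      exact sub_left_injective h4
  rw [Set.ncard_prod] at h2
  calc _ ≤ Z.ncard * (φ.ker : Set G).ncard * Nat.card H := Nat.mul_le_mul_right _ h2
    _ = _ := by rw [mul_assoc, ← h1]; rfl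

/-- The matrix with columns `1, x, x², y, xy`. -/
def monomialMatrix {R : Type*} [CommRing R] (x y : Fin 5 → R) : Matrix (Fin 5) (Fin 5) R :=
  Matrix.of fun j => ![1, x j, x j ^ 2, y j, x j * y j]

theorem map_det_monomialMatrix {R S : Type*} [CommRing R] [CommRing S] (f : R →+* S)
    (x y : Fin 5 → R) :
    f (monomialMatrix x y).det = (monomialMatrix (fun j => f (x j)) fun j => f (y j)).det := by
  rw [RingHom.map_det]
  congr 1
  ext j c
  fin_cases c <;> simp [monomialMatrix]

/-- The determinant of the generic matrix with columns `1, x, x², y, xy`. -/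
noncomputable def monomialDet (F : Type*) [Field F] : MvPolynomial (Fin (5 + 5)) F :=
  (monomialMatrix (fun j => MvPolynomial.X (Fin.castAdd 5 j))
    fun j => MvPolynomial.X (Fin.natAdd 5 j)).det

theorem monomialDet_ne_zero (F : Type*) [Field F] : monomialDet F ≠ 0 := by
  intro h
  have h1 := congrArg (MvPolynomial.aeval (R := F) (Fin.append
    (fun j : Fin 5 => (MvPolynomial.X j : MvPolynomial (Fin 5) F)) fun j => MvPolynomial.X j ^ 3)) h
  rw [map_zero] at h1
  have h2 := map_det_monomialMatrix ((MvPolynomial.aeval (R := F) (Fin.append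
    (fun j : Fin 5 => (MvPolynomial.X j : MvPolynomial (Fin 5) F))
      fun j => MvPolynomial.X j ^ 3)) : MvPolynomial (Fin (5 + 5)) F →+* MvPolynomial (Fin 5) F)
    (fun j => MvPolynomial.X (Fin.castAdd 5 j)) fun j => MvPolynomial.X (Fin.natAdd 5 j)
  have h3 : monomialMatrix (fun j : Fin 5 => (MvPolynomial.X j : MvPolynomial (Fin 5) F))
      (fun j => MvPolynomial.X j ^ 3) = Matrix.vandermonde fun j => MvPolynomial.X j := by
    ext1 j c
    fin_cases c <;> simp [monomialMatrix, Matrix.vandermonde_apply]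
    ring
  refine Matrix.det_vandermonde_ne_zero_iff.2 (MvPolynomial.X_injective (σ := Fin 5) (R := F)) ?_
  rw [← h3]
  refine Eq.trans ?_ (h2.symm.trans h1)
  congr 2 <;> ext1 j <;> simp [-Fin.natAdd_eq_addNat]

theorem totalDegree_monomialDet_le (F : Type*) [Field F] : (monomialDet F).totalDegree ≤ 10 := by
  rw [monomialDet, Matrix.det_apply]
  refine MvPolynomial.totalDegree_finsetSum_le fun σ _ => ?_
  rw [Units.smul_def]
  refine (MvPolynomial.totalDegree_smul_le _ _).trans
    ((MvPolynomial.totalDegree_finsetProd _ _).trans ?_)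
  calc _ ≤ ∑ i : Fin 5, 2 := Finset.sum_le_sum fun c _ => ?_
    _ = 10 := by simp
  fin_cases c
  · simp [monomialMatrix]
  · simp [monomialMatrix]
  · simp [monomialMatrix]
  · simp [monomialMatrix]
  · simp only [monomialMatrix, Matrix.of_apply]
    refine (MvPolynomial.totalDegree_mul _ _).trans ?_
    simp

theorem ncard_monomialDet_zeros_le (p : ℕ) [Fact p.Prime] :
    {w : Fin (5 + 5) → ZMod p | MvPolynomial.eval w (monomialDet (ZMod p)) = 0}.ncard ≤
      10 * p ^ 9 := by
  classical
  have h := MvPolynomial.schwartz_zippel_totalDegree (monomialDet_ne_zero (ZMod p)) Finset.univ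
  rw [Finset.card_univ, ZMod.card, Fintype.piFinset_univ] at h
  have hp : (0 : ℚ≥0) < p := by exact_mod_cast (Fact.out : p.Prime).pos
  have hdeg : ((monomialDet (ZMod p)).totalDegree : ℚ≥0) ≤ 10 := by
    exact_mod_cast totalDegree_monomialDet_le (ZMod p)
  rw [Set.ncard_eq_toFinset_card']
  have h2 := h.trans (div_le_div_of_nonneg_right hdeg hp.le)
  rw [div_le_div_iff₀ (by positivity) hp] at h2
  have h3 : (#{f : Fin (5 + 5) → ZMod p | MvPolynomial.eval f (monomialDet (ZMod p)) = 0} : ℚ≥0) ≤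
      10 * p ^ 9 := by
    refine le_of_mul_le_mul_right (h2.trans (le_of_eq ?_)) hp
    ring
  have h4 : #{f : Fin (5 + 5) → ZMod p | MvPolynomial.eval f (monomialDet (ZMod p)) = 0} ≤
      10 * p ^ 9 := by exact_mod_cast h3
  refine le_trans (le_of_eq ?_) h4
  congr 1
  ext w
  simp

theorem eval_monomialDet {F : Type*} [Field F] (w : Fin (5 + 5) → F) :
    MvPolynomial.eval w (monomialDet F) =
      (monomialMatrix (fun j => w (Fin.castAdd 5 j)) fun j => w (Fin.natAdd 5 j)).det := by
  rw [monomialDet, map_det_monomialMatrix]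
  simp

/-- If `1, x, x², y, xy` span `X` modulo `p`, a scaled subring containing `x` and `y` contains
all `p`-multiples. -/
theorem pMul_le_of_det_ne_zero {X : Type*} [CommRing X] {p i : ℕ} [Fact p.Prime]
    (hpi : ∀ x : X, (p ^ i) • x = 0) (π : X →+* (Fin 5 → ZMod p))
    (hker : ∀ x, π x = 0 → x ∈ pMul X p) {M : AddSubgroup X} (h1 : 1 ∈ M)
    (hM : ∀ x ∈ M, ∀ y ∈ M, (p ^ 1) • (x * y) ∈ M) {x y : X} (hx : x ∈ M) (hy : y ∈ M)
    (hdet : (monomialMatrix (π x) (π y)).det ≠ 0) : pMul X p ≤ M := by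
  refine le_of_forall_eq_add_nsmul hpi ?_
  rintro _ ⟨z, rfl⟩
  let u : Fin 5 → X := ![1, x, x ^ 2, y, x * y]
  have hu : ∀ c, p • u c ∈ M := by
    intro c
    fin_cases c
    · exact M.nsmul_mem h1 p
    · exact M.nsmul_mem hx p
    · simpa [u, sq] using hM x hx x hx
    · exact M.nsmul_mem hy p
    · simpa [u] using hM x hx y hy
  let c : Fin 5 → ZMod p := (monomialMatrix (π x) (π y))⁻¹.mulVec (π z)
  have hc : (monomialMatrix (π x) (π y)).mulVec c = π z := by
    rw [Matrix.mulVec_mulVec, Matrix.mul_nonsing_inv _ (isUnit_iff_ne_zero.2 hdet),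
      Matrix.one_mulVec]
  have hz : z - ∑ k, (c k).val • u k ∈ pMul X p := by
    refine hker _ ?_
    rw [map_sub, sub_eq_zero, ← hc, map_sum]
    ext j
    rw [Matrix.mulVec, dotProduct, Finset.sum_apply]
    refine Finset.sum_congr rfl fun k _ => ?_
    rw [map_nsmul, Pi.smul_apply, nsmul_eq_mul, ZMod.natCast_zmod_val, mul_comm]
    congr 1
    fin_cases k <;> simp [monomialMatrix, u]
  obtain ⟨t, ht⟩ := mem_pMul.1 hz
  refine ⟨p • ∑ k, (c k).val • u k, ?_, p • t, ⟨t, rfl⟩, ?_⟩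
  · rw [Finset.smul_sum]
    refine M.sum_mem fun k _ => ?_
    rw [smul_comm]
    exact M.nsmul_mem (hu k) _
  · rw [ht, ← smul_add, add_sub_cancel]
    rfl

theorem ncard_layer_exceptional_le_of_surjective {X : Type*} [CommRing X] [Finite X] {p : ℕ}
    [hp : Fact p.Prime]
    (hpi : ∀ x : X, (p ^ 3) • x = 0) (hpX : (pMul X p).index = p ^ (4 + 1))
    (h1 : (1 : X) ∉ pMul X p) (π : X →+* (Fin 5 → ZMod p)) (hπ : Function.Surjective π)
    (hker : ∀ x, π x = 0 → x ∈ pMul X p) : (layer X p 1 3 2).ncard ≤ 40 * p ^ 5 := by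
  let φ : (Fin (4 - 2) → X) →+ (Fin (5 + 5) → ZMod p) :=
    AddMonoidHom.mk' (fun v => Fin.append (π (v 0)) (π (v 1))) fun v w => by
      ext j
      refine Fin.addCases (fun j => ?_) (fun j => ?_) j <;>
        simp [-Fin.natAdd_eq_addNat]
  have hφ : Function.Surjective φ := by
    intro w
    obtain ⟨x, hx⟩ := hπ fun j => w (Fin.castAdd 5 j)
    obtain ⟨y, hy⟩ := hπ fun j => w (Fin.natAdd 5 j)
    refine ⟨![x, y], ?_⟩
    change Fin.append (π x) (π y) = w
    rw [hx, hy]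
    exact Fin.append_castAdd_natAdd
  let Z := {w : Fin (5 + 5) → ZMod p | MvPolynomial.eval w (monomialDet (ZMod p)) = 0}
  have hZ : Z.ncard ≤ 10 * p ^ 9 := ncard_monomialDet_zeros_le p
  have hV := ncard_preimage_mul_card_le φ hφ Z
  have hlat := (latticeSet_two_bound (p := p) (a := 1) (e := 1) hp.out le_rfl).1
  have hlat' : (latticeSet p 1 2 (3 - 2)).ncard ≤ 1 := by simpa using hlat
  have hmain := ncard_layer_mul_le (a := 1) (d := 2) hp.out le_rfl (by norm_num) hpi hpX h1
    (φ ⁻¹' Z) ?_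
  · have hcard : Nat.card (Fin (5 + 5) → ZMod p) = p ^ 10 := by simp
    have hcard' : Nat.card (Fin (4 - 2) → X) = Nat.card X ^ 2 := by simp [Nat.card_fun]
    rw [hcard, hcard'] at hV
    have hX : 0 < Nat.card X ^ 2 := pow_pos Nat.card_pos 2
    have hp0 := hp.out.pos
    have hV' : (φ ⁻¹' Z).ncard * p ≤ 10 * Nat.card X ^ 2 := by
      refine Nat.le_of_mul_le_mul_right (c := p ^ 9) ?_ (pow_pos hp0 9)
      calc _ = (φ ⁻¹' Z).ncard * p ^ 10 := by ring
        _ ≤ _ := hV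
        _ ≤ 10 * p ^ 9 * Nat.card X ^ 2 := Nat.mul_le_mul_right _ hZ
        _ = _ := by ring
    refine Nat.le_of_mul_le_mul_right (c := Nat.card X ^ 2 * p) ?_ (by positivity)
    calc _ = (layer X p 1 3 2).ncard * Nat.card X ^ (4 - 2) * p := by ring
      _ ≤ 2 ^ (4 - 2) * p ^ ((4 - 2) * 3) * ((φ ⁻¹' Z).ncard * 1) * p :=
        Nat.mul_le_mul_right _ (hmain.trans (Nat.mul_le_mul_left _ (Nat.mul_le_mul_left _ hlat')))
      _ = 4 * p ^ 6 * ((φ ⁻¹' Z).ncard * p) := by ring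
      _ ≤ 4 * p ^ 6 * (10 * Nat.card X ^ 2) := Nat.mul_le_mul_left _ hV'
      _ = _ := by ring
  · rintro v ⟨M, hM, hvM, -⟩
    by_contra hv
    have hdet : (monomialMatrix (π (v 0)) (π (v 1))).det ≠ 0 := by
      intro h0
      refine hv ?_
      change MvPolynomial.eval (Fin.append (π (v 0)) (π (v 1))) (monomialDet (ZMod p)) = 0
      rw [eval_monomialDet]
      simp only [Fin.append_left, Fin.append_right]
      exact h0
    have hle := pMul_le_of_det_ne_zero hpi π hker hM.1.2.1 hM.1.2.2.1 (hvM 0) (hvM 1) hdet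
    have hidx := hM.2
    rw [sup_of_le_left hle, hM.1.1] at hidx
    have := Nat.pow_right_injective hp.out.two_le hidx
    omega

theorem index_pMul_pi (ι : Type*) [Fintype ι] {N : ℕ} (hN : N ≠ 0) :
    (pMul (ι → ℤ) N).index = N ^ Fintype.card ι := by
  have : NeZero N := ⟨hN⟩
  let f : (ι → ℤ) →+* (ι → ZMod N) := RingHom.compLeft (Int.castRingHom (ZMod N)) ι
  have hf : Function.Surjective f.toAddMonoidHom := fun w =>
    ⟨fun j => (w j).val, by ext j; simp [f]⟩
  have hker : pMul (ι → ℤ) N = f.toAddMonoidHom.ker := by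
    ext x
    rw [mem_pMul, AddMonoidHom.mem_ker]
    constructor
    · rintro ⟨y, rfl⟩
      ext j
      simp [f]
    · intro h
      have h2 : ∀ j, (N : ℤ) ∣ x j := fun j => by
        have := congrFun h j
        exact (ZMod.intCast_zmod_eq_zero_iff_dvd _ _).1 this
      choose y hy using h2
      refine ⟨y, ?_⟩
      ext j
      rw [Pi.smul_apply, nsmul_eq_mul, hy j]
  rw [hker, AddSubgroup.index_ker, AddMonoidHom.range_eq_top.2 hf, AddSubgroup.card_top,
    Nat.card_fun, Nat.card_zmod, Nat.card_eq_fintype_card]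

theorem index_pMul_subring {ι : Type*} [Fintype ι] (K : Subring (ι → ℤ))
    (hK : K.toAddSubgroup.index ≠ 0) {N : ℕ} (hN : N ≠ 0) :
    (pMul K N).index = N ^ Fintype.card ι := by
  have hinj : Function.Injective (nsmulAddMonoidHom N : (ι → ℤ) →+ (ι → ℤ)) := fun x y h => by
    ext j
    have := congrFun h j
    simpa [hN] using this
  have hsub : Function.Injective K.subtype.toAddMonoidHom := Subtype.val_injective
  have h1 : (pMul K N).map K.subtype.toAddMonoidHom =
      K.toAddSubgroup.map (nsmulAddMonoidHom N : (ι → ℤ) →+ (ι → ℤ)) := by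
    ext x
    constructor
    · rintro ⟨_, ⟨y, rfl⟩, rfl⟩
      exact ⟨y, y.2, rfl⟩
    · rintro ⟨y, hy, rfl⟩
      exact ⟨N • ⟨y, hy⟩, ⟨⟨y, hy⟩, rfl⟩, rfl⟩
  have h2 := congrArg AddSubgroup.index h1
  have h3 : K.subtype.toAddMonoidHom.range = K.toAddSubgroup := by
    ext x
    exact ⟨fun ⟨y, hy⟩ => hy ▸ y.2, fun hx => ⟨⟨x, hx⟩, rfl⟩⟩
  rw [AddSubgroup.index_map, AddSubgroup.index_map, (AddMonoidHom.ker_eq_bot_iff _).2 hinj,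
    (AddMonoidHom.ker_eq_bot_iff _).2 hsub, sup_bot_eq, sup_bot_eq, h3, mul_comm] at h2
  have h4 := Nat.eq_of_mul_eq_mul_left (Nat.pos_of_ne_zero hK) h2
  rw [h4]
  exact index_pMul_pi ι hN

/-- The quotient of a ring by `p ^ i`. -/
abbrev QuotPow {A : Type*} [CommRing A] (K : Subring A) (p i : ℕ) : Type _ :=
  K ⧸ Ideal.span {((p : K) ^ i)}

theorem QuotPow.mk_eq_zero_iff {A : Type*} [CommRing A] {K : Subring A} {p i : ℕ} {x : K} :
    Ideal.Quotient.mk (Ideal.span {((p : K) ^ i)}) x = 0 ↔ ∃ y : K, (p ^ i) • y = x := by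
  rw [Ideal.Quotient.eq_zero_iff_mem, Ideal.mem_span_singleton']
  refine exists_congr fun y => ?_
  rw [nsmul_eq_mul, Nat.cast_pow, mul_comm]

theorem QuotPow.nsmul_eq_zero {A : Type*} [CommRing A] {K : Subring A} {p i : ℕ}
    (x : QuotPow K p i) : (p ^ i) • x = 0 := by
  obtain ⟨x, rfl⟩ := Ideal.Quotient.mk_surjective x
  rw [← map_nsmul]
  exact QuotPow.mk_eq_zero_iff.2 ⟨x, rfl⟩

theorem QuotPow.mk_mem_pMul_iff {A : Type*} [CommRing A] {K : Subring A} {p i j : ℕ} (hj : j ≤ i)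
    {x : K} : Ideal.Quotient.mk (Ideal.span {((p : K) ^ i)}) x ∈ pMul (QuotPow K p i) (p ^ j) ↔
      x ∈ pMul K (p ^ j) := by
  constructor
  · rintro ⟨y, hy⟩
    obtain ⟨y, rfl⟩ := Ideal.Quotient.mk_surjective y
    have h1 : Ideal.Quotient.mk (Ideal.span {((p : K) ^ i)}) (x - (p ^ j) • y) = 0 := by
      rw [map_sub, map_nsmul, ← hy]
      exact sub_self _
    obtain ⟨z, hz⟩ := QuotPow.mk_eq_zero_iff.1 h1
    refine ⟨y + (p ^ (i - j)) • z, ?_⟩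
    change (p ^ j) • (y + (p ^ (i - j)) • z) = x
    rw [smul_add, ← mul_smul, ← pow_add, Nat.add_sub_cancel' hj, hz, add_sub_cancel]
  · rintro ⟨y, rfl⟩
    exact ⟨Ideal.Quotient.mk _ y, (map_nsmul (Ideal.Quotient.mk _) _ _).symm⟩

theorem QuotPow.index_pMul {ι : Type*} [Fintype ι] {K : Subring (ι → ℤ)} {p i j : ℕ}
    (hK : K.toAddSubgroup.index ≠ 0) (hp : p ≠ 0) (hj : j ≤ i) :
    (pMul (QuotPow K p i) (p ^ j)).index = (p ^ j) ^ Fintype.card ι := by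
  rw [← index_pMul_subring K hK (pow_ne_zero j hp),
    ← AddSubgroup.index_comap_of_surjective (pMul (QuotPow K p i) (p ^ j))
      (f := (Ideal.Quotient.mk (Ideal.span {((p : K) ^ i)})).toAddMonoidHom)
      Ideal.Quotient.mk_surjective]
  congr 1
  ext x
  exact QuotPow.mk_mem_pMul_iff hj

theorem QuotPow.finite {ι : Type*} [Fintype ι] {K : Subring (ι → ℤ)} {p : ℕ} (i : ℕ)
    (hK : K.toAddSubgroup.index ≠ 0) (hp : p ≠ 0) : Finite (QuotPow K p i) := by
  have h := QuotPow.index_pMul (i := i) hK hp le_rfl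
  have h0 : pMul (QuotPow K p i) (p ^ i) = ⊥ := by
    refine (AddSubgroup.eq_bot_iff_forall _).2 ?_
    rintro _ ⟨y, rfl⟩
    exact QuotPow.nsmul_eq_zero y
  rw [h0, AddSubgroup.index_bot] at h
  exact Nat.finite_of_card_ne_zero (h ▸ pow_ne_zero _ (pow_ne_zero _ hp))

theorem QuotPow.one_notMem_pMul {ι : Type*} [Nonempty ι] {K : Subring (ι → ℤ)} {p i : ℕ}
    (hp : p.Prime) (hi : 1 ≤ i) : (1 : QuotPow K p i) ∉ pMul (QuotPow K p i) p := by
  intro h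
  rw [← map_one (Ideal.Quotient.mk (Ideal.span {((p : K) ^ i)}))] at h
  have h' := (QuotPow.mk_mem_pMul_iff (j := 1) hi).1 (by rwa [pow_one])
  rw [pow_one] at h'
  obtain ⟨y, hy⟩ := h'
  obtain ⟨j⟩ := ‹Nonempty ι›
  have h2 : (p : ℤ) * y.1 j = 1 := by
    have := congrFun (congrArg Subtype.val hy) j
    change (p • y.1) j = 1 at this
    rwa [Pi.smul_apply, nsmul_eq_mul] at this
  have h3 : (p : ℤ) ∣ 1 := ⟨_, h2.symm⟩
  have h4 : p ∣ 1 := by exact_mod_cast h3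
  exact hp.one_lt.ne' (Nat.dvd_one.1 h4)

theorem le_of_mem_scaledSubrings {A : Type*} [CommRing A] {p a j : ℕ} {K : Subring A}
    {M : AddSubgroup A} (hM : M ∈ scaledSubrings p a j K) : M ≤ K.toAddSubgroup := fun x hx => by
  change x ∈ K
  rw [← hM.2.2.2]
  exact Subring.subset_closure hx

/-- The image in the quotient by `p ^ i` of a subgroup contained in `K`. -/
def quotImage {A : Type*} [CommRing A] (K : Subring A) (p i : ℕ) (M : AddSubgroup A) :
    AddSubgroup (QuotPow K p i) :=
  (M.comap K.subtype.toAddMonoidHom).map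
    (Ideal.Quotient.mk (Ideal.span {((p : K) ^ i)})).toAddMonoidHom

theorem index_comap_subtype {A : Type*} [CommRing A] {K : Subring A} {p a i κ : ℕ} (hp : p.Prime)
    (hK : K.toAddSubgroup.index = p ^ κ) {M : AddSubgroup A}
    (hM : M ∈ scaledSubrings p a (κ + i) K) :
    (M.comap K.subtype.toAddMonoidHom).index = p ^ i := by
  have h1 := AddSubgroup.relIndex_mul_index (le_of_mem_scaledSubrings hM)
  have h3 : K.subtype.toAddMonoidHom.range = K.toAddSubgroup := by
    ext x
    exact ⟨fun ⟨y, hy⟩ => hy ▸ y.2, fun hx => ⟨⟨x, hx⟩, rfl⟩⟩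
  rw [AddSubgroup.index_comap, h3]
  rw [hM.1, hK, pow_add, mul_comm] at h1
  exact Nat.eq_of_mul_eq_mul_left (pow_pos hp.pos κ) h1

theorem ker_le_comap_subtype {A : Type*} [CommRing A] {K : Subring A} {p a i κ : ℕ} (hp : p.Prime)
    (hK : K.toAddSubgroup.index = p ^ κ) {M : AddSubgroup A}
    (hM : M ∈ scaledSubrings p a (κ + i) K) :
    (Ideal.Quotient.mk (Ideal.span {((p : K) ^ i)})).toAddMonoidHom.ker ≤
      M.comap K.subtype.toAddMonoidHom := by
  intro x hx
  obtain ⟨y, rfl⟩ := QuotPow.mk_eq_zero_iff.1 hx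
  rw [← index_comap_subtype hp hK hM]
  exact AddSubgroup.nsmul_index_mem _ y

theorem quotImage_mem {A : Type*} [CommRing A] {K : Subring A} {p a i κ : ℕ} (hp : p.Prime)
    (hK : K.toAddSubgroup.index = p ^ κ) {M : AddSubgroup A}
    (hM : M ∈ scaledSubrings p a (κ + i) K) :
    quotImage K p i M ∈ scaledSubrings p a i (⊤ : Subring (QuotPow K p i)) := by
  refine ⟨?_, ⟨1, hM.2.1, map_one (Ideal.Quotient.mk _)⟩, ?_, ?_⟩
  · rw [quotImage, AddSubgroup.index_map, sup_of_le_left (ker_le_comap_subtype hp hK hM),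
      index_comap_subtype hp hK hM, AddMonoidHom.range_eq_top.2 Ideal.Quotient.mk_surjective,
      AddSubgroup.index_top, mul_one]
  · rintro _ ⟨x, hx, rfl⟩ _ ⟨y, hy, rfl⟩
    refine ⟨(p ^ a) • (x * y), hM.2.2.1 _ hx _ hy, ?_⟩
    change Ideal.Quotient.mk _ ((p ^ a) • (x * y)) = (p ^ a) • (Ideal.Quotient.mk _ x *
      Ideal.Quotient.mk _ y)
    rw [map_nsmul, map_mul]
  · have h1 : Subring.closure ((M.comap K.subtype.toAddMonoidHom : AddSubgroup K) : Set K) = ⊤ := by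
      have h2 := RingHom.map_closure K.subtype
        ((M.comap K.subtype.toAddMonoidHom : AddSubgroup K) : Set K)
      have h3 : K.subtype '' ((M.comap K.subtype.toAddMonoidHom : AddSubgroup K) : Set K) = M := by
        ext x
        exact ⟨fun ⟨y, hy, hyx⟩ => hyx ▸ hy,
          fun hx => ⟨⟨x, le_of_mem_scaledSubrings hM hx⟩, hx, rfl⟩⟩
      rw [h3, hM.2.2.2] at h2
      refine eq_top_iff.2 fun x _ => ?_
      obtain ⟨y, hy, hyx⟩ := h2.ge x.2
      rwa [← Subtype.ext hyx]
    have h2 := RingHom.map_closure (Ideal.Quotient.mk (Ideal.span {((p : K) ^ i)}))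
      ((M.comap K.subtype.toAddMonoidHom : AddSubgroup K) : Set K)
    rw [h1, ← RingHom.range_eq_map, RingHom.range_eq_top.2 Ideal.Quotient.mk_surjective] at h2
    exact h2.symm

theorem quotImage_injOn {A : Type*} [CommRing A] {K : Subring A} {p a i κ : ℕ} (hp : p.Prime)
    (hK : K.toAddSubgroup.index = p ^ κ) :
    Set.InjOn (quotImage K p i) (scaledSubrings p a (κ + i) K) := by
  have key : ∀ M ∈ scaledSubrings p a (κ + i) K,
      ((quotImage K p i M).comap
        (Ideal.Quotient.mk (Ideal.span {((p : K) ^ i)})).toAddMonoidHom).map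
        K.subtype.toAddMonoidHom = M := by
    intro M hM
    rw [quotImage, AddSubgroup.comap_map_eq, sup_of_le_left (ker_le_comap_subtype hp hK hM)]
    ext x
    exact ⟨fun ⟨y, hy, hyx⟩ => hyx ▸ hy,
      fun hx => ⟨⟨x, le_of_mem_scaledSubrings hM hx⟩, hx, rfl⟩⟩
  intro M hM M' hM' h
  rw [← key M hM, ← key M' hM', h]

theorem ncard_scaledSubrings_le_sum {ι : Type*} [Fintype ι] {K : Subring (ι → ℤ)}
    {p a i κ n : ℕ} (hp : p.Prime) (hι : Fintype.card ι = n + 1) (hi : 1 ≤ i)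
    (hK : K.toAddSubgroup.index = p ^ κ) :
    (scaledSubrings p a (κ + i) K).ncard ≤
      ∑ d ∈ Ico 1 n, (layer (QuotPow K p i) p a i d).ncard := by
  have hK0 : K.toAddSubgroup.index ≠ 0 := hK ▸ pow_ne_zero κ hp.ne_zero
  have : Nonempty ι := Fintype.card_pos_iff.1 (by omega)
  have := QuotPow.finite i hK0 hp.ne_zero
  have hpX : (pMul (QuotPow K p i) p).index = p ^ (n + 1) := by
    have := QuotPow.index_pMul (i := i) (j := 1) hK0 hp.ne_zero hi
    rwa [pow_one, hι] at this
  refine (Set.ncard_le_ncard_of_injOn (t := ⋃ d ∈ Ico 1 n, layer (QuotPow K p i) p a i d)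
    (quotImage K p i) (fun M hM => ?_) (quotImage_injOn hp hK) (Set.toFinite _)).trans
    (Finset.set_ncard_biUnion_le _ _)
  obtain ⟨d, hd, hMd⟩ := exists_layer hp hi QuotPow.nsmul_eq_zero hpX
    (QuotPow.one_notMem_pMul hp hi) (quotImage_mem hp hK hM)
  exact Set.mem_biUnion hd hMd

/-- Reduction modulo `p` of the five coordinates. -/
def reduceMod {ι : Type*} (e : Fin 5 ≃ ι) (p : ℕ) (K : Subring (ι → ℤ)) :
    K →+* (Fin 5 → ZMod p) :=
  (RingHom.compLeft (Int.castRingHom (ZMod p)) (Fin 5)).comp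
    ((RingHom.pi fun j => Pi.evalRingHom (fun _ : ι => ℤ) (e j)).comp K.subtype)

theorem reduceMod_apply {ι : Type*} (e : Fin 5 ≃ ι) (p : ℕ) (K : Subring (ι → ℤ)) (x : K)
    (j : Fin 5) : reduceMod e p K x j = (x.1 (e j) : ZMod p) := rfl

theorem exists_reduction {ι : Type*} [Fintype ι] (hι : Fintype.card ι = 5) {p i : ℕ}
    [Fact p.Prime] (hi : 1 ≤ i) {K : Subring (ι → ℤ)} (hK : K.toAddSubgroup.index = 1) :
    ∃ π : QuotPow K p i →+* (Fin 5 → ZMod p), Function.Surjective π ∧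
      ∀ x, π x = 0 → x ∈ pMul (QuotPow K p i) p := by
  have hmem : ∀ x, x ∈ K := fun x => by
    have h := AddSubgroup.index_eq_one.1 hK
    change x ∈ K.toAddSubgroup
    rw [h]
    exact AddSubgroup.mem_top x
  let e : Fin 5 ≃ ι := (Fintype.equivFinOfCardEq hι).symm
  have hlift : ∀ x ∈ Ideal.span {((p : K) ^ i)}, reduceMod e p K x = 0 := by
    intro x hx
    obtain ⟨y, rfl⟩ := Ideal.mem_span_singleton'.1 hx
    rw [map_mul, map_pow, map_natCast]
    have h0 : ((p : ℕ) : Fin 5 → ZMod p) = 0 := by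
      ext j
      simp
    rw [h0, zero_pow (by omega), mul_zero]
  refine ⟨Ideal.Quotient.lift _ (reduceMod e p K) hlift, ?_, ?_⟩
  · intro w
    refine ⟨Ideal.Quotient.mk _ ⟨fun k => ((w (e.symm k)).val : ℤ), hmem _⟩, ?_⟩
    rw [Ideal.Quotient.lift_mk]
    ext j
    rw [reduceMod_apply]
    simp
  · intro x hx
    obtain ⟨x, rfl⟩ := Ideal.Quotient.mk_surjective x
    rw [Ideal.Quotient.lift_mk] at hx
    have h2 : ∀ k, (p : ℤ) ∣ x.1 k := fun k => by
      have := congrFun hx (e.symm k)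
      rw [reduceMod_apply, e.apply_symm_apply] at this
      exact (ZMod.intCast_zmod_eq_zero_iff_dvd _ _).1 this
    choose y hy using h2
    have h3 : x = p • (⟨y, hmem y⟩ : K) := by
      refine Subtype.ext (funext fun k => ?_)
      change x.1 k = (p • y) k
      rw [Pi.smul_apply, nsmul_eq_mul, hy k]
    refine ⟨Ideal.Quotient.mk _ ⟨y, hmem y⟩, ?_⟩
    rw [h3, map_nsmul]
    rfl

theorem ncard_layer_mul_wt_le {ι : Type*} [Fintype ι] {K : Subring (ι → ℤ)}
    {p a i κ n d : ℕ} (hp : p.Prime) (hn : n ≤ 4) (hι : Fintype.card ι = n + 1) (ha : 1 ≤ a)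
    (hi : 1 ≤ i) (hK : K.toAddSubgroup.index = p ^ κ) (hd : d ∈ Ico 1 n) :
    ((layer (QuotPow K p i) p a i d).ncard : ℝ) * wt p κ ≤
      40 * (a + 1) ^ 2 * wt p (n * a + (κ + i)) := by
  have hK0 : K.toAddSubgroup.index ≠ 0 := hK ▸ pow_ne_zero κ hp.ne_zero
  have : Nonempty ι := Fintype.card_pos_iff.1 (by omega)
  have := QuotPow.finite i hK0 hp.ne_zero
  have hpX : (pMul (QuotPow K p i) p).index = p ^ (n + 1) := by
    have := QuotPow.index_pMul (i := i) (j := 1) hK0 hp.ne_zero hi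
    rwa [pow_one, hι] at this
  have hone := QuotPow.one_notMem_pMul (K := K) hp hi
  have hp1 := hp.one_lt.le
  have hw := wt_nonneg p κ
  by_cases hex : n = 4 ∧ d = 2 ∧ a = 1 ∧ i = 3
  · obtain ⟨rfl, rfl, rfl, rfl⟩ := hex
    have hw' := wt_nonneg p (κ + 7)
    have hfin : (4 * (p : ℝ) ^ 6) * wt p κ ≤ 40 * ((1 : ℕ) + 1) ^ 2 * wt p (κ + 7) ∨ κ = 0 := by
      by_cases hκ : κ = 0
      · exact Or.inr hκ
      · left
        have := pow_six_mul_wt_le hp1 hκ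
        push_cast
        nlinarith
    rw [show 4 * 1 + (κ + 3) = κ + 7 by ring]
    rcases hfin with hfin | rfl
    · refine le_trans (mul_le_mul_of_nonneg_right ?_ hw) hfin
      exact_mod_cast ncard_layer_exceptional_le hp QuotPow.nsmul_eq_zero hpX hone
    · have := Fact.mk hp
      obtain ⟨π, hπ, hker⟩ := exists_reduction (p := p) (i := 3) hι (by norm_num)
        (hK.trans (pow_zero p))
      have h1 := ncard_layer_exceptional_le_of_surjective QuotPow.nsmul_eq_zero hpX hone π hπ hker
      have h2 : ((layer (QuotPow K p 3) p 1 3 2).ncard : ℝ) ≤ 40 * (p : ℝ) ^ 5 := by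
        exact_mod_cast h1
      have h3 := pow_le_wt (E := 5) (m := 0 + 7) hp1 (by norm_num)
      rw [show wt p 0 = 1 by simp [wt], mul_one]
      push_cast
      linarith
  · have h1 := ncard_layer_le_wt_of_le_four hp ha hn hd QuotPow.nsmul_eq_zero hpX hone hex
    have h2 := wt_mul_le hp1 (n * a + i) κ
    rw [show n * a + i + κ = n * a + (κ + i) by ring] at h2
    calc _ ≤ 8 * (a + 1) ^ 2 * wt p (n * a + i) * wt p κ := mul_le_mul_of_nonneg_right h1 hw
      _ = 8 * (a + 1) ^ 2 * (wt p (n * a + i) * wt p κ) := by ring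
      _ ≤ 40 * (a + 1) ^ 2 * (wt p (n * a + i) * wt p κ) := by
        have := wt_nonneg p (n * a + i)
        gcongr
        norm_num
      _ ≤ _ := by gcongr

theorem ncard_scaledSubrings_zero_le {ι : Type*} {K : Subring (ι → ℤ)} {p a κ : ℕ}
    (hp : p.Prime) (hK : K.toAddSubgroup.index = p ^ κ) :
    (scaledSubrings p a (κ + 0) K).ncard ≤ 1 := by
  have key : scaledSubrings p a (κ + 0) K ⊆ {K.toAddSubgroup} := by
    intro M hM
    have h := index_comap_subtype hp hK hM
    rw [pow_zero, AddSubgroup.index_eq_one] at h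
    refine le_antisymm (le_of_mem_scaledSubrings hM) fun x hx => ?_
    have : (⟨x, hx⟩ : K) ∈ M.comap K.subtype.toAddMonoidHom := h ▸ AddSubgroup.mem_top _
    exact this
  exact (Set.ncard_le_ncard key).trans (Set.ncard_singleton _).le

theorem scaledBound_of_le_four {n : ℕ} (hn : n ≤ 4) : ScaledBound n := by
  refine ⟨160, by norm_num, 2, fun p hp ι _ hι a i κ ha K hK => ?_⟩
  have hw := wt_nonneg p κ
  have hw' := wt_nonneg p (n * a + (κ + i))
  rcases Nat.eq_zero_or_pos i with rfl | hi
  · have h1 : ((scaledSubrings p a (κ + 0) K).ncard : ℝ) ≤ 1 := by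
      exact_mod_cast ncard_scaledSubrings_zero_le hp hK
    have h2 : wt p κ ≤ wt p (n * a + (κ + 0)) := wt_mono hp.one_lt.le (by omega)
    have h3 : (1 : ℝ) ≤ 160 * (a + 1) ^ 2 := by nlinarith [Nat.cast_nonneg (α := ℝ) a]
    calc _ ≤ 1 * wt p κ := mul_le_mul_of_nonneg_right h1 hw
      _ ≤ _ := mul_le_mul h3 h2 hw (by positivity)
  · have h1 : ((scaledSubrings p a (κ + i) K).ncard : ℝ) ≤
        ∑ d ∈ Ico 1 n, ((layer (QuotPow K p i) p a i d).ncard : ℝ) := by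
      exact_mod_cast ncard_scaledSubrings_le_sum hp hι hi hK
    calc _ ≤ ∑ d ∈ Ico 1 n, ((layer (QuotPow K p i) p a i d).ncard : ℝ) * wt p κ := by
          rw [← Finset.sum_mul]
          exact mul_le_mul_of_nonneg_right h1 hw
      _ ≤ ∑ d ∈ Ico 1 n, 40 * (a + 1) ^ 2 * wt p (n * a + (κ + i)) :=
          Finset.sum_le_sum fun d hd => ncard_layer_mul_wt_le hp hn hι ha hi hK hd
      _ = ((n - 1 : ℕ) : ℝ) * (40 * (a + 1) ^ 2 * wt p (n * a + (κ + i))) := by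
          rw [Finset.sum_const, Nat.card_Ico, nsmul_eq_mul]
      _ ≤ 4 * (40 * (a + 1) ^ 2 * wt p (n * a + (κ + i))) := by
          have : ((n - 1 : ℕ) : ℝ) ≤ 4 := by exact_mod_cast (by omega : n - 1 ≤ 4)
          gcongr
      _ = _ := by ring

theorem subringBound_of_le_one {m : ℕ} (hm : m ≤ 1) : SubringBound m := by
  refine ⟨1, zero_le_one, 0, fun p hp ι _ hι k => ?_⟩
  have hsub : Subsingleton ι := Fintype.card_le_one_iff_subsingleton.1 (hι ▸ hm)
  have htop : ∀ R : Subring (ι → ℤ), R = ⊤ := by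
    intro R
    refine eq_top_iff.2 fun x _ => ?_
    rcases isEmpty_or_nonempty ι with hι' | ⟨⟨j⟩⟩
    · rw [Subsingleton.elim x 0]
      exact R.zero_mem
    · have : x = ((x j : ℤ) : ι → ℤ) := by
        ext k
        rw [Subsingleton.elim k j]
        simp
      rw [this]
      exact intCast_mem R _
  have h1 : numSubrings ι (p ^ k) ≤ 1 := by
    rw [numSubrings_eq_ncard]
    exact (Set.ncard_le_ncard (t := {⊤}) fun R _ => htop R).trans (Set.ncard_singleton _).le
  have h2 : (numSubrings ι (p ^ k) : ℝ) ≤ 1 := by exact_mod_cast h1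
  have := one_le_wt hp.one_lt.le k
  linarith

theorem subringBound_of_le_five (m : ℕ) : m ≤ 5 → SubringBound m := by
  induction m using Nat.strong_induction_on with
  | _ m ih =>
    intro hm
    by_cases h1 : m ≤ 1
    · exact subringBound_of_le_one h1
    · obtain ⟨n, rfl⟩ : ∃ n, m = n + 1 := ⟨m - 1, by omega⟩
      exact subringBound_succ (by omega) (fun m' hm' => ih m' hm' (by omega))
        (scaledBound_of_le_four (by omega))

theorem locBound_numSubrings_five :
    LocBound fun p k => (numSubrings (Fin 5) (p ^ k) : ℝ) := by
  obtain ⟨C, hC, D, h⟩ := subringBound_of_le_five 5 le_rfl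
  refine ⟨C, hC, D, fun p hp k => ?_⟩
  rw [abs_of_nonneg (Nat.cast_nonneg _)]
  exact h p hp (Fin 5) (Fintype.card_fin 5) k

/-- The number of subrings of `ℤ ^ 5` of given index, as an arithmetic function. -/
noncomputable def subringCount : ArithmeticFunction ℝ :=
  ⟨fun n => if n = 0 then 0 else numSubrings (Fin 5) n, by simp⟩

theorem subringCount_apply {n : ℕ} (hn : n ≠ 0) : subringCount n = numSubrings (Fin 5) n := by
  simp [subringCount, hn]

theorem isMultiplicative_subringCount : subringCount.IsMultiplicative := by
  rw [ArithmeticFunction.IsMultiplicative.iff_ne_zero]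
  refine ⟨by rw [subringCount_apply one_ne_zero, numSubrings_one, Nat.cast_one],
    fun {m n} hm hn hc => ?_⟩
  rw [subringCount_apply hm, subringCount_apply hn, subringCount_apply (mul_ne_zero hm hn),
    numSubrings_mul _ hc hm hn, Nat.cast_mul]

theorem subringCount_nonneg (n : ℕ) : 0 ≤ subringCount n := by
  rcases eq_or_ne n 0 with rfl | hn
  · simp
  · rw [subringCount_apply hn]; positivity

theorem numOrdersZ_eq_summatory (B : ℝ) : (numOrdersZ 5 B : ℝ) = summatory subringCount B := by
  classical
  set T : Set (Subring (Fin 5 → ℤ)) :=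
    {O | O.toAddSubgroup.index ≠ 0 ∧ (O.toAddSubgroup.index : ℝ) ≤ B} with hT
  have hmem : ∀ O, O ∈ T ↔ O.toAddSubgroup.index ∈ Ioc 0 ⌊B⌋₊ := by
    intro O
    rw [Finset.mem_Ioc]
    refine ⟨fun h => ⟨Nat.pos_of_ne_zero h.1, Nat.le_floor h.2⟩, fun h => ⟨h.1.ne', ?_⟩⟩
    exact (Nat.le_floor_iff' h.1.ne').1 h.2
  have hfin : T.Finite := by
    refine ((Ioc 0 ⌊B⌋₊).finite_toSet.biUnion
      fun n hn => finite_subring_index (Fin 5) (N := n) ?_).subset fun O hO => ?_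
    · exact (Finset.mem_Ioc.1 hn).1.ne'
    · exact Set.mem_biUnion ((hmem O).1 hO) rfl
  have h1 : numOrdersZ 5 B = hfin.toFinset.card := by
    rw [← Set.ncard_eq_toFinset_card T hfin]; rfl
  rw [h1, Finset.card_eq_sum_card_fiberwise (f := fun O => O.toAddSubgroup.index)
    (t := Ioc 0 ⌊B⌋₊) fun O hO => (hmem O).1 (hfin.mem_toFinset.1 hO), summatory]
  push_cast
  refine Finset.sum_congr rfl fun n hn => ?_
  rw [subringCount_apply (Finset.mem_Ioc.1 hn).1.ne', numSubrings]
  congr 1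
  rw [← Set.ncard_coe_finset]
  change _ = {R : Subring (Fin 5 → ℤ) | R.toAddSubgroup.index = n}.ncard
  congr 1
  ext O
  simp only [Finset.coe_filter, Set.Finite.mem_toFinset, hmem, Set.mem_ofPred_eq]
  exact ⟨fun h => h.2, fun h => ⟨h ▸ hn, h⟩⟩

theorem exists_polynomial_numOrdersZ
    (hb : LocBound fun p k => (numSubrings (Fin 5) (p ^ k) : ℝ)) :
    ∃ P : Polynomial ℝ, P.degree = 9 ∧ ∀ ε : ℝ, 0 < ε → ∃ C : ℝ, 0 < C ∧
      ∀ᶠ B : ℝ in Filter.atTop,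
        |(numOrdersZ 5 B : ℝ) - B * P.eval (Real.log B)| ≤ C * B ^ (33 / 34 + ε) := by
  have hb' : LocBound fun p k => subringCount (p ^ k) := by
    obtain ⟨C, hC, D, h⟩ := hb
    exact ⟨C, hC, D, fun p hp k => by
      beta_reduce
      rw [subringCount_apply (pow_ne_zero _ hp.ne_zero)]; exact h p hp k⟩
  obtain ⟨P, hP, hE⟩ := exists_polynomial_of_locBound isMultiplicative_subringCount
    subringCount_nonneg (fun p hp => by
      rw [subringCount_apply hp.ne_zero, numSubrings_prime hp]; norm_num) hb'
  refine ⟨P, hP, fun ε hε => ?_⟩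
  obtain ⟨C, hC0, hC⟩ := hE.nonneg_const (s := 1 / 34 - ε) (by linarith)
  refine ⟨C + 1, by linarith, Filter.eventually_atTop.2 ⟨1, fun B hB => ?_⟩⟩
  have hB0 : 0 < B := by linarith
  have h1 := hC B hB
  rw [numOrdersZ_eq_summatory]
  have h2 : summatory subringCount B - B * P.eval (Real.log B) =
      B * (summatory subringCount B / B - P.eval (Real.log B)) := by
    field_simp
  rw [h2, abs_mul, abs_of_pos hB0]
  calc B * |summatory subringCount B / B - P.eval (Real.log B)|
      ≤ B * (C * B ^ (-(1 / 34 - ε))) := by gcongr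
    _ = C * B ^ (33 / 34 + ε) := by
        rw [mul_left_comm]
        congr 1
        conv_lhs => rw [← Real.rpow_one_add' hB0.le (by linarith)]
        congr 1; ring
    _ ≤ (C + 1) * B ^ (33 / 34 + ε) := by
        have := Real.rpow_nonneg hB0.le (33 / 34 + ε)
        nlinarith

end

/-- There is a real polynomial `P₅` of degree `9` such that for every `ε > 0`,
`N₅(B) = B · P₅(log B) + O_ε(B^(33/34 + ε))` as `B → ∞`. -/
theorem stmt9 :
    ∃ P : Polynomial ℝ, P.degree = 9 ∧
      ∀ ε : ℝ, 0 < ε → ∃ C : ℝ, 0 < C ∧ ∀ᶠ B : ℝ in Filter.atTop,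
        |(numOrdersZ 5 B : ℝ) - B * P.eval (Real.log B)| ≤ C * B ^ (33 / 34 + ε) :=
  exists_polynomial_numOrdersZ locBound_numSubrings_five
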